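/- For all t ∈ ℝ and all F, G, H, F¹, F², F³ : ℝ×𝕋 → ℂ: ‖N^t[F,G,H]‖_S ≲ (1+|t|)^{−1}‖F‖_S‖G‖_S‖H‖_S, and ‖N^t[F¹,F²,F³]‖_{S⁺} ≲ (1+|t|)^{−1} max_{{j,k,ℓ}={1,2,3}} ‖F^j‖_{S⁺}‖F^k‖_S‖F^ℓ‖_S. -/

import Mathlib

open scoped ENNReal NNReal BigOperators
open MeasureTheory Filter

noncomputable section

/-- A function on the cylinder `ℝ × 𝕋` represented through the family of its
Fourier coefficients in the periodic variable `y`: `F p : ℝ → ℂ` is `x ↦ F_p(x)`. -/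
abbrev FunRT : Type := ℤ → ℝ → ℂ

/-- Fourier transform in `x` (convention `ĝ(ξ) = ∫ e^{-ixξ} g(x) dx`). -/
def ftx (f : ℝ → ℂ) (ξ : ℝ) : ℂ := ∫ x : ℝ, Complex.exp (-(Complex.I * x * ξ)) * f x

/-- Inverse Fourier transform in `x`. -/
def iftx (g : ℝ → ℂ) (x : ℝ) : ℂ :=
  ((2 * Real.pi : ℝ) : ℂ)⁻¹ * ∫ ξ : ℝ, Complex.exp (Complex.I * x * ξ) * g ξ

/-- The free Schrödinger propagator `e^{it∂_xx}` on `ℝ`, as the Fourier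
multiplier `e^{-itξ²}`. -/
def schro (t : ℝ) (f : ℝ → ℂ) : ℝ → ℂ :=
  iftx fun ξ => Complex.exp (-(Complex.I * t * ξ ^ 2)) * ftx f ξ

/-- `e^{itA}` with `A = ∂_xx − |D_y|`. -/
def expA (t : ℝ) (F : FunRT) : FunRT :=
  fun p x => Complex.exp (-(Complex.I * t * |(p : ℝ)|)) * schro t (F p) x

/-- Pointwise product of functions on `ℝ × 𝕋` (convolution of the
`y`-Fourier coefficients). -/
def mulF (F G : FunRT) : FunRT := fun p x => ∑' q : ℤ, F q x * G (p - q) x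

/-- Complex conjugate of a function on `ℝ × 𝕋`. -/
def conjF (F : FunRT) : FunRT := fun p x => (starRingEnd ℂ) (F (-p) x)

def subF (F G : FunRT) : FunRT := fun p x => F p x - G p x

def smulF (c : ℂ) (F : FunRT) : FunRT := fun p x => c * F p x

/-- Multiplication by the weight `x`. -/
def xMul (F : FunRT) : FunRT := fun p x => (x : ℂ) * F p x

/-- `(1 − ∂_xx)⁴` as a Fourier multiplier in `x`. -/
def opL (F : FunRT) : FunRT :=
  fun p => iftx fun ξ => ((1 + ξ ^ 2 : ℝ) : ℂ) ^ 4 * ftx (F p) ξ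

/-- The nonlinearity `N^t[F,G,H] = e^{-itA}(e^{itA}F ⬝ conj(e^{itA}G) ⬝ e^{itA}H)`. -/
def Nt (t : ℝ) (F G H : FunRT) : FunRT :=
  expA (-t) (mulF (mulF (expA t F) (conjF (expA t G))) (expA t H))

/-- Squared `L²(ℝ×𝕋)` norm. -/
def L2sq (F : FunRT) : ℝ≥0∞ := ∑' p : ℤ, ∫⁻ x : ℝ, (‖F p x‖₊ : ℝ≥0∞) ^ 2

/-- `L²(ℝ×𝕋)` norm. -/
def L2norm (F : FunRT) : ℝ≥0∞ := L2sq F ^ (1 / 2 : ℝ)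

/-- Sobolev `H^s(ℝ×𝕋)` norm. -/
def HsNorm (s : ℝ) (F : FunRT) : ℝ≥0∞ :=
  (∑' p : ℤ, ∫⁻ ξ : ℝ,
      ENNReal.ofReal ((1 + ξ ^ 2 + (p : ℝ) ^ 2) ^ s) * (‖ftx (F p) ξ‖₊ : ℝ≥0∞) ^ 2) ^ (1 / 2 : ℝ)

/-- The norm `‖F‖_S = ‖F‖_{H^N} + ‖xF‖_{L²}`. -/
def Snorm (N : ℕ) (F : FunRT) : ℝ≥0∞ := HsNorm N F + L2norm (xMul F)

/-- The norm `‖F‖_{S⁺} = ‖F‖_S + ‖(1−∂_xx)⁴F‖_S + ‖xF‖_S`. -/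
def SplusNorm (N : ℕ) (F : FunRT) : ℝ≥0∞ :=
  Snorm N F + Snorm N (opL F) + Snorm N (xMul F)

/-- The norm `‖F‖_{Y^s} = sup_ξ (1+|ξ|²) (Σ_p (1+|p|²)^s |F̂_p(ξ)|²)^{1/2}`. -/
def Ynorm (s : ℝ) (F : FunRT) : ℝ≥0∞ :=
  ⨆ ξ : ℝ, ENNReal.ofReal (1 + ξ ^ 2) *
    (∑' p : ℤ, ENNReal.ofReal ((1 + (p : ℝ) ^ 2) ^ s) * (‖ftx (F p) ξ‖₊ : ℝ≥0∞) ^ 2) ^ (1 / 2 : ℝ)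

/-- A smooth even cutoff `φ`, identically `1` on `[-1,1]` and vanishing outside `[-2,2]`. -/
structure IsCutoff (φ : ℝ → ℝ) : Prop where
  smooth : ContDiff ℝ (⊤ : ℕ∞) φ
  compact_support : HasCompactSupport φ
  eq_one : ∀ x : ℝ, |x| ≤ 1 → φ x = 1
  eq_zero : ∀ x : ℝ, 2 ≤ |x| → φ x = 0

/-- A function on `𝕋` from its Fourier coefficients. -/
def trigSum (c : ℤ → ℂ) (y : ℝ) : ℂ := ∑' p : ℤ, c p * Complex.exp (Complex.I * p * y)

/-- `L¹(𝕋)` norm of the function with Fourier coefficients `c`. -/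
def L1T (c : ℤ → ℂ) : ℝ≥0∞ := ∫⁻ y in Set.Ioc (0 : ℝ) (2 * Real.pi), (‖trigSum c y‖₊ : ℝ≥0∞)

/-- The Besov `B¹_{1,1}(𝕋)` norm `‖S₀f‖_{L¹} + Σ_{M dyadic} M ‖Δ_M f‖_{L¹}`,
for the function `f` with Fourier coefficients `c`, built from the cutoff `φ`. -/
def B1Norm (φ : ℝ → ℝ) (c : ℤ → ℂ) : ℝ≥0∞ :=
  L1T (fun p => ((φ p : ℝ) : ℂ) * c p) +
    ∑' k : ℕ, ((2 : ℝ≥0∞) ^ (k + 1)) *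
      L1T (fun p =>
        ((φ ((p : ℝ) / 2 ^ (k + 1)) - φ (2 * (p : ℝ) / 2 ^ (k + 1)) : ℝ) : ℂ) * c p)

/-- The norm `‖F‖_Z = sup_ξ (1+|ξ|²) ‖F̂(ξ,·)‖_{B¹}`. -/
def Znorm (φ : ℝ → ℝ) (F : FunRT) : ℝ≥0∞ :=
  ⨆ ξ : ℝ, ENNReal.ofReal (1 + ξ ^ 2) * B1Norm φ fun p => ftx (F p) ξ

/-- `H^s(𝕋)` norm of the function with Fourier coefficients `c`. -/
def HsTnorm (s : ℝ) (c : ℤ → ℂ) : ℝ≥0∞ :=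
  (∑' p : ℤ, ENNReal.ofReal ((1 + (p : ℝ) ^ 2) ^ s) * (‖c p‖₊ : ℝ≥0∞) ^ 2) ^ (1 / 2 : ℝ)

/-- The norm `‖F‖_{L²_x H^s_y}`. -/
def L2HsNorm (s : ℝ) (F : FunRT) : ℝ≥0∞ :=
  (∑' p : ℤ, ENNReal.ofReal ((1 + (p : ℝ) ^ 2) ^ s) *
    ∫⁻ x : ℝ, (‖F p x‖₊ : ℝ≥0∞) ^ 2) ^ (1 / 2 : ℝ)

/-- Fourier transform in `x` of the resonant trilinear operator:
`Σ_{(p,q,r,s)∈Γ₀} F̂_q(ξ) conj(Ĝ_r(ξ)) Ĥ_s(ξ)` where `s = p − q + r`. -/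
def RopF (F G H : FunRT) (p : ℤ) (ξ : ℝ) : ℂ :=
  ∑' qr : ℤ × ℤ,
    if |p| - |qr.1| + |qr.2| - |p - qr.1 + qr.2| = 0 then
      ftx (F qr.1) ξ * (starRingEnd ℂ) (ftx (G qr.2) ξ) * ftx (H (p - qr.1 + qr.2)) ξ
    else 0

/-- The resonant trilinear operator `R`. -/
def Rop (F G H : FunRT) : FunRT := fun p => iftx (RopF F G H p)

/-- `I^t[f,g,h] = e^{-it∂_xx}(e^{it∂_xx}f ⬝ conj(e^{it∂_xx}g) ⬝ e^{it∂_xx}h)` on `ℝ`. -/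
def It (t : ℝ) (f g h : ℝ → ℂ) : ℝ → ℂ :=
  schro (-t) fun x => schro t f x * (starRingEnd ℂ) (schro t g x) * schro t h x

/-- The resonant-in-`y` part `N₀^t` of the nonlinearity. -/
def N0t (t : ℝ) (F G H : FunRT) : FunRT :=
  fun p x => ∑' qr : ℤ × ℤ,
    if |p| - |qr.1| + |qr.2| - |p - qr.1 + qr.2| = 0 then
      It t (F qr.1) (G qr.2) (H (p - qr.1 + qr.2)) x
    else 0

/-- `Ñ^t = N^t − N₀^t`. -/
def Ntil (t : ℝ) (F G H : FunRT) : FunRT := subF (Nt t F G H) (N0t t F G H)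

/-- The operator `A = ∂_xx − |D_y|`. -/
def Aop (F : FunRT) : FunRT :=
  fun p x => deriv (deriv (F p)) x - ((|(p : ℝ)| : ℝ) : ℂ) * F p x

/-- The cubic nonlinearity `|U|²U`. -/
def cubic (F : FunRT) : FunRT := mulF (mulF F (conjF F)) F

/-- `U` solves the wave guide Schrödinger equation `i∂_tU + AU = |U|²U` at time `t`. -/
def SolvesWS (U : ℝ → FunRT) (t : ℝ) : Prop :=
  ∀ p x, HasDerivAt (fun τ => U τ p x)
    (Complex.I * Aop (U t) p x - Complex.I * cubic (U t) p x) t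

/-- `G` solves the resonant system `i∂_tG = R[G,G,G]`. -/
def SolvesRS (G : ℝ → FunRT) : Prop :=
  ∀ t p x, HasDerivAt (fun τ => G τ p x) (-Complex.I * Rop (G t) (G t) (G t) p x) t

/-- The value of `F` at the point `(x,y)` of the cylinder. -/
def valF (F : FunRT) (x y : ℝ) : ℂ := ∑' p : ℤ, F p x * Complex.exp (Complex.I * p * y)

/-- `F(x, y+π) = −F(x,y)`. -/
def AntiPer (F : FunRT) : Prop := ∀ x y : ℝ, valF F x (y + Real.pi) = -valF F x y

/-- Pointwise time derivative of a time-dependent function. -/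
def dtF (F : ℝ → FunRT) (t : ℝ) : FunRT := fun p x => deriv (fun τ => F τ p x) t

/-- The space-time norm `X_T`. -/
def XTnorm (N : ℕ) (δ : ℝ) (φ : ℝ → ℝ) (T : ℝ) (F : ℝ → FunRT) : ℝ≥0∞ :=
  ⨆ t : Set.Icc (0 : ℝ) T,
    (Znorm φ (F t) + ENNReal.ofReal ((1 + |(t : ℝ)|) ^ (-δ)) * Snorm N (F t)
      + ENNReal.ofReal ((1 + |(t : ℝ)|) ^ (1 - 3 * δ)) * Snorm N (dtF F t))

/-- The space-time norm `X_T⁺`. -/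
def XTplusNorm (N : ℕ) (δ : ℝ) (φ : ℝ → ℝ) (T : ℝ) (F : ℝ → FunRT) : ℝ≥0∞ :=
  XTnorm N δ φ T F +
    ⨆ t : Set.Icc (0 : ℝ) T,
      (ENNReal.ofReal ((1 + |(t : ℝ)|) ^ (-(5 * δ))) * SplusNorm N (F t)
        + ENNReal.ofReal ((1 + |(t : ℝ)|) ^ (1 - 7 * δ)) * SplusNorm N (dtF F t))

/-- Littlewood–Paley projection `Q_{≤M}` in the `x` variable. -/
def Qle (φ : ℝ → ℝ) (M : ℝ) (F : FunRT) : FunRT :=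
  fun p => iftx fun ξ => ((φ (ξ / M) : ℝ) : ℂ) * ftx (F p) ξ

/-- Littlewood–Paley piece `Q_A` with `A = 2^k` (`Q_1 = Q_{≤1}`). -/
def Qdy (φ : ℝ → ℝ) (k : ℕ) (F : FunRT) : FunRT :=
  if k = 0 then Qle φ 1 F else subF (Qle φ (2 ^ k) F) (Qle φ (2 ^ (k - 1)) F)

/-- Time integral of a family of functions on the cylinder. -/
def intF (a b : ℝ) (Φ : ℝ → FunRT) : FunRT := fun p x => ∫ t in a..b, Φ t p x

/-- Projection `Π₊` on positive `y`-frequencies. -/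
def Pplus (F : FunRT) : FunRT := fun p x => if 0 < p then F p x else 0

/-- Projection `Π₋` on negative `y`-frequencies. -/
def Pminus (F : FunRT) : FunRT := fun p x => if p < 0 then F p x else 0

/-- Fourier transform in `x` of the reduced (Szegő) resonant operator `R₊`. -/
def RopPlusF (F G H : FunRT) (p : ℤ) (ξ : ℝ) : ℂ :=
  if 0 < p then
    ∑' qr : ℤ × ℤ,
      if 0 < qr.1 ∧ 0 < qr.2 ∧ 0 < p - qr.1 + qr.2 then
        ftx (F qr.1) ξ * (starRingEnd ℂ) (ftx (G qr.2) ξ) * ftx (H (p - qr.1 + qr.2)) ξ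
      else 0
  else 0

/-- The reduced (Szegő) resonant operator `R₊`. -/
def RopPlus (F G H : FunRT) : FunRT := fun p => iftx (RopPlusF F G H p)

/-- Fourier transform in `x` of the reduced resonant operator `R₋`. -/
def RopMinusF (F G H : FunRT) (p : ℤ) (ξ : ℝ) : ℂ :=
  if p < 0 then
    ∑' qr : ℤ × ℤ,
      if qr.1 < 0 ∧ qr.2 < 0 ∧ p - qr.1 + qr.2 < 0 then
        ftx (F qr.1) ξ * (starRingEnd ℂ) (ftx (G qr.2) ξ) * ftx (H (p - qr.1 + qr.2)) ξ
      else 0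
  else 0

/-- The reduced resonant operator `R₋`. -/
def RopMinus (F G H : FunRT) : FunRT := fun p => iftx (RopMinusF F G H p)


namespace NtProof
open scoped FourierTransform Topology
open Real (pi)

/-! ### One dimensional Fourier analysis -/

lemma norm_ph (a : ℝ) : ‖Complex.exp (Complex.I * a)‖ = 1 := by
  rw [mul_comm]; exact Complex.norm_exp_ofReal_mul_I a

lemma ftx_eq (f : ℝ → ℂ) (ξ : ℝ) : ftx f ξ = 𝓕 f (ξ / (2 * Real.pi)) := by
  rw [Real.fourier_real_eq_integral_exp_smul, ftx]
  congr 1; ext x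
  rw [smul_eq_mul]
  congr 2
  have : (Real.pi : ℂ) ≠ 0 := by exact_mod_cast Real.pi_ne_zero
  push_cast; field_simp

lemma iftx_eq_ftx (g : ℝ → ℂ) (x : ℝ) : iftx g x = ((2 * Real.pi : ℝ) : ℂ)⁻¹ * ftx g (-x) := by
  rw [iftx, ftx]; congr 1
  congr 1; ext ξ; congr 2; push_cast; ring

lemma integrable_ph {f : ℝ → ℂ} {a : ℝ → ℝ} (ha : Continuous a) :
    Integrable (fun x => Complex.exp (Complex.I * a x) * f x) ↔ Integrable f := by
  have key : ∀ (b : ℝ → ℝ), Continuous b → ∀ f : ℝ → ℂ, Integrable f →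
      Integrable (fun x => Complex.exp (Complex.I * b x) * f x) := by
    intro b hb f hf
    refine hf.bdd_mul (c := 1) (Continuous.aestronglyMeasurable (by fun_prop)) ?_
    exact Eventually.of_forall fun x => (norm_ph _).le
  refine ⟨fun h => ?_, key a ha f⟩
  have := key (fun x => - a x) (by fun_prop) _ h
  refine this.congr (Eventually.of_forall fun x => ?_)
  simp only []
  rw [← mul_assoc, ← Complex.exp_add]; simp

lemma ftx_nonint {f : ℝ → ℂ} (h : ¬ Integrable f) (ξ : ℝ) : ftx f ξ = 0 := by
  rw [ftx, integral_undef]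
  intro h'; apply h
  rw [← integrable_ph (a := fun x => -(x * ξ)) (by fun_prop)]
  convert h' using 3 with x; congr 1; push_cast; ring

lemma iftx_nonint {f : ℝ → ℂ} (h : ¬ Integrable f) (x : ℝ) : iftx f x = 0 := by
  rw [iftx_eq_ftx, ftx_nonint h, mul_zero]

lemma continuous_fourier' {f : ℝ → ℂ} (h : Integrable f) : Continuous (𝓕 f) :=
  VectorFourier.fourierIntegral_continuous Real.continuous_fourierChar
    (by exact continuous_inner) h

lemma ftx_cont (f : ℝ → ℂ) : Continuous (ftx f) := by
  by_cases h : Integrable f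
  · have : ftx f = fun ξ => 𝓕 f (ξ / (2 * Real.pi)) := funext (ftx_eq f)
    rw [this]
    exact (continuous_fourier' h).comp (by fun_prop)
  · have : ftx f = fun _ => 0 := funext (ftx_nonint h)
    rw [this]; fun_prop

lemma iftx_cont (f : ℝ → ℂ) : Continuous (iftx f) := by
  have : iftx f = fun x => ((2 * Real.pi : ℝ) : ℂ)⁻¹ * ftx f (-x) := funext (iftx_eq_ftx f)
  rw [this]
  exact continuous_const.mul ((ftx_cont f).comp continuous_neg)

lemma ftx_congr {f g : ℝ → ℂ} (h : f =ᵐ[volume] g) : ftx f = ftx g := by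
  ext ξ; rw [ftx, ftx]; apply integral_congr_ae
  filter_upwards [h] with x hx; rw [hx]

lemma iftx_congr {f g : ℝ → ℂ} (h : f =ᵐ[volume] g) : iftx f = iftx g := by
  ext ξ; rw [iftx_eq_ftx, iftx_eq_ftx, ftx_congr h]

lemma fourier_self_adj {f g : ℝ → ℂ} (hf : Integrable f) (hg : Integrable g) :
    ∫ ξ, 𝓕 f ξ * g ξ = ∫ x, f x * 𝓕 g x := by
  have := VectorFourier.integral_fourierIntegral_smul_eq_flip (L := innerₗ ℝ)
    (μ := volume) (ν := volume) Real.continuous_fourierChar (by exact continuous_inner) hf hg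
  simpa using! this

/-- test against Schwartz functions -/
lemma ae_eq_of_schwartz {f g : ℝ → ℂ} (hf : LocallyIntegrable f) (hg : LocallyIntegrable g)
    (h : ∀ φ : SchwartzMap ℝ ℂ, ∫ x, φ x * f x = ∫ x, φ x * g x) : f =ᵐ[volume] g := by
  apply ae_eq_of_integral_contDiff_smul_eq hf hg
  intro φ h1 h2
  have h3 : HasCompactSupport (fun x => (φ x : ℂ)) := h2.comp_left (g := Complex.ofReal) rfl
  have h4 : ContDiff ℝ (⊤ : ℕ∞) (fun x => (φ x : ℂ)) := Complex.ofRealCLM.contDiff.comp h1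
  have := h (h3.toSchwartzMap h4)
  simpa using! this

lemma fourier_inversion_ae {f : ℝ → ℂ} (hf : Integrable f) (hf' : Integrable (𝓕 f)) :
    f =ᵐ[volume] 𝓕⁻ (𝓕 f) := by
  have hc : Continuous (𝓕⁻ (𝓕 f)) := by
    rw [Real.fourierInv_eq_fourier_comp_neg]
    exact continuous_fourier' hf'.comp_neg
  apply ae_eq_of_schwartz hf.locallyIntegrable hc.locallyIntegrable
  intro φ
  have e1 : (𝓕 (𝓕⁻ φ : SchwartzMap ℝ ℂ) : SchwartzMap ℝ ℂ) = φ := FourierTransform.fourier_fourierInv_eq φ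
  have e2 : (𝓕 ((𝓕⁻ φ : SchwartzMap ℝ ℂ) : ℝ → ℂ)) = φ := by
    rw [← SchwartzMap.fourier_coe, e1]
  calc ∫ x, φ x * f x = ∫ x, f x * 𝓕 ((𝓕⁻ φ : SchwartzMap ℝ ℂ) : ℝ → ℂ) x := by
        rw [e2]; simp_rw [mul_comm]
    _ = ∫ x, 𝓕 f x * (𝓕⁻ φ : SchwartzMap ℝ ℂ) x :=
        (fourier_self_adj hf (SchwartzMap.integrable _)).symm
    _ = ∫ x, 𝓕 f x * 𝓕 (φ : ℝ → ℂ) (-x) := by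
        rw [SchwartzMap.fourierInv_coe]; simp_rw [Real.fourierInv_eq_fourier_neg]
    _ = ∫ x, 𝓕 f (-x) * 𝓕 (φ : ℝ → ℂ) x := by
        rw [← integral_neg_eq_self]; simp
    _ = ∫ x, 𝓕 (φ : ℝ → ℂ) x * 𝓕 f (-x) := by simp_rw [mul_comm]
    _ = ∫ x, φ x * 𝓕 (fun y => 𝓕 f (-y)) x :=
        fourier_self_adj (SchwartzMap.integrable _) hf'.comp_neg
    _ = _ := by rw [Real.fourierInv_eq_fourier_comp_neg]

lemma fourier_L2 {f : ℝ → ℂ} (hf : Integrable f) (hf2 : MemLp f 2) :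
    𝓕 f =ᵐ[volume] (𝓕 (hf2.toLp f) : Lp (α := ℝ) ℂ 2) := by
  apply ae_eq_of_schwartz (continuous_fourier' hf).locallyIntegrable
    ((Lp.memLp _).locallyIntegrable (by norm_num))
  intro φ
  have h := congrArg (fun T : TemperedDistribution ℝ ℂ => T φ)
    (Lp.fourier_toTemperedDistribution_eq (hf2.toLp f))
  simp only [TemperedDistribution.fourier_apply, Lp.toTemperedDistribution_apply] at h
  simp only [smul_eq_mul] at h
  rw [← h]
  calc ∫ x, φ x * 𝓕 f x = ∫ x, 𝓕 (φ : ℝ → ℂ) x * f x :=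
        (fourier_self_adj (SchwartzMap.integrable _) hf).symm
    _ = _ := by
        apply integral_congr_ae
        filter_upwards [hf2.coeFn_toLp] with x hx
        rw [hx, SchwartzMap.fourier_coe]

lemma lint_sq_eq (f : ℝ → ℂ) : ∫⁻ x, ‖f x‖ₑ ^ 2 = eLpNorm f 2 volume ^ 2 := by
  rw [eLpNorm_eq_lintegral_rpow_enorm_toReal (by norm_num) (by norm_num)]
  rw [← ENNReal.rpow_natCast, ← ENNReal.rpow_mul]; simp

lemma memLp_two_iff {f : ℝ → ℂ} (hf : AEStronglyMeasurable f) :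
    MemLp f 2 ↔ ∫⁻ x, ‖f x‖ₑ ^ 2 ≠ ∞ := by
  rw [lint_sq_eq]
  constructor
  · intro h; exact ENNReal.pow_ne_top h.2.ne
  · intro h; refine ⟨hf, ?_⟩
    rw [lt_top_iff_ne_top]; intro h'; rw [h'] at h; simp at h

lemma plancherel_fourier {f : ℝ → ℂ} (hf : Integrable f) (hf2 : MemLp f 2) :
    ∫⁻ x, ‖𝓕 f x‖ₑ ^ 2 = ∫⁻ x, ‖f x‖ₑ ^ 2 := by
  rw [lint_sq_eq, lint_sq_eq, eLpNorm_congr_ae (fourier_L2 hf hf2)]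
  have h := Lp.norm_fourier_eq (hf2.toLp f)
  rw [Lp.norm_def, Lp.norm_def, ENNReal.toReal_eq_toReal_iff' (Lp.eLpNorm_ne_top _) (Lp.eLpNorm_ne_top _),
    eLpNorm_congr_ae hf2.coeFn_toLp] at h
  rw [h]

lemma lintegral_comp_mul (g : ℝ → ℝ≥0∞) {c : ℝ} (hc : c ≠ 0) :
    ∫⁻ x, g (c * x) = ENNReal.ofReal |c⁻¹| * ∫⁻ x, g x := by
  have h := Real.map_volume_mul_left hc
  have h2 : ∫⁻ x, g x ∂(Measure.map (c * ·) volume) = ∫⁻ x, g (c * x) :=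
    lintegral_map_equiv g (Homeomorph.mulLeft₀ c hc).toMeasurableEquiv
  rw [← h2, h, lintegral_smul_measure, smul_eq_mul]

lemma plancherel {f : ℝ → ℂ} (hf : Integrable f) (hf2 : MemLp f 2) :
    ∫⁻ x, ‖ftx f x‖ₑ ^ 2 = ENNReal.ofReal (2 * Real.pi) * ∫⁻ x, ‖f x‖ₑ ^ 2 := by
  rw [← plancherel_fourier hf hf2]
  have := lintegral_comp_mul (fun x => ‖𝓕 f x‖ₑ ^ 2) (c := (2 * Real.pi)⁻¹) (by positivity)
  rw [inv_inv, abs_of_pos (by positivity)] at this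
  rw [← this]
  congr 1; ext x; rw [ftx_eq]; congr 3; ring_nf

lemma integrable_ftx_iff {f : ℝ → ℂ} : Integrable (ftx f) ↔ Integrable (𝓕 f) := by
  have : ftx f = fun x => 𝓕 f (x / (2 * Real.pi)) := funext (ftx_eq f)
  rw [this]
  exact integrable_comp_div_iff (𝓕 f) (by positivity : (2 * Real.pi) ≠ 0)

lemma inversion {f : ℝ → ℂ} (hf : Integrable f) (hf' : Integrable (ftx f)) :
    f =ᵐ[volume] iftx (ftx f) := by
  refine (fourier_inversion_ae hf (integrable_ftx_iff.1 hf')).trans (Eventually.of_forall fun x => ?_)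
  rw [iftx, Real.fourierInv_eq']
  have h := Measure.integral_comp_mul_left
    (fun ξ : ℝ => Complex.exp (Complex.I * x * ξ) * ftx f ξ) (2 * Real.pi)
  rw [abs_of_pos (by positivity)] at h
  rw [Complex.real_smul] at h
  rw [Complex.ofReal_inv] at h
  rw [← h]
  congr 1; ext ξ
  rw [ftx_eq]
  simp only [smul_eq_mul]
  congr 2
  · simp; ring
  · field_simp

lemma memLp_of_ftx {f : ℝ → ℂ} (hf : Integrable f) (hf' : Integrable (ftx f)) : MemLp f 2 := by
  have h1 : MemLp f ∞ := by
    refine memLp_top_of_bound hf.1 ((2 * Real.pi)⁻¹ * ∫ ξ, ‖ftx f ξ‖) ?_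
    filter_upwards [inversion hf hf'] with x hx
    rw [hx, iftx, norm_mul]
    have : ‖((2 * Real.pi : ℝ) : ℂ)⁻¹‖ = (2 * Real.pi)⁻¹ := by
      rw [norm_inv, Complex.norm_real, Real.norm_of_nonneg (by positivity)]
    rw [this]
    gcongr
    refine (norm_integral_le_integral_norm _).trans (le_of_eq ?_)
    congr 1; ext ξ; rw [norm_mul]
    have := norm_ph (x * ξ)
    push_cast at this
    rw [← mul_assoc] at this
    rw [this, one_mul]
  rw [memLp_two_iff hf.1]
  have h2 : ∫⁻ x, ‖f x‖ₑ ^ 2 ≤ eLpNorm f ∞ volume * ∫⁻ x, ‖f x‖ₑ := by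
    rw [← lintegral_const_mul' _ _ h1.2.ne]
    apply lintegral_mono_ae
    filter_upwards [ae_le_eLpNormEssSup (f := f) (μ := volume)] with x hx
    rw [pow_two, eLpNorm_exponent_top]; gcongr
  exact ne_top_of_le_ne_top (ENNReal.mul_ne_top h1.2.ne hf.2.ne) h2

lemma ftx_const_mul (c : ℂ) (f : ℝ → ℂ) (ξ : ℝ) : ftx (fun x => c * f x) ξ = c * ftx f ξ := by
  rw [ftx, ftx, ← integral_const_mul]; congr 1; ext x; ring

lemma ftx_comp_neg (f : ℝ → ℂ) (ξ : ℝ) : ftx (fun x => f (-x)) ξ = ftx f (-ξ) := by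
  rw [ftx, ftx, ← integral_neg_eq_self]; congr 1; ext x; simp

lemma two_pi_ne : ((2 * Real.pi : ℝ) : ℂ) ≠ 0 := by
  exact_mod_cast (by positivity : (2 * Real.pi : ℝ) ≠ 0)

lemma ftx_iftx {g : ℝ → ℂ} (hg : Integrable g) (hg' : Integrable (iftx g)) :
    ftx (iftx g) =ᵐ[volume] g := by
  have e : ftx g = fun x => ((2 * Real.pi : ℝ) : ℂ) * iftx g (-x) := by
    ext x; rw [iftx_eq_ftx, neg_neg, mul_inv_cancel_left₀ two_pi_ne]
  have h1 : Integrable (ftx g) := by rw [e]; exact hg'.comp_neg.const_mul _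
  refine EventuallyEq.trans (Eventually.of_forall fun x => ?_) (inversion hg h1).symm
  rw [iftx_eq_ftx, e, ftx_const_mul, ftx_comp_neg (iftx g), neg_neg, inv_mul_cancel_left₀ two_pi_ne]

lemma ftx_iftx_le (g : ℝ → ℂ) : ∀ᵐ ξ, ‖ftx (iftx g) ξ‖ₑ ≤ ‖g ξ‖ₑ := by
  by_cases hg : Integrable g
  · by_cases hg' : Integrable (iftx g)
    · filter_upwards [ftx_iftx hg hg'] with x hx; rw [hx]
    · exact Eventually.of_forall fun x => by rw [ftx_nonint hg']; simp
  · have : iftx g = fun _ => 0 := funext (iftx_nonint hg)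
    exact Eventually.of_forall fun x => by rw [this, ftx]; simp

lemma iftx_L2_eq {g : ℝ → ℂ} (hg : Integrable g) (hg2 : MemLp g 2) :
    ∫⁻ x, ‖iftx g x‖ₑ ^ 2 = ENNReal.ofReal (2 * Real.pi)⁻¹ * ∫⁻ x, ‖g x‖ₑ ^ 2 := by
  have h := plancherel hg hg2
  have e : ∀ x, ‖iftx g x‖ₑ ^ 2 = ENNReal.ofReal ((2 * Real.pi)⁻¹ ^ 2) * ‖ftx g (-x)‖ₑ ^ 2 := by
    intro x; rw [iftx_eq_ftx, enorm_mul, mul_pow, ENNReal.ofReal_pow (by positivity)]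
    congr 2
    rw [← ofReal_norm, norm_inv, Complex.norm_real, Real.norm_of_nonneg (by positivity)]
  simp_rw [e]
  rw [lintegral_const_mul' _ _ ENNReal.ofReal_ne_top]
  have : ∫⁻ x, ‖ftx g (-x)‖ₑ ^ 2 = ∫⁻ x, ‖ftx g x‖ₑ ^ 2 := by
    have := lintegral_comp_mul (fun x => ‖ftx g x‖ₑ ^ 2) (c := -1) (by norm_num)
    simpa using this
  rw [this, h, ← mul_assoc, ← ENNReal.ofReal_mul (by positivity)]
  congr 2; field_simp

lemma iftx_L2_le (g : ℝ → ℂ) :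
    ∫⁻ x, ‖iftx g x‖ₑ ^ 2 ≤ ENNReal.ofReal (2 * Real.pi)⁻¹ * ∫⁻ x, ‖g x‖ₑ ^ 2 := by
  by_cases hg : Integrable g
  · by_cases h2 : MemLp g 2
    · exact (iftx_L2_eq hg h2).le
    · have : ∫⁻ x, ‖g x‖ₑ ^ 2 = ∞ := by
        by_contra h; exact h2 ((memLp_two_iff hg.1).2 h)
      rw [this, ENNReal.mul_top]
      · exact le_top
      · have : 0 < (2 * Real.pi)⁻¹ := by positivity
        simpa using Real.pi_pos
  · simp [iftx_nonint hg]

end NtProof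

namespace NtProof
open scoped FourierTransform Topology

/-! ### Dispersive estimate -/

lemma norm_ph3 (x ξ : ℝ) : ‖Complex.exp (Complex.I * x * ξ)‖ = 1 := by
  have := norm_ph (x * ξ)
  push_cast at this
  rwa [← mul_assoc] at this

lemma norm_ph3' (x ξ : ℝ) : ‖Complex.exp (-(Complex.I * x * ξ))‖ = 1 := by
  have := norm_ph (-(x * ξ))
  push_cast at this
  rw [← this]; congr 2; ring

lemma norm_phsq (t ξ : ℝ) : ‖Complex.exp (-(Complex.I * t * ξ ^ 2))‖ = 1 := by
  have := norm_ph (-(t * ξ ^ 2))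
  push_cast at this
  rw [← this]; congr 2; ring

lemma ftx_self_adj {f g : ℝ → ℂ} (hf : Integrable f) (hg : Integrable g) :
    ∫ ξ, ftx f ξ * g ξ = ∫ x, f x * ftx g x := by
  have h : Integrable (Function.uncurry fun (ξ x : ℝ) =>
      Complex.exp (-(Complex.I * x * ξ)) * (g ξ * f x)) (volume.prod volume) := by
    refine (hg.mul_prod hf).bdd_mul (c := 1)
      (f := fun z : ℝ × ℝ => Complex.exp (-(Complex.I * z.2 * z.1)))
      (Continuous.aestronglyMeasurable (by fun_prop)) ?_
    exact Eventually.of_forall fun z => (norm_ph3' _ _).le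
  have := integral_integral_swap h
  calc ∫ ξ, ftx f ξ * g ξ = ∫ ξ : ℝ, ∫ x : ℝ, Complex.exp (-(Complex.I * x * ξ)) * (g ξ * f x) := by
        congr 1; ext ξ; rw [ftx, ← integral_mul_const]; congr 1; ext x; ring
    _ = _ := this
    _ = _ := by
        congr 1; ext x; rw [ftx, ← integral_const_mul]; congr 1; ext ξ
        rw [show (-(Complex.I * x * ξ)) = (-(Complex.I * ξ * x)) by ring]; ring

lemma norm_sqrt_cpow (z : ℂ) : ‖z ^ (1 / 2 : ℂ)‖ = Real.sqrt ‖z‖ := by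
  have h : (z ^ ((2 : ℕ) : ℂ)⁻¹) ^ 2 = z := Complex.cpow_nat_inv_pow z (by norm_num)
  have h2 : ‖z ^ (1 / 2 : ℂ)‖ ^ 2 = ‖z‖ := by
    rw [← norm_pow]; congr 1; rw [← h]; simp
  rw [← h2, Real.sqrt_sq (norm_nonneg _)]

lemma disp_kernel {ε t : ℝ} (hε : 0 < ε) (ht : t ≠ 0) (x y : ℝ) :
    ‖ftx (fun ξ : ℝ => Complex.exp (Complex.I * x * ξ) *
      Complex.exp (-(ε + Complex.I * t) * (ξ : ℂ) ^ 2)) y‖ ≤ Real.sqrt (Real.pi / |t|) := by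
  have hb : 0 < ((ε : ℂ) + Complex.I * t).re := by simpa using hε
  have h := fourierIntegral_gaussian hb ((x - y : ℝ) : ℂ)
  have e : ftx (fun ξ : ℝ => Complex.exp (Complex.I * x * ξ) *
      Complex.exp (-(ε + Complex.I * t) * (ξ : ℂ) ^ 2)) y =
      ∫ ξ : ℝ, Complex.exp (Complex.I * ((x - y : ℝ) : ℂ) * ξ) * Complex.exp (-(ε + Complex.I * t) * (ξ : ℂ) ^ 2) := by
    rw [ftx]; congr 1; ext ξ
    rw [← mul_assoc, ← Complex.exp_add]; congr 2; push_cast; ring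
  rw [e, h, norm_mul, norm_sqrt_cpow]
  have h1 : ‖Complex.exp (-((x - y : ℝ) : ℂ) ^ 2 / (4 * ((ε : ℂ) + Complex.I * t)))‖ ≤ 1 := by
    rw [Complex.norm_exp]
    apply Real.exp_le_one_iff.2
    rw [Complex.div_re]
    have : (-((x - y : ℝ) : ℂ) ^ 2) = ((-(x - y) ^ 2 : ℝ) : ℂ) := by push_cast; ring
    rw [this, Complex.ofReal_re, Complex.ofReal_im]
    have h3 : (4 * ((ε : ℂ) + Complex.I * t)).re = 4 * ε := by simp
    rw [h3]
    have : 0 ≤ Complex.normSq (4 * ((ε : ℂ) + Complex.I * t)) := Complex.normSq_nonneg _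
    have h4 : (-(x - y) ^ 2) * (4 * ε) ≤ 0 := by nlinarith [sq_nonneg (x - y)]
    simp only [zero_mul, zero_div, add_zero]
    exact div_nonpos_of_nonpos_of_nonneg h4 this
  have h2 : ‖(Real.pi : ℂ) / ((ε : ℂ) + Complex.I * t)‖ ≤ Real.pi / |t| := by
    rw [norm_div, Complex.norm_real, Real.norm_of_nonneg Real.pi_pos.le]
    have : |t| ≤ ‖(ε : ℂ) + Complex.I * t‖ := by
      have := Complex.abs_im_le_norm ((ε : ℂ) + Complex.I * t)
      simpa using this
    have : 0 < |t| := abs_pos.2 ht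
    gcongr
  calc _ ≤ Real.sqrt (Real.pi / |t|) * 1 := by gcongr
    _ = _ := mul_one _

lemma dispersive {f : ℝ → ℂ} (hf : Integrable f) (hf' : Integrable (ftx f)) {t : ℝ} (ht : t ≠ 0)
    (x : ℝ) : ‖schro t f x‖ ≤ (2 * Real.pi)⁻¹ * (Real.sqrt (Real.pi / |t|) * ∫ y, ‖f y‖) := by
  rw [schro, iftx, norm_mul]
  have e0 : ‖((2 * Real.pi : ℝ) : ℂ)⁻¹‖ = (2 * Real.pi)⁻¹ := by
    rw [norm_inv, Complex.norm_real, Real.norm_of_nonneg (by positivity)]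
  rw [e0]
  gcongr
  set g : ℕ → ℝ → ℂ := fun n ξ => Complex.exp (Complex.I * x * ξ) *
      Complex.exp (-(((1 / ((n : ℝ) + 1) : ℝ) : ℂ) + Complex.I * t) * (ξ : ℂ) ^ 2) with hg
  have hε : ∀ n : ℕ, 0 < 1 / ((n : ℝ) + 1) := fun n => by positivity
  have hgn : ∀ n ξ, ‖g n ξ‖ ≤ 1 := by
    intro n ξ
    rw [hg]; simp only [norm_mul, norm_ph3, one_mul]
    rw [Complex.norm_exp]; apply Real.exp_le_one_iff.2
    have : (-(((1 / ((n : ℝ) + 1) : ℝ) : ℂ) + Complex.I * t) * (ξ : ℂ) ^ 2) =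
      ((-(1 / ((n : ℝ) + 1) * ξ ^ 2) : ℝ) : ℂ) + ((-(t * ξ ^ 2) : ℝ) : ℂ) * Complex.I := by push_cast; ring
    rw [this]
    have : 0 ≤ (1 / ((n : ℝ) + 1) * ξ ^ 2) := by positivity
    rw [Complex.add_re, Complex.ofReal_re, Complex.re_ofReal_mul, Complex.I_re, mul_zero, add_zero]
    linarith
  have hgi : ∀ n, Integrable (g n) := by
    intro n
    have := integrable_cexp_quadratic (b := ((1 / ((n : ℝ) + 1) : ℝ) : ℂ) + Complex.I * t)
      (by
        rw [Complex.add_re, Complex.ofReal_re, mul_comm, Complex.re_ofReal_mul, Complex.I_re, mul_zero,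
          add_zero]
        exact hε n) (Complex.I * x) 0
    refine this.congr (Eventually.of_forall fun ξ => ?_)
    simp only [hg]; rw [← Complex.exp_add]; congr 1; ring
  have hlim : Tendsto (fun n => ∫ ξ, ftx f ξ * g n ξ) atTop
      (𝓝 (∫ ξ : ℝ, Complex.exp (Complex.I * x * ξ) *
        (Complex.exp (-(Complex.I * t * ξ ^ 2)) * ftx f ξ))) := by
    apply tendsto_integral_of_dominated_convergence (fun ξ => ‖ftx f ξ‖)
    · intro n
      exact (hf'.1.mul (hgi n).1)
    · exact hf'.norm
    · intro n
      refine Eventually.of_forall fun ξ => ?_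
      rw [norm_mul]
      exact mul_le_of_le_one_right (norm_nonneg _) (hgn n ξ)
    · refine Eventually.of_forall fun ξ => ?_
      have : Tendsto (fun n : ℕ => (((1 / ((n : ℝ) + 1) : ℝ) : ℂ))) atTop (𝓝 0) := by
        have := (Complex.continuous_ofReal.tendsto 0).comp (tendsto_one_div_add_atTop_nhds_zero_nat (𝕜 := ℝ))
        rw [Complex.ofReal_zero] at this
        exact this
      have h2 : Tendsto (fun n => ftx f ξ * g n ξ) atTop (𝓝 (ftx f ξ * (Complex.exp (Complex.I * x * ξ) *
        Complex.exp (-((0 : ℂ) + Complex.I * t) * (ξ : ℂ) ^ 2)))) := by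
        refine Tendsto.const_mul _ (Tendsto.const_mul _ ?_)
        refine (Complex.continuous_exp.tendsto _).comp ?_
        exact ((this.add_const _).neg.mul_const _)
      convert h2 using 2
      rw [show (-((0 : ℂ) + Complex.I * t) * (ξ : ℂ) ^ 2) = -(Complex.I * t * ξ ^ 2) by ring]; ring
  refine le_of_tendsto' hlim.norm fun n => ?_
  rw [ftx_self_adj hf (hgi n)]
  refine (norm_integral_le_integral_norm _).trans ?_
  rw [← integral_const_mul]
  apply integral_mono_of_nonneg
  · exact Eventually.of_forall fun y => norm_nonneg _
  · exact hf.norm.const_mul _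
  · refine Eventually.of_forall fun y => ?_
    simp only [norm_mul]
    rw [mul_comm]
    gcongr
    exact disp_kernel (hε n) ht x y

lemma norm_iftx_le (g : ℝ → ℂ) (x : ℝ) : ‖iftx g x‖ ≤ ∫ ξ, ‖g ξ‖ := by
  rw [iftx, norm_mul]
  have e0 : ‖((2 * Real.pi : ℝ) : ℂ)⁻¹‖ ≤ 1 := by
    rw [norm_inv, Complex.norm_real, Real.norm_of_nonneg (by positivity)]
    exact inv_le_one_of_one_le₀ (by nlinarith [Real.pi_gt_three])
  have e1 : ‖∫ ξ : ℝ, Complex.exp (Complex.I * x * ξ) * g ξ‖ ≤ ∫ ξ, ‖g ξ‖ := by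
    refine (norm_integral_le_integral_norm _).trans (le_of_eq ?_)
    congr 1; ext ξ; rw [norm_mul, norm_ph3, one_mul]
  calc _ ≤ 1 * ∫ ξ, ‖g ξ‖ := by gcongr
    _ = _ := one_mul _

lemma sup_bound {f : ℝ → ℂ} (hf : Integrable f) (hf' : Integrable (ftx f)) (t x : ℝ) :
    ‖schro t f x‖ ^ 2 ≤ 2 * (1 + |t|)⁻¹ * ((∫ y, ‖f y‖) ^ 2 + (∫ ξ, ‖ftx f ξ‖) ^ 2) := by
  have hI1 : 0 ≤ ∫ y, ‖f y‖ := integral_nonneg fun _ => norm_nonneg _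
  have hI2 : 0 ≤ ∫ y, ‖ftx f y‖ := integral_nonneg fun _ => norm_nonneg _
  have ht0 : 0 ≤ |t| := abs_nonneg t
  rw [mul_assoc, mul_comm, mul_assoc]
  rw [le_inv_mul_iff₀ (by positivity)]
  by_cases h : |t| ≤ 1
  · have h1 : ‖schro t f x‖ ≤ ∫ ξ, ‖ftx f ξ‖ := by
      refine (norm_iftx_le _ x).trans (le_of_eq ?_)
      congr 1; ext ξ; rw [norm_mul, norm_phsq, one_mul]
    have h2 : ‖schro t f x‖ ^ 2 ≤ (∫ ξ, ‖ftx f ξ‖) ^ 2 := by gcongr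
    nlinarith [sq_nonneg (∫ y, ‖f y‖), sq_nonneg ‖schro t f x‖]
  · push Not at h
    have ht : t ≠ 0 := by intro h0; rw [h0] at h; norm_num at h
    have h1 := dispersive hf hf' ht x
    have h2 : ‖schro t f x‖ ^ 2 ≤ ((2 * Real.pi)⁻¹ * (Real.sqrt (Real.pi / |t|) * ∫ y, ‖f y‖)) ^ 2 := by gcongr
    rw [mul_pow, mul_pow, Real.sq_sqrt (by positivity)] at h2
    have h3 : (2 * Real.pi)⁻¹ ^ 2 * (Real.pi / |t| * (∫ y, ‖f y‖) ^ 2) ≤ |t|⁻¹ * (∫ y, ‖f y‖) ^ 2 := by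
      rw [← mul_assoc]; gcongr
      rw [div_eq_mul_inv, ← mul_assoc]
      have : (2 * Real.pi)⁻¹ ^ 2 * Real.pi ≤ 1 := by
        rw [inv_pow, inv_mul_le_iff₀ (by positivity)]
        nlinarith [Real.pi_gt_three]
      calc _ ≤ 1 * |t|⁻¹ := by gcongr
        _ = _ := one_mul _
    have h4 := h2.trans h3
    rw [le_inv_mul_iff₀ (by linarith)] at h4
    nlinarith [sq_nonneg (∫ y, ‖ftx f y‖), sq_nonneg ‖schro t f x‖]

/-! ### Cauchy-Schwarz -/

lemma cs_lintegral {α : Type*} [MeasurableSpace α] (μ : Measure α) {a b : α → ℝ≥0∞}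
    (ha : AEMeasurable a μ) (hb : AEMeasurable b μ) :
    (∫⁻ x, a x * b x ∂μ) ^ 2 ≤ (∫⁻ x, a x ^ 2 ∂μ) * ∫⁻ x, b x ^ 2 ∂μ := by
  have h := ENNReal.lintegral_mul_le_Lp_mul_Lq μ Real.HolderConjugate.two_two ha hb
  have h2 : (∫⁻ x, a x * b x ∂μ) ^ 2 ≤ ((∫⁻ x, a x ^ (2 : ℝ) ∂μ) ^ (1 / 2 : ℝ) * (∫⁻ x, b x ^ (2 : ℝ) ∂μ) ^ (1 / 2 : ℝ)) ^ 2 := by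
    gcongr; exact h
  refine h2.trans (le_of_eq ?_)
  rw [mul_pow]
  simp only [← ENNReal.rpow_natCast, ← ENNReal.rpow_mul]
  norm_num

lemma cs_tsum {ι : Type*} (a b : ι → ℝ≥0∞) :
    (∑' i, a i * b i) ^ 2 ≤ (∑' i, a i ^ 2) * ∑' i, b i ^ 2 := by
  let _ : MeasurableSpace ι := ⊤
  have : MeasurableSingletonClass ι := ⟨fun _ => trivial⟩
  have h := cs_lintegral (Measure.count : Measure ι) (a := a) (b := b)
    (measurable_from_top.aemeasurable) (measurable_from_top.aemeasurable)
  simpa only [lintegral_count] using h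

/-- weighted `L¹` bound, at scale `μ`. -/
lemma l1_weight {f : ℝ → ℂ} (hf : AEStronglyMeasurable f) {μ : ℝ} (hμ : 0 < μ) :
    (∫⁻ x, ‖f x‖ₑ) ^ 2 ≤ ENNReal.ofReal (Real.pi * μ) *
      ∫⁻ x, ENNReal.ofReal (1 + (x / μ) ^ 2) * ‖f x‖ₑ ^ 2 := by
  have hpos : ∀ x : ℝ, 0 < 1 + (x / μ) ^ 2 := fun x => by positivity
  have h := cs_lintegral volume
    (a := fun x : ℝ => ENNReal.ofReal (Real.sqrt (1 + (x / μ) ^ 2)⁻¹))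
    (b := fun x : ℝ => ENNReal.ofReal (Real.sqrt (1 + (x / μ) ^ 2)) * ‖f x‖ₑ)
    (by fun_prop)
    (AEMeasurable.mul (by fun_prop) hf.enorm)
  have e1 : ∀ x : ℝ, ENNReal.ofReal (Real.sqrt (1 + (x / μ) ^ 2)⁻¹) *
      (ENNReal.ofReal (Real.sqrt (1 + (x / μ) ^ 2)) * ‖f x‖ₑ) = ‖f x‖ₑ := by
    intro x
    rw [← mul_assoc, ← ENNReal.ofReal_mul (by positivity), Real.sqrt_inv,
      inv_mul_cancel₀ (Real.sqrt_pos.2 (hpos x)).ne']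
    simp
  have e2 : ∀ x : ℝ, (ENNReal.ofReal (Real.sqrt (1 + (x / μ) ^ 2)) * ‖f x‖ₑ) ^ 2 =
      ENNReal.ofReal (1 + (x / μ) ^ 2) * ‖f x‖ₑ ^ 2 := by
    intro x
    rw [mul_pow, ← ENNReal.ofReal_pow (by positivity), Real.sq_sqrt (hpos x).le]
  have e3 : ∫⁻ x : ℝ, ENNReal.ofReal (Real.sqrt (1 + (x / μ) ^ 2)⁻¹) ^ 2 = ENNReal.ofReal (Real.pi * μ) := by
    have : ∀ x : ℝ, ENNReal.ofReal (Real.sqrt (1 + (x / μ) ^ 2)⁻¹) ^ 2 =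
        (fun y : ℝ => ENNReal.ofReal (1 + y ^ 2)⁻¹) (μ⁻¹ * x) := by
      intro x
      rw [← ENNReal.ofReal_pow (by positivity), Real.sq_sqrt (by positivity)]
      simp only []; congr 4; field_simp
    rw [lintegral_congr this, lintegral_comp_mul (fun y : ℝ => ENNReal.ofReal (1 + y ^ 2)⁻¹)
      (by positivity : μ⁻¹ ≠ 0), inv_inv, abs_of_pos hμ,
      ← ofReal_integral_eq_lintegral_ofReal integrable_inv_one_add_sq
        (Eventually.of_forall fun x => by positivity), integral_univ_inv_one_add_sq,
      ← ENNReal.ofReal_mul hμ.le, mul_comm]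
  simp_rw [e1, e2, e3] at h
  exact h

end NtProof

namespace NtProof
open scoped FourierTransform Topology

/-! ### Norms and the basic decay bound -/

def Hq (m : ℕ) (F : FunRT) : ℝ≥0∞ :=
  ∑' p : ℤ, ∫⁻ ξ : ℝ, ENNReal.ofReal ((1 + ξ ^ 2 + (p : ℝ) ^ 2) ^ m) * ‖ftx (F p) ξ‖ₑ ^ 2

def L2w (n : ℕ) (U : FunRT) : ℝ≥0∞ :=
  ∑' p : ℤ, ENNReal.ofReal ((1 + (p : ℝ) ^ 2) ^ n) * ∫⁻ x : ℝ, ‖U p x‖ₑ ^ 2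

def Aw (U : FunRT) : ℝ≥0∞ := ∑' p : ℤ, ⨆ x : ℝ, ‖U p x‖ₑ

structure Gd (F : FunRT) : Prop where
  int : ∀ p, Integrable (F p)
  hq : Hq 2 F ≠ ∞
  hx : L2sq (xMul F) ≠ ∞

lemma L2sq_eq (F : FunRT) : L2sq F = ∑' p : ℤ, ∫⁻ x : ℝ, ‖F p x‖ₑ ^ 2 := rfl

lemma L2w_zero (F : FunRT) : L2w 0 F = L2sq F := by
  rw [L2sq_eq, L2w]; simp

lemma Hq_mono (F : FunRT) {m n : ℕ} (h : m ≤ n) : Hq m F ≤ Hq n F := by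
  unfold Hq
  gcongr with p ξ
  nlinarith [sq_nonneg ξ, sq_nonneg (p : ℝ)]

lemma ftx_L2_le (f : ℝ → ℂ) :
    ∫⁻ x, ‖ftx f x‖ₑ ^ 2 ≤ ENNReal.ofReal (2 * Real.pi) * ∫⁻ x, ‖f x‖ₑ ^ 2 := by
  by_cases h : Integrable f
  · by_cases h2 : ∫⁻ x, ‖f x‖ₑ ^ 2 = ∞
    · rw [h2, ENNReal.mul_top]
      · exact le_top
      · simp [Real.pi_pos]
    · exact (plancherel h ((memLp_two_iff h.1).2 h2)).le
  · simp [ftx_nonint h]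

lemma enorm_of_norm_one {z : ℂ} (h : ‖z‖ = 1) : ‖z‖ₑ = 1 := by
  rw [← ofReal_norm, h, ENNReal.ofReal_one]

lemma norm_phabs (t : ℝ) (p : ℤ) : ‖Complex.exp (-(Complex.I * t * |(p : ℝ)|))‖ = 1 :=
  norm_ph3' t _

lemma enorm_expA (t : ℝ) (F : FunRT) (p : ℤ) (x : ℝ) : ‖expA t F p x‖ₑ = ‖schro t (F p) x‖ₑ := by
  rw [expA, enorm_mul, enorm_of_norm_one (norm_phabs t p), one_mul]

lemma pi_inv_mul : ENNReal.ofReal (2 * Real.pi)⁻¹ * ENNReal.ofReal (2 * Real.pi) = 1 := by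
  rw [← ENNReal.ofReal_mul (by positivity), inv_mul_cancel₀ (by positivity), ENNReal.ofReal_one]

lemma schro_L2_le' (t : ℝ) (f : ℝ → ℂ) :
    ∫⁻ x, ‖schro t f x‖ₑ ^ 2 ≤ ENNReal.ofReal (2 * Real.pi)⁻¹ * ∫⁻ ξ, ‖ftx f ξ‖ₑ ^ 2 := by
  refine (iftx_L2_le _).trans (le_of_eq ?_)
  congr 1; apply lintegral_congr; intro ξ
  rw [enorm_mul, enorm_of_norm_one (norm_phsq t ξ), one_mul]

lemma schro_L2_le (t : ℝ) (f : ℝ → ℂ) :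
    ∫⁻ x, ‖schro t f x‖ₑ ^ 2 ≤ ∫⁻ x, ‖f x‖ₑ ^ 2 := by
  refine (schro_L2_le' t f).trans ?_
  calc _ ≤ ENNReal.ofReal (2 * Real.pi)⁻¹ * (ENNReal.ofReal (2 * Real.pi) * ∫⁻ x, ‖f x‖ₑ ^ 2) := by
        gcongr; exact ftx_L2_le f
    _ = _ := by rw [← mul_assoc, pi_inv_mul, one_mul]

lemma L2w_expA_le (n : ℕ) (t : ℝ) (F : FunRT) : L2w n (expA t F) ≤ L2w n F := by
  unfold L2w
  simp only [enorm_expA]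
  exact ENNReal.tsum_le_tsum fun p => mul_le_mul_right (schro_L2_le t (F p)) _

lemma L2sq_expA_le (t : ℝ) (F : FunRT) : L2sq (expA t F) ≤ L2sq F := by
  rw [← L2w_zero, ← L2w_zero]; exact L2w_expA_le 0 t F

lemma expA_cont (t : ℝ) (F : FunRT) (p : ℤ) : Continuous (expA t F p) :=
  continuous_const.mul (iftx_cont _)

lemma lint_ofReal_norm {f : ℝ → ℂ} (hf : Integrable f) :
    ENNReal.ofReal (∫ x, ‖f x‖) = ∫⁻ x, ‖f x‖ₑ := by
  rw [ofReal_integral_norm_eq_lintegral_enorm hf]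

lemma sup_bound_e {f : ℝ → ℂ} (hf : Integrable f) (hf' : Integrable (ftx f)) (t x : ℝ) :
    ‖schro t f x‖ₑ ^ 2 ≤ ENNReal.ofReal (2 * (1 + |t|)⁻¹) *
      ((∫⁻ y, ‖f y‖ₑ) ^ 2 + (∫⁻ ξ, ‖ftx f ξ‖ₑ) ^ 2) := by
  have h := sup_bound hf hf' t x
  have hI1 : 0 ≤ ∫ y, ‖f y‖ := integral_nonneg fun _ => norm_nonneg _
  have hI2 : 0 ≤ ∫ y, ‖ftx f y‖ := integral_nonneg fun _ => norm_nonneg _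
  rw [← lint_ofReal_norm hf, ← lint_ofReal_norm hf', ← ENNReal.ofReal_pow hI1, ← ENNReal.ofReal_pow hI2,
    ← ENNReal.ofReal_add (by positivity) (by positivity), ← ENNReal.ofReal_mul (by positivity),
    ← ofReal_norm, ← ENNReal.ofReal_pow (norm_nonneg _)]
  exact ENNReal.ofReal_le_ofReal h

lemma iSup_sq_le {ι : Sort*} {a : ι → ℝ≥0∞} {B : ℝ≥0∞} (h : ∀ i, a i ^ 2 ≤ B) : (⨆ i, a i) ^ 2 ≤ B := by
  have h1 : (⨆ i, a i) ≤ B ^ (1 / 2 : ℝ) := by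
    refine iSup_le fun i => ?_
    calc a i = (a i ^ 2) ^ (1 / 2 : ℝ) := by
          rw [← ENNReal.rpow_natCast, ← ENNReal.rpow_mul]; norm_num
      _ ≤ _ := by gcongr; exact h i
  calc (⨆ i, a i) ^ 2 ≤ (B ^ (1 / 2 : ℝ)) ^ 2 := by gcongr
    _ = B := by rw [← ENNReal.rpow_natCast, ← ENNReal.rpow_mul]; norm_num

lemma meas_ftx (f : ℝ → ℂ) : Measurable (fun ξ => ‖ftx f ξ‖ₑ ^ 2) :=
  ((ftx_cont f).measurable.enorm).pow_const 2

lemma Gd.hq_p {F : FunRT} (h : Gd F) (p : ℤ) :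
    ∫⁻ ξ : ℝ, ENNReal.ofReal ((1 + ξ ^ 2 + (p : ℝ) ^ 2) ^ 2) * ‖ftx (F p) ξ‖ₑ ^ 2 ≠ ∞ :=
  ENNReal.ne_top_of_tsum_ne_top h.hq p

lemma int_of_weight {f : ℝ → ℂ} (hf : AEStronglyMeasurable f)
    (h : ∫⁻ x, ENNReal.ofReal (1 + x ^ 2) * ‖f x‖ₑ ^ 2 ≠ ∞) : Integrable f := by
  refine ⟨hf, ?_⟩
  have h1 := l1_weight hf one_pos
  simp only [div_one] at h1
  have h2 : (∫⁻ x, ‖f x‖ₑ) ^ 2 ≠ ∞ :=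
    ne_top_of_le_ne_top (ENNReal.mul_ne_top ENNReal.ofReal_ne_top h) h1
  rw [hasFiniteIntegral_iff_enorm]
  exact lt_top_iff_ne_top.2 (by simpa using h2)

lemma Gd.ftx_int {F : FunRT} (h : Gd F) (p : ℤ) : Integrable (ftx (F p)) := by
  apply int_of_weight (ftx_cont _).aestronglyMeasurable
  refine ne_top_of_le_ne_top (h.hq_p p) ?_
  gcongr with ξ
  nlinarith [sq_nonneg ξ, sq_nonneg (p : ℝ)]

lemma Gd.memLp {F : FunRT} (h : Gd F) (p : ℤ) : MemLp (F p) 2 := memLp_of_ftx (h.int p) (h.ftx_int p)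

lemma L2_le_ftx {f : ℝ → ℂ} (hf : Integrable f) (h2 : MemLp f 2) :
    ∫⁻ x, ‖f x‖ₑ ^ 2 ≤ ∫⁻ ξ, ‖ftx f ξ‖ₑ ^ 2 := by
  rw [plancherel hf h2]
  refine le_mul_of_one_le_left (zero_le) ?_
  rw [ENNReal.one_le_ofReal]
  nlinarith [Real.pi_gt_three]

lemma Gd.L2w_le {F : FunRT} (h : Gd F) (n : ℕ) : L2w n F ≤ Hq n F := by
  unfold L2w Hq
  gcongr with p
  refine (mul_le_mul_right (L2_le_ftx (h.int p) (h.memLp p)) _).trans ?_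
  rw [← lintegral_const_mul _ (meas_ftx _)]
  gcongr with ξ
  nlinarith [sq_nonneg ξ, sq_nonneg (p : ℝ)]

def S0 : ℝ≥0∞ := ∑' p : ℤ, ENNReal.ofReal (1 + (p : ℝ) ^ 2)⁻¹

lemma S0_ne_top : S0 ≠ ∞ := by
  have h : Summable fun p : ℤ => (1 + (p : ℝ) ^ 2)⁻¹ := by
    have h1 : Summable fun p : ℤ => 1 / ((p : ℝ) ^ 2) := by
      simpa using (Real.summable_one_div_int_pow (p := 2)).2 (by norm_num)
    have h2 : Summable fun p : ℤ => (if p = 0 then (1 : ℝ) else 0) :=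
      summable_of_ne_finset_zero (s := {0}) (by intro b hb; simpa using hb)
    refine Summable.of_nonneg_of_le (fun p => by positivity) (fun p => ?_) (h1.add h2)
    by_cases hp : p = 0
    · simp [hp]
    · have : 0 < (p : ℝ) ^ 2 := by positivity
      simp only [hp, if_false, add_zero, one_div]
      gcongr; linarith
  exact h.tsum_ofReal_ne_top

lemma S0_cs (a : ℤ → ℝ≥0∞) : (∑' p, a p) ^ 2 ≤ S0 * ∑' p : ℤ, ENNReal.ofReal (1 + (p : ℝ) ^ 2) * a p ^ 2 := by
  have h := cs_tsum (fun p : ℤ => ENNReal.ofReal (Real.sqrt (1 + (p : ℝ) ^ 2)⁻¹))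
    (fun p : ℤ => ENNReal.ofReal (Real.sqrt (1 + (p : ℝ) ^ 2)) * a p)
  have e1 : ∀ p : ℤ, ENNReal.ofReal (Real.sqrt (1 + (p : ℝ) ^ 2)⁻¹) *
      (ENNReal.ofReal (Real.sqrt (1 + (p : ℝ) ^ 2)) * a p) = a p := by
    intro p
    have hpos : 0 < 1 + (p : ℝ) ^ 2 := by positivity
    rw [← mul_assoc, ← ENNReal.ofReal_mul (by positivity), Real.sqrt_inv,
      inv_mul_cancel₀ (Real.sqrt_pos.2 hpos).ne']
    simp
  simp only [e1] at h
  refine h.trans (le_of_eq ?_)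
  rw [S0]
  congr 1
  · congr 1; ext p
    rw [← ENNReal.ofReal_pow (by positivity), Real.sq_sqrt (by positivity)]
  · congr 1; ext p
    rw [mul_pow, ← ENNReal.ofReal_pow (by positivity), Real.sq_sqrt (by positivity)]

lemma Abound_p {F : FunRT} (h : Gd F) (p : ℤ) :
    ENNReal.ofReal (1 + (p : ℝ) ^ 2) * ((∫⁻ y, ‖F p y‖ₑ) ^ 2 + (∫⁻ ξ, ‖ftx (F p) ξ‖ₑ) ^ 2) ≤
     ENNReal.ofReal (2 * Real.pi) * ((∫⁻ ξ : ℝ, ENNReal.ofReal ((1 + ξ ^ 2 + (p : ℝ) ^ 2) ^ 2) * ‖ftx (F p) ξ‖ₑ ^ 2) +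
      ∫⁻ x, ‖xMul F p x‖ₑ ^ 2) := by
  set w : ℝ := 1 + (p : ℝ) ^ 2 with hw
  have hw0 : 0 < w := by positivity
  set T := ∫⁻ ξ : ℝ, ENNReal.ofReal ((1 + ξ ^ 2 + (p : ℝ) ^ 2) ^ 2) * ‖ftx (F p) ξ‖ₑ ^ 2 with hT
  set X := ∫⁻ x, ‖xMul F p x‖ₑ ^ 2 with hX
  have hmF : AEMeasurable (fun x => ‖F p x‖ₑ ^ 2) := ((h.int p).1.enorm).pow_const 2
  have h1 : ENNReal.ofReal w * (∫⁻ y, ‖F p y‖ₑ) ^ 2 ≤ ENNReal.ofReal Real.pi * (T + X) := by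
    have a := l1_weight (h.int p).1 hw0
    calc _ ≤ ENNReal.ofReal w * (ENNReal.ofReal (Real.pi * w) *
          ∫⁻ x, ENNReal.ofReal (1 + (x / w) ^ 2) * ‖F p x‖ₑ ^ 2) := by gcongr
      _ = ENNReal.ofReal Real.pi * ∫⁻ x, (ENNReal.ofReal (w ^ 2) * ‖F p x‖ₑ ^ 2 + ‖xMul F p x‖ₑ ^ 2) := by
          rw [← mul_assoc, ← ENNReal.ofReal_mul hw0.le, show w * (Real.pi * w) = Real.pi * w ^ 2 by ring,
            ENNReal.ofReal_mul Real.pi_pos.le, mul_assoc]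
          congr 1
          rw [← lintegral_const_mul' _ _ ENNReal.ofReal_ne_top]
          apply lintegral_congr; intro x
          rw [← mul_assoc, ← ENNReal.ofReal_mul (by positivity)]
          rw [show w ^ 2 * (1 + (x / w) ^ 2) = w ^ 2 + |x| ^ 2 by rw [sq_abs]; field_simp]
          rw [ENNReal.ofReal_add (by positivity) (by positivity), add_mul]
          congr 1
          rw [xMul, enorm_mul, mul_pow, ENNReal.ofReal_pow (abs_nonneg _), ← Real.enorm_eq_ofReal_abs]
          congr 2
          rw [← ofReal_norm, ← ofReal_norm, Complex.norm_real]
      _ = ENNReal.ofReal Real.pi * ((∫⁻ x, ENNReal.ofReal (w ^ 2) * ‖F p x‖ₑ ^ 2) + X) := by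
          rw [lintegral_add_left' (by fun_prop)]
      _ ≤ _ := by
          gcongr
          rw [lintegral_const_mul' _ _ ENNReal.ofReal_ne_top]
          refine (mul_le_mul_right (L2_le_ftx (h.int p) (h.memLp p)) _).trans ?_
          rw [← lintegral_const_mul _ (meas_ftx _), hT]
          gcongr with ξ
          rw [hw]; nlinarith [sq_nonneg ξ, sq_nonneg (p : ℝ)]
  have h2 : ENNReal.ofReal w * (∫⁻ ξ, ‖ftx (F p) ξ‖ₑ) ^ 2 ≤ ENNReal.ofReal Real.pi * T := by
    have a := l1_weight (ftx_cont (F p)).aestronglyMeasurable one_pos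
    simp only [div_one, mul_one] at a
    calc _ ≤ ENNReal.ofReal w * (ENNReal.ofReal Real.pi *
          ∫⁻ x, ENNReal.ofReal (1 + x ^ 2) * ‖ftx (F p) x‖ₑ ^ 2) := by gcongr
      _ = ENNReal.ofReal Real.pi * ∫⁻ x, ENNReal.ofReal w * (ENNReal.ofReal (1 + x ^ 2) * ‖ftx (F p) x‖ₑ ^ 2) := by
          rw [lintegral_const_mul' _ _ ENNReal.ofReal_ne_top]; ring
      _ ≤ _ := by
          rw [hT]
          refine mul_le_mul_right (lintegral_mono fun ξ => ?_) _
          rw [← mul_assoc, ← ENNReal.ofReal_mul (by positivity)]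
          gcongr
          rw [hw]; nlinarith [sq_nonneg ξ, sq_nonneg (p : ℝ), sq_nonneg (ξ * p)]
  rw [mul_add]
  calc _ ≤ ENNReal.ofReal Real.pi * (T + X) + ENNReal.ofReal Real.pi * (T + X) := by
        refine add_le_add h1 (h2.trans ?_)
        gcongr; exact le_self_add
    _ = _ := by
        rw [ENNReal.ofReal_mul (by norm_num)]
        simp only [ENNReal.ofReal_ofNat]; ring

def CA : ℝ := 4 * Real.pi * S0.toReal

lemma S0_pos : 0 < S0.toReal := by
  apply ENNReal.toReal_pos _ S0_ne_top
  intro h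
  rw [S0, ENNReal.tsum_eq_zero] at h
  simpa using h 0

lemma CA_pos : 0 < CA := by
  have := S0_pos
  have := Real.pi_pos
  unfold CA; positivity

lemma Abound (t : ℝ) {F : FunRT} (h : Gd F) :
    Aw (expA t F) ^ 2 ≤ ENNReal.ofReal (CA * (1 + |t|)⁻¹) * (Hq 2 F + L2sq (xMul F)) := by
  have h0 : 0 ≤ (1 + |t|)⁻¹ := by positivity
  unfold Aw
  simp only [enorm_expA]
  refine (S0_cs _).trans ?_
  calc _ ≤ S0 * ∑' p : ℤ, ENNReal.ofReal (2 * (1 + |t|)⁻¹) * (ENNReal.ofReal (2 * Real.pi) *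
      ((∫⁻ ξ : ℝ, ENNReal.ofReal ((1 + ξ ^ 2 + (p : ℝ) ^ 2) ^ 2) * ‖ftx (F p) ξ‖ₑ ^ 2) +
      ∫⁻ x, ‖xMul F p x‖ₑ ^ 2)) := by
        refine mul_le_mul_right (ENNReal.tsum_le_tsum fun p => ?_) _
        refine (mul_le_mul_right (iSup_sq_le fun x => sup_bound_e (h.int p) (h.ftx_int p) t x) _).trans ?_
        rw [mul_left_comm]
        exact mul_le_mul_right (Abound_p h p) _
    _ = _ := by
        rw [ENNReal.tsum_mul_left, ENNReal.tsum_mul_left, ENNReal.tsum_add, ← L2sq_eq, ← Hq]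
        have : ENNReal.ofReal (CA * (1 + |t|)⁻¹) = S0 * ENNReal.ofReal (2 * (1 + |t|)⁻¹) * ENNReal.ofReal (2 * Real.pi) := by
          rw [mul_assoc, ← ENNReal.ofReal_mul (by positivity)]
          nth_rewrite 1 [← ENNReal.ofReal_toReal S0_ne_top]
          rw [← ENNReal.ofReal_mul ENNReal.toReal_nonneg]
          congr 1; unfold CA; ring
        rw [this]; ring

end NtProof

namespace NtProof
open scoped FourierTransform Topology

/-! ### Products -/

lemma half_mul_half (b : ℝ≥0∞) : b ^ (1 / 2 : ℝ) * b ^ (1 / 2 : ℝ) = b := by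
  rw [← ENNReal.rpow_add_of_nonneg _ _ (by norm_num) (by norm_num)]; norm_num

lemma cs_w {ι : Type*} (a b : ι → ℝ≥0∞) :
    (∑' i, a i * b i) ^ 2 ≤ (∑' i, a i ^ 2 * b i) * ∑' i, b i := by
  have h := cs_tsum (fun i => a i * b i ^ (1 / 2 : ℝ)) (fun i => b i ^ (1 / 2 : ℝ))
  have e1 : ∀ i, a i * b i ^ (1 / 2 : ℝ) * b i ^ (1 / 2 : ℝ) = a i * b i := fun i => by
    rw [mul_assoc, half_mul_half]
  have e2 : ∀ i, (a i * b i ^ (1 / 2 : ℝ)) ^ 2 = a i ^ 2 * b i := fun i => by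
    rw [mul_pow, pow_two (b i ^ _), half_mul_half]
  have e3 : ∀ i, (b i ^ (1 / 2 : ℝ)) ^ 2 = b i := fun i => by
    rw [pow_two, half_mul_half]
  simpa only [e1, e2, e3] using h

lemma tsum_shift (f : ℤ → ℝ≥0∞) (p : ℤ) : ∑' q, f (p - q) = ∑' q, f q :=
  (Equiv.subLeft p).tsum_eq f

lemma tsum_shift' (f : ℤ → ℝ≥0∞) (p : ℤ) : ∑' q, f (q - p) = ∑' q, f q :=
  (Equiv.subRight p).tsum_eq f

lemma young_left (a b : ℤ → ℝ → ℝ≥0∞) (ha : ∀ q, Measurable (a q)) :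
    ∑' p : ℤ, ∫⁻ x, (∑' q, a q x * b (p - q) x) ^ 2 ≤
      (∑' p, ∫⁻ x, a p x ^ 2) * (∑' q, ⨆ x, b q x) ^ 2 := by
  set B : ℤ → ℝ≥0∞ := fun q => ⨆ x, b q x with hB
  have h1 : ∀ p x, (∑' q, a q x * b (p - q) x) ^ 2 ≤ (∑' q, a q x ^ 2 * B (p - q)) * ∑' q, B q := by
    intro p x
    calc _ ≤ (∑' q, a q x * B (p - q)) ^ 2 := by
          gcongr with q
          exact le_iSup (fun x => b (p - q) x) x
      _ ≤ _ := cs_w _ _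
      _ = _ := by rw [tsum_shift B p]
  calc _ ≤ ∑' p : ℤ, ∫⁻ x, (∑' q, a q x ^ 2 * B (p - q)) * ∑' q, B q := by
        exact ENNReal.tsum_le_tsum fun p => lintegral_mono fun x => h1 p x
    _ = ∑' p : ℤ, ∑' q, (∫⁻ x, a q x ^ 2) * B (p - q) * ∑' q, B q := by
        congr 1; ext p
        rw [lintegral_mul_const _ (by fun_prop), lintegral_tsum (by fun_prop), ENNReal.tsum_mul_right]
        congr 2; ext q
        rw [lintegral_mul_const _ (by fun_prop)]
    _ = _ := by
        rw [ENNReal.tsum_comm]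
        have : ∀ q, ∑' p : ℤ, (∫⁻ x, a q x ^ 2) * B (p - q) * ∑' q, B q =
            (∫⁻ x, a q x ^ 2) * (∑' q, B q) ^ 2 := by
          intro q
          rw [ENNReal.tsum_mul_right, ENNReal.tsum_mul_left]
          rw [tsum_shift' B]; ring
        simp_rw [this]
        rw [ENNReal.tsum_mul_right]

lemma conv_comm (a b : ℤ → ℝ → ℝ≥0∞) (p : ℤ) (x : ℝ) :
    ∑' q, a q x * b (p - q) x = ∑' q, b q x * a (p - q) x := by
  rw [← tsum_shift _ p]
  congr 1; ext q; rw [sub_sub_cancel, mul_comm]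

lemma young_right (a b : ℤ → ℝ → ℝ≥0∞) (hb : ∀ q, Measurable (b q)) :
    ∑' p : ℤ, ∫⁻ x, (∑' q, a q x * b (p - q) x) ^ 2 ≤
      (∑' q, ⨆ x, a q x) ^ 2 * (∑' p, ∫⁻ x, b p x ^ 2) := by
  simp_rw [conv_comm a b]
  rw [mul_comm]
  exact young_left b a hb

structure Nice (U : FunRT) : Prop where
  cont : ∀ p, Continuous (U p)
  aw : Aw U ≠ ∞
  l2 : L2sq U ≠ ∞

lemma Nice.meas {U : FunRT} (h : Nice U) (p : ℤ) : Measurable fun x => ‖U p x‖ₑ :=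
  (h.cont p).measurable.enorm

lemma mulF_enorm (U V : FunRT) (p : ℤ) (x : ℝ) :
    ‖mulF U V p x‖ₑ ≤ ∑' q, ‖U q x‖ₑ * ‖V (p - q) x‖ₑ := by
  refine enorm_tsum_le_tsum_enorm.trans (le_of_eq ?_)
  simp_rw [enorm_mul]

lemma L2sq_mul_left {U : FunRT} (V : FunRT) (hU : Nice U) :
    L2sq (mulF U V) ≤ L2sq U * Aw V ^ 2 := by
  refine le_trans ?_ (young_left (fun q x => ‖U q x‖ₑ) (fun q x => ‖V q x‖ₑ) hU.meas)
  rw [L2sq_eq]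
  gcongr with p x
  exact mulF_enorm U V p x

lemma L2sq_mul_right (U : FunRT) {V : FunRT} (hV : Nice V) :
    L2sq (mulF U V) ≤ Aw U ^ 2 * L2sq V := by
  refine le_trans ?_ (young_right (fun q x => ‖U q x‖ₑ) (fun q x => ‖V q x‖ₑ) hV.meas)
  rw [L2sq_eq]
  gcongr with p x
  exact mulF_enorm U V p x

def sw (n : ℕ) (p : ℤ) : ℝ≥0∞ := ENNReal.ofReal (Real.sqrt (1 + (p : ℝ) ^ 2) ^ n)

lemma sw_sq (n : ℕ) (p : ℤ) : sw n p ^ 2 = ENNReal.ofReal ((1 + (p : ℝ) ^ 2) ^ n) := by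
  rw [sw, ← ENNReal.ofReal_pow (by positivity), ← pow_mul, mul_comm, pow_mul, Real.sq_sqrt (by positivity)]

lemma sw_add (n : ℕ) (p q : ℤ) : sw n p ≤ 2 ^ n * (sw n q + sw n (p - q)) := by
  have h1 : Real.sqrt (1 + (p : ℝ) ^ 2) ≤ Real.sqrt (1 + (q : ℝ) ^ 2) + Real.sqrt (1 + ((p - q : ℤ) : ℝ) ^ 2) := by
    apply Real.sqrt_le_iff.2
    refine ⟨by positivity, ?_⟩
    rw [add_sq, Real.sq_sqrt (by positivity), Real.sq_sqrt (by positivity)]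
    have h2 : (q : ℝ) * ((p - q : ℤ) : ℝ) ≤ Real.sqrt (1 + (q : ℝ) ^ 2) * Real.sqrt (1 + ((p - q : ℤ) : ℝ) ^ 2) := by
      refine (le_abs_self _).trans ?_
      rw [abs_mul]
      gcongr
      · apply Real.abs_le_sqrt; linarith
      · apply Real.abs_le_sqrt; linarith
    have h3 : (p : ℝ) = q + ((p - q : ℤ) : ℝ) := by push_cast; ring
    rw [h3]
    nlinarith
  have h2 : Real.sqrt (1 + (p : ℝ) ^ 2) ^ n ≤ 2 ^ n * (Real.sqrt (1 + (q : ℝ) ^ 2) ^ n +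
      Real.sqrt (1 + ((p - q : ℤ) : ℝ) ^ 2) ^ n) := by
    refine (pow_le_pow_left₀ (by positivity) h1 n).trans ((add_pow_le (by positivity) (by positivity) n).trans ?_)
    gcongr
    · norm_num
    · omega
  unfold sw
  rw [← ENNReal.ofReal_add (by positivity) (by positivity)]
  have : (2 : ℝ≥0∞) ^ n = ENNReal.ofReal (2 ^ n) := by
    rw [ENNReal.ofReal_pow (by norm_num)]; norm_num
  rw [this, ← ENNReal.ofReal_mul (by positivity)]
  exact ENNReal.ofReal_le_ofReal h2

lemma L2w_eq (n : ℕ) (U : FunRT) : L2w n U = ∑' p, ∫⁻ x, (sw n p * ‖U p x‖ₑ) ^ 2 := by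
  unfold L2w
  congr 1; ext p
  simp_rw [mul_pow, sw_sq]
  rw [lintegral_const_mul' _ _ ENNReal.ofReal_ne_top]

lemma add_sq_le (a b : ℝ≥0∞) : (a + b) ^ 2 ≤ 2 * (a ^ 2 + b ^ 2) := by
  have := ENNReal.rpow_add_le_mul_rpow_add_rpow a b (p := 2) (by norm_num)
  norm_num at this
  exact this

lemma L2w_mul (n : ℕ) {U V : FunRT} (hU : Nice U) (hV : Nice V) :
    L2w n (mulF U V) ≤ 2 * 4 ^ n * (L2w n U * Aw V ^ 2 + Aw U ^ 2 * L2w n V) := by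
  have hy1 := young_left (fun q x => sw n q * ‖U q x‖ₑ) (fun q x => ‖V q x‖ₑ)
    (fun q => (hU.meas q).const_mul _)
  have hy2 := young_right (fun q x => ‖U q x‖ₑ) (fun q x => sw n q * ‖V q x‖ₑ)
    (fun q => (hV.meas q).const_mul _)
  rw [← L2w_eq] at hy1 hy2
  have h1 : ∀ p x, (sw n p * ‖mulF U V p x‖ₑ) ^ 2 ≤ 2 * 4 ^ n *
      ((∑' q, sw n q * ‖U q x‖ₑ * ‖V (p - q) x‖ₑ) ^ 2 + (∑' q, ‖U q x‖ₑ * (sw n (p - q) * ‖V (p - q) x‖ₑ)) ^ 2) := by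
    intro p x
    have : sw n p * ‖mulF U V p x‖ₑ ≤ 2 ^ n * ((∑' q, sw n q * ‖U q x‖ₑ * ‖V (p - q) x‖ₑ) +
        ∑' q, ‖U q x‖ₑ * (sw n (p - q) * ‖V (p - q) x‖ₑ)) := by
      calc _ ≤ sw n p * ∑' q, ‖U q x‖ₑ * ‖V (p - q) x‖ₑ := mul_le_mul_right (mulF_enorm U V p x) _
        _ = ∑' q, sw n p * (‖U q x‖ₑ * ‖V (p - q) x‖ₑ) := by rw [ENNReal.tsum_mul_left]
        _ ≤ ∑' q, 2 ^ n * (sw n q + sw n (p - q)) * (‖U q x‖ₑ * ‖V (p - q) x‖ₑ) := by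
            gcongr with q
            exact sw_add n p q
        _ = _ := by
            rw [← ENNReal.tsum_add, ← ENNReal.tsum_mul_left]
            congr 1; ext q; ring
    refine (pow_le_pow_left₀ (zero_le) this 2).trans ?_
    rw [mul_pow, ← pow_mul, mul_comm n 2, pow_mul, show (2 : ℝ≥0∞) ^ 2 = 4 by norm_num, mul_comm 2 (4 ^ n), mul_assoc]
    exact mul_le_mul_right (add_sq_le _ _) _
  calc L2w n (mulF U V) ≤ ∑' p, ∫⁻ x, 2 * 4 ^ n *
      ((∑' q, sw n q * ‖U q x‖ₑ * ‖V (p - q) x‖ₑ) ^ 2 + (∑' q, ‖U q x‖ₑ * (sw n (p - q) * ‖V (p - q) x‖ₑ)) ^ 2) := by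
        rw [L2w_eq]
        exact ENNReal.tsum_le_tsum fun p => lintegral_mono fun x => h1 p x
    _ = 2 * 4 ^ n * ((∑' p : ℤ, ∫⁻ x, (∑' q, sw n q * ‖U q x‖ₑ * ‖V (p - q) x‖ₑ) ^ 2) +
        ∑' p : ℤ, ∫⁻ x, (∑' q, ‖U q x‖ₑ * (sw n (p - q) * ‖V (p - q) x‖ₑ)) ^ 2) := by
        rw [← ENNReal.tsum_add, ← ENNReal.tsum_mul_left]
        congr 1; ext p
        have hm : Measurable fun x => (∑' q, sw n q * ‖U q x‖ₑ * ‖V (p - q) x‖ₑ) ^ 2 :=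
          (Measurable.tsum fun q => ((hU.meas q).const_mul _).mul (hV.meas _)).pow_const 2
        rw [lintegral_const_mul', lintegral_add_left hm]
        exact ENNReal.mul_ne_top (by norm_num) (by finiteness)
    _ ≤ _ := mul_le_mul_right (add_le_add hy1 hy2) _

lemma Aw_mul_aux (U V : FunRT) (p : ℤ) (x : ℝ) :
    ‖mulF U V p x‖ₑ ≤ ∑' q, (⨆ x, ‖U q x‖ₑ) * ⨆ x, ‖V (p - q) x‖ₑ := by
  refine (mulF_enorm U V p x).trans ?_
  gcongr with q
  · exact le_iSup (fun x => ‖U q x‖ₑ) x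
  · exact le_iSup (fun x => ‖V (p - q) x‖ₑ) x

lemma Aw_mul (U V : FunRT) : Aw (mulF U V) ≤ Aw U * Aw V := by
  calc Aw (mulF U V) ≤ ∑' p : ℤ, ∑' q : ℤ, (⨆ x, ‖U q x‖ₑ) * ⨆ x, ‖V (p - q) x‖ₑ :=
        ENNReal.tsum_le_tsum fun p => iSup_le fun x => Aw_mul_aux U V p x
    _ = Aw U * Aw V := by
        rw [ENNReal.tsum_comm]
        unfold Aw
        rw [← ENNReal.tsum_mul_right]
        congr 1; ext q
        rw [ENNReal.tsum_mul_left, tsum_shift' fun q => ⨆ x, ‖V q x‖ₑ]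

lemma Nice.sup_ne {U : FunRT} (h : Nice U) (q : ℤ) : (⨆ x, ‖U q x‖ₑ) ≠ ∞ :=
  ENNReal.ne_top_of_tsum_ne_top h.aw q

lemma conv_ne_top {U V : FunRT} (hU : Nice U) (hV : Nice V) (p : ℤ) :
    ∑' q, (⨆ x, ‖U q x‖ₑ) * ⨆ x, ‖V (p - q) x‖ₑ ≠ ∞ := by
  refine ne_top_of_le_ne_top (ENNReal.mul_ne_top hU.aw hV.aw) ?_
  unfold Aw
  rw [← ENNReal.tsum_mul_right]
  gcongr with q
  exact ENNReal.le_tsum (f := fun q => ⨆ x, ‖V q x‖ₑ) (p - q)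

lemma summable_mul {U V : FunRT} (hU : Nice U) (hV : Nice V) (p : ℤ) (x : ℝ) :
    Summable fun q => U q x * V (p - q) x := by
  refine Summable.of_norm_bounded (ENNReal.summable_toReal (conv_ne_top hU hV p)) fun q => ?_
  rw [← toReal_enorm, enorm_mul]
  apply ENNReal.toReal_mono (ENNReal.mul_ne_top (hU.sup_ne q) (hV.sup_ne _))
  gcongr
  · exact le_iSup (fun x => ‖U q x‖ₑ) x
  · exact le_iSup (fun x => ‖V (p - q) x‖ₑ) x

lemma Nice.mul {U V : FunRT} (hU : Nice U) (hV : Nice V) : Nice (mulF U V) where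
  cont := by
    intro p
    refine continuous_tsum (fun q => (hU.cont q).mul (hV.cont (p - q)))
      (ENNReal.summable_toReal (conv_ne_top hU hV p)) fun q x => ?_
    rw [← toReal_enorm, enorm_mul]
    apply ENNReal.toReal_mono (ENNReal.mul_ne_top (hU.sup_ne q) (hV.sup_ne _))
    gcongr
    · exact le_iSup (fun x => ‖U q x‖ₑ) x
    · exact le_iSup (fun x => ‖V (p - q) x‖ₑ) x
  aw := ne_top_of_le_ne_top (ENNReal.mul_ne_top hU.aw hV.aw) (Aw_mul U V)
  l2 := ne_top_of_le_ne_top (ENNReal.mul_ne_top hU.l2 (ENNReal.pow_ne_top hV.aw)) (L2sq_mul_left V hU)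

lemma mulF_int {U V : FunRT} (hU : Nice U) (hV : Nice V) (p : ℤ) : Integrable (mulF U V p) := by
  refine ⟨((hU.mul hV).cont p).aestronglyMeasurable, ?_⟩
  rw [hasFiniteIntegral_iff_enorm, lt_top_iff_ne_top]
  have h : ∫⁻ x, ‖mulF U V p x‖ₑ ≤ ∑' q, ((∫⁻ x, ‖U q x‖ₑ ^ 2) + ∫⁻ x, ‖V (p - q) x‖ₑ ^ 2) := by
    calc _ ≤ ∫⁻ x, ∑' q, (‖U q x‖ₑ ^ 2 + ‖V (p - q) x‖ₑ ^ 2) := by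
          refine lintegral_mono fun x => (mulF_enorm U V p x).trans (ENNReal.tsum_le_tsum fun q => ?_)
          rcases le_total ‖U q x‖ₑ ‖V (p - q) x‖ₑ with h | h
          · calc _ ≤ ‖V (p - q) x‖ₑ * ‖V (p - q) x‖ₑ := by gcongr
              _ ≤ _ := by rw [← pow_two]; exact le_add_self
          · calc _ ≤ ‖U q x‖ₑ * ‖U q x‖ₑ := by gcongr
              _ ≤ _ := by rw [← pow_two]; exact le_self_add
      _ = _ := by
          have hm : ∀ q, AEMeasurable fun x => ‖U q x‖ₑ ^ 2 + ‖V (p - q) x‖ₑ ^ 2 :=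
            fun q => (((hU.meas q).pow_const 2).add ((hV.meas _).pow_const 2)).aemeasurable
          rw [lintegral_tsum hm]
          congr 1; ext q
          rw [lintegral_add_left ((hU.meas q).pow_const 2)]
  refine ne_top_of_le_ne_top ?_ h
  rw [ENNReal.tsum_add, tsum_shift (fun q => ∫⁻ x, ‖V q x‖ₑ ^ 2) p]
  exact ENNReal.add_ne_top.2 ⟨hU.l2, hV.l2⟩

/-! ### Linear structure -/

def tau (a : ℝ) (U : FunRT) : FunRT := fun p x => U p (x + a)

def dl (h : ℝ) (U : FunRT) : FunRT := fun p x => U p (x + h) - U p x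

lemma L2w_tau (n : ℕ) (a : ℝ) (U : FunRT) : L2w n (tau a U) = L2w n U := by
  unfold L2w tau
  congr 1; ext p
  rw [lintegral_add_right_eq_self (fun x => ‖U p x‖ₑ ^ 2) a]

lemma L2sq_tau (a : ℝ) (U : FunRT) : L2sq (tau a U) = L2sq U := by
  rw [← L2w_zero, ← L2w_zero, L2w_tau]

lemma Aw_tau (a : ℝ) (U : FunRT) : Aw (tau a U) = Aw U := by
  unfold Aw tau
  congr 1; ext p
  exact (Equiv.addRight a).iSup_comp (g := fun x => ‖U p x‖ₑ)

lemma Nice.tau1 {U : FunRT} (h : Nice U) (a : ℝ) : Nice (tau a U) where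
  cont p := (h.cont p).comp (continuous_add_const a)
  aw := by rw [Aw_tau]; exact h.aw
  l2 := by rw [L2sq_tau]; exact h.l2

lemma Aw_add (U V : FunRT) : Aw (U + V) ≤ Aw U + Aw V := by
  unfold Aw
  rw [← ENNReal.tsum_add]
  refine ENNReal.tsum_le_tsum fun p => iSup_le fun x => (enorm_add_le _ _).trans ?_
  exact add_le_add (le_iSup (fun x => ‖U p x‖ₑ) x) (le_iSup (fun x => ‖V p x‖ₑ) x)

lemma L2w_add (n : ℕ) {U V : FunRT} (hU : ∀ p, AEStronglyMeasurable (U p)) :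
    L2w n (U + V) ≤ 2 * (L2w n U + L2w n V) := by
  unfold L2w
  rw [← ENNReal.tsum_add, ← ENNReal.tsum_mul_left]
  refine ENNReal.tsum_le_tsum fun p => ?_
  rw [← mul_add, mul_left_comm, ← lintegral_add_left' ((hU p).enorm.pow_const 2),
    ← lintegral_const_mul' 2 _ (by norm_num)]
  refine mul_le_mul_right (lintegral_mono fun x => ?_) _
  exact (pow_le_pow_left₀ zero_le (enorm_add_le _ _) 2).trans (add_sq_le _ _)

lemma L2sq_add {U V : FunRT} (hU : ∀ p, AEStronglyMeasurable (U p)) :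
    L2sq (U + V) ≤ 2 * (L2sq U + L2sq V) := by
  simp only [← L2w_zero]; exact L2w_add 0 hU

lemma Nice.aesm {U : FunRT} (h : Nice U) (p : ℤ) : AEStronglyMeasurable (U p) :=
  (h.cont p).aestronglyMeasurable

lemma Nice.add {U V : FunRT} (hU : Nice U) (hV : Nice V) : Nice (U + V) where
  cont p := (hU.cont p).add (hV.cont p)
  aw := ne_top_of_le_ne_top (ENNReal.add_ne_top.2 ⟨hU.aw, hV.aw⟩) (Aw_add U V)
  l2 := ne_top_of_le_ne_top (ENNReal.mul_ne_top (by norm_num) (ENNReal.add_ne_top.2 ⟨hU.l2, hV.l2⟩))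
    (L2sq_add hU.aesm)

lemma L2w_smul (n : ℕ) (c : ℂ) (U : FunRT) : L2w n (c • U) = ‖c‖ₑ ^ 2 * L2w n U := by
  unfold L2w
  rw [← ENNReal.tsum_mul_left]
  congr 1; ext p
  rw [mul_left_comm, ← lintegral_const_mul' (‖c‖ₑ ^ 2) _ (by finiteness)]
  congr 1
  refine lintegral_congr fun x => ?_
  simp only [Pi.smul_apply, smul_eq_mul, enorm_mul, mul_pow]

lemma L2sq_smul (c : ℂ) (U : FunRT) : L2sq (c • U) = ‖c‖ₑ ^ 2 * L2sq U := by
  simp only [← L2w_zero]; exact L2w_smul 0 c U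

lemma Aw_smul (c : ℂ) (U : FunRT) : Aw (c • U) = ‖c‖ₑ * Aw U := by
  unfold Aw
  rw [← ENNReal.tsum_mul_left]
  congr 1; ext p
  rw [ENNReal.mul_iSup]
  congr 1; ext x
  simp only [Pi.smul_apply, smul_eq_mul, enorm_mul]

lemma Nice.smul {U : FunRT} (hU : Nice U) (c : ℂ) : Nice (c • U) where
  cont p := (hU.cont p).const_smul c
  aw := by rw [Aw_smul]; exact ENNReal.mul_ne_top (by finiteness) hU.aw
  l2 := by rw [L2sq_smul]; exact ENNReal.mul_ne_top (by finiteness) hU.l2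

lemma sub_eq_add_smul (U V : FunRT) : U - V = U + (-1 : ℂ) • V := by
  rw [neg_one_smul, sub_eq_add_neg]

lemma Nice.sub {U V : FunRT} (hU : Nice U) (hV : Nice V) : Nice (U - V) := by
  rw [sub_eq_add_smul]; exact hU.add (hV.smul _)

lemma Aw_sub (U V : FunRT) : Aw (U - V) ≤ Aw U + Aw V := by
  rw [sub_eq_add_smul]
  refine (Aw_add _ _).trans ?_
  rw [Aw_smul]; simp

lemma L2w_sub (n : ℕ) {U V : FunRT} (hU : ∀ p, AEStronglyMeasurable (U p)) :
    L2w n (U - V) ≤ 2 * (L2w n U + L2w n V) := by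
  rw [sub_eq_add_smul]
  refine (L2w_add n hU).trans ?_
  rw [L2w_smul]; simp

lemma L2sq_sub {U V : FunRT} (hU : ∀ p, AEStronglyMeasurable (U p)) :
    L2sq (U - V) ≤ 2 * (L2sq U + L2sq V) := by
  simp only [← L2w_zero]; exact L2w_sub 0 hU

lemma dl_eq (h : ℝ) (U : FunRT) : dl h U = tau h U - U := rfl

lemma Nice.dl1 {U : FunRT} (hU : Nice U) (h : ℝ) : Nice (dl h U) := by
  rw [dl_eq]; exact (hU.tau1 h).sub hU

lemma Nice.dlk {U : FunRT} (hU : Nice U) (h : ℝ) (k : ℕ) : Nice ((dl h)^[k] U) := by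
  induction k with
  | zero => exact hU
  | succ k ih => rw [Function.iterate_succ_apply']; exact ih.dl1 h

lemma Aw_dl (h : ℝ) (U : FunRT) : Aw (dl h U) ≤ 2 * Aw U := by
  rw [dl_eq]; refine (Aw_sub _ _).trans (le_of_eq ?_); rw [Aw_tau]; ring

lemma L2w_dl (n : ℕ) (h : ℝ) {U : FunRT} (hU : Nice U) : L2w n (dl h U) ≤ 4 * L2w n U := by
  rw [dl_eq]; refine (L2w_sub n (hU.tau1 h).aesm).trans (le_of_eq ?_); rw [L2w_tau]; ring

lemma Aw_dlk (h : ℝ) (U : FunRT) (j : ℕ) : Aw ((dl h)^[j] U) ≤ 2 ^ j * Aw U := by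
  induction j with
  | zero => simp
  | succ k ih =>
    rw [Function.iterate_succ_apply', pow_succ']
    refine (Aw_dl _ _).trans ?_
    rw [mul_assoc]; gcongr

lemma L2w_dlk (n : ℕ) (h : ℝ) {U : FunRT} (hU : Nice U) (j : ℕ) :
    L2w n ((dl h)^[j] U) ≤ 4 ^ j * L2w n U := by
  induction j with
  | zero => simp
  | succ k ih =>
    rw [Function.iterate_succ_apply', pow_succ']
    refine (L2w_dl n _ (hU.dlk h k)).trans ?_
    rw [mul_assoc]; gcongr

lemma mulF_add_left {U U' V : FunRT} (hU : Nice U) (hU' : Nice U') (hV : Nice V) :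
    mulF (U + U') V = mulF U V + mulF U' V := by
  ext p x
  simp only [mulF, Pi.add_apply, add_mul]
  exact (summable_mul hU hV p x).tsum_add (summable_mul hU' hV p x)

lemma mulF_add_right {U V V' : FunRT} (hU : Nice U) (hV : Nice V) (hV' : Nice V') :
    mulF U (V + V') = mulF U V + mulF U V' := by
  ext p x
  simp only [mulF, Pi.add_apply, mul_add]
  exact (summable_mul hU hV p x).tsum_add (summable_mul hU hV' p x)

lemma mulF_smul_left (c : ℂ) (U V : FunRT) : mulF (c • U) V = c • mulF U V := by
  ext p x
  simp only [mulF, Pi.smul_apply, smul_eq_mul, mul_assoc]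
  exact tsum_mul_left

lemma mulF_smul_right (c : ℂ) (U V : FunRT) : mulF U (c • V) = c • mulF U V := by
  ext p x
  simp only [mulF, Pi.smul_apply, smul_eq_mul, mul_left_comm _ c]
  exact tsum_mul_left

lemma mulF_sub_left {U U' V : FunRT} (hU : Nice U) (hU' : Nice U') (hV : Nice V) :
    mulF (U - U') V = mulF U V - mulF U' V := by
  rw [sub_eq_add_smul, mulF_add_left hU (hU'.smul _) hV, mulF_smul_left, ← sub_eq_add_smul]

lemma mulF_sub_right {U V V' : FunRT} (hU : Nice U) (hV : Nice V) (hV' : Nice V') :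
    mulF U (V - V') = mulF U V - mulF U V' := by
  rw [sub_eq_add_smul, mulF_add_right hU hV (hV'.smul _), mulF_smul_right, ← sub_eq_add_smul]

lemma Nice.conj {U : FunRT} (hU : Nice U) : Nice (conjF U) := by
  refine ⟨fun p => Complex.continuous_conj.comp (hU.cont (-p)), ?_, ?_⟩
  · convert hU.aw using 1
    unfold Aw conjF
    simp only [RCLike.enorm_conj]
    exact (Equiv.neg ℤ).tsum_eq fun p => ⨆ x, ‖U p x‖ₑ
  · convert hU.l2 using 1
    rw [L2sq_eq, L2sq_eq]
    unfold conjF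
    simp only [RCLike.enorm_conj]
    exact (Equiv.neg ℤ).tsum_eq fun p => ∫⁻ x, ‖U p x‖ₑ ^ 2

lemma Aw_conj (U : FunRT) : Aw (conjF U) = Aw U := by
  unfold Aw conjF
  simp only [RCLike.enorm_conj]
  exact (Equiv.neg ℤ).tsum_eq fun p => ⨆ x, ‖U p x‖ₑ

lemma L2w_conj (n : ℕ) (U : FunRT) : L2w n (conjF U) = L2w n U := by
  unfold L2w conjF
  simp only [RCLike.enorm_conj]
  rw [← (Equiv.neg ℤ).tsum_eq]
  simp

lemma conjF_sub (U V : FunRT) : conjF (U - V) = conjF U - conjF V := by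
  ext p x; simp [conjF]

lemma dl_conj (h : ℝ) (U : FunRT) : dl h (conjF U) = conjF (dl h U) := by
  ext p x; simp [conjF, dl]

lemma dlk_conj (h : ℝ) (U : FunRT) (k : ℕ) : (dl h)^[k] (conjF U) = conjF ((dl h)^[k] U) := by
  induction k with
  | zero => rfl
  | succ k ih => rw [Function.iterate_succ_apply', Function.iterate_succ_apply', ih, dl_conj]

end NtProof

namespace NtProof
open scoped FourierTransform Topology

/-! ### Trilinear products and Leibniz rule -/

def tri (U V W : FunRT) : FunRT := mulF (mulF U V) W

lemma Nice.tri1 {U V W : FunRT} (hU : Nice U) (hV : Nice V) (hW : Nice W) : Nice (tri U V W) :=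
  (hU.mul hV).mul hW

lemma tri_int {U V W : FunRT} (hU : Nice U) (hV : Nice V) (hW : Nice W) (p : ℤ) :
    Integrable (tri U V W p) := mulF_int (hU.mul hV) hW p

lemma tri_L2_1 {U V W : FunRT} (hU : Nice U) (hV : Nice V) :
    L2sq (tri U V W) ≤ L2sq U * Aw V ^ 2 * Aw W ^ 2 := by
  refine (L2sq_mul_left W (hU.mul hV)).trans ?_
  gcongr
  exact L2sq_mul_left V hU

lemma tri_L2_2 {U V W : FunRT} (hU : Nice U) (hV : Nice V) :
    L2sq (tri U V W) ≤ L2sq V * Aw U ^ 2 * Aw W ^ 2 := by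
  refine (L2sq_mul_left W (hU.mul hV)).trans ?_
  gcongr
  rw [mul_comm]
  exact L2sq_mul_right U hV

lemma tri_L2_3 {U V W : FunRT} (hW : Nice W) :
    L2sq (tri U V W) ≤ L2sq W * Aw U ^ 2 * Aw V ^ 2 := by
  refine (L2sq_mul_right _ hW).trans ?_
  rw [mul_comm, mul_assoc, ← mul_pow]
  gcongr
  exact Aw_mul U V

def Bd (n : ℕ) (X Y Z : FunRT) : ℝ≥0∞ :=
  L2w n X * Aw Y ^ 2 * Aw Z ^ 2 + Aw X ^ 2 * (L2w n Y * Aw Z ^ 2 + Aw Y ^ 2 * L2w n Z)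

lemma Bd_perm1 (n : ℕ) (X Y Z : FunRT) : Bd n X Y Z = Bd n Y X Z := by unfold Bd; ring

lemma Bd_perm2 (n : ℕ) (X Y Z : FunRT) : Bd n X Y Z = Bd n Z X Y := by unfold Bd; ring

lemma one_le_two_four (n : ℕ) : (1 : ℝ≥0∞) ≤ 2 * 4 ^ n := by
  have h : (1 : ℝ≥0∞) ≤ 4 ^ n := one_le_pow₀ (by norm_num)
  calc (1 : ℝ≥0∞) ≤ 4 ^ n := h
    _ ≤ _ := by rw [two_mul]; exact le_self_add

lemma tri_L2w (n : ℕ) {U V W : FunRT} (hU : Nice U) (hV : Nice V) (hW : Nice W) :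
    L2w n (tri U V W) ≤ (2 * 4 ^ n) ^ 2 * Bd n U V W := by
  refine (L2w_mul n (hU.mul hV) hW).trans ?_
  calc _ ≤ 2 * 4 ^ n * ((2 * 4 ^ n * (L2w n U * Aw V ^ 2 + Aw U ^ 2 * L2w n V)) * Aw W ^ 2 +
      (2 * 4 ^ n) * ((Aw U * Aw V) ^ 2 * L2w n W)) := by
        refine mul_le_mul_right (add_le_add (mul_le_mul' (L2w_mul n hU hV) le_rfl)
          ((mul_le_mul' (pow_le_pow_left₀ zero_le (Aw_mul U V) 2) le_rfl).trans
            (le_mul_of_one_le_left zero_le (one_le_two_four n)))) _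
    _ = _ := by unfold Bd; ring

lemma dl_add (h : ℝ) (U V : FunRT) : dl h (U + V) = dl h U + dl h V := by
  ext p x; simp only [dl, Pi.add_apply]; ring

lemma dlk_add (h : ℝ) (k : ℕ) (U V : FunRT) : (dl h)^[k] (U + V) = (dl h)^[k] U + (dl h)^[k] V := by
  induction k generalizing U V with
  | zero => rfl
  | succ k ih => simp only [Function.iterate_succ_apply, dl_add, ih]

lemma dl_tau (h a : ℝ) (U : FunRT) : dl h (tau a U) = tau a (dl h U) := by
  ext p x; simp only [dl, tau]; congr 2; ring

lemma dlk_tau (h a : ℝ) (k : ℕ) (U : FunRT) : (dl h)^[k] (tau a U) = tau a ((dl h)^[k] U) := by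
  induction k generalizing U with
  | zero => rfl
  | succ k ih => simp only [Function.iterate_succ_apply, dl_tau, ih]

lemma tau_tau (a b : ℝ) (U : FunRT) : tau a (tau b U) = tau (a + b) U := by
  ext p x; simp only [tau]; congr 1; ring

lemma tau_zero (U : FunRT) : tau 0 U = U := by ext p x; simp [tau]

lemma dl_mul (h : ℝ) {U V : FunRT} (hU : Nice U) (hV : Nice V) :
    dl h (mulF U V) = mulF (dl h U) (tau h V) + mulF U (dl h V) := by
  rw [dl_eq, dl_eq, dl_eq, mulF_sub_left (hU.tau1 h) hU (hV.tau1 h), mulF_sub_right hU (hV.tau1 h) hV]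
  have : tau h (mulF U V) = mulF (tau h U) (tau h V) := rfl
  rw [this]; abel

lemma dl_tri (h : ℝ) {U V W : FunRT} (hU : Nice U) (hV : Nice V) (hW : Nice W) :
    dl h (tri U V W) = tri (dl h U) (tau h V) (tau h W) + tri U (dl h V) (tau h W) + tri U V (dl h W) := by
  unfold tri
  rw [dl_mul h (hU.mul hV) hW, dl_mul h hU hV,
    mulF_add_left ((hU.dl1 h).mul (hV.tau1 h)) (hU.mul (hV.dl1 h)) (hW.tau1 h)]

lemma leib (n : ℕ) (h : ℝ) (k : ℕ) (B : ℝ≥0∞) : ∀ {U V W : FunRT} (_ : Nice U) (_ : Nice V) (_ : Nice W)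
    (_ : ∀ i j l : ℕ, i + j + l = k → ∀ a b c : ℝ,
      L2w n (tri (tau a ((dl h)^[i] U)) (tau b ((dl h)^[j] V)) (tau c ((dl h)^[l] W))) ≤ B),
    L2w n ((dl h)^[k] (tri U V W)) ≤ 10 ^ k * B := by
  induction k with
  | zero =>
    intro U V W hU hV hW hB
    have := hB 0 0 0 rfl 0 0 0
    simpa [tau_zero] using this
  | succ k ih =>
    intro U V W hU hV hW hB
    rw [Function.iterate_succ_apply, dl_tri h hU hV hW, dlk_add, dlk_add]
    have h1 := ih (hU.dl1 h) (hV.tau1 h) (hW.tau1 h) (by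
      intro i j l hs a b c
      rw [dlk_tau, dlk_tau, tau_tau, tau_tau, ← Function.iterate_succ_apply]
      exact hB _ _ _ (by omega) _ _ _)
    have h2 := ih hU (hV.dl1 h) (hW.tau1 h) (by
      intro i j l hs a b c
      rw [dlk_tau, tau_tau, ← Function.iterate_succ_apply]
      exact hB _ _ _ (by omega) _ _ _)
    have h3 := ih hU hV (hW.dl1 h) (by
      intro i j l hs a b c
      rw [← Function.iterate_succ_apply]
      exact hB _ _ _ (by omega) _ _ _)
    have n1 := ((hU.dl1 h).tri1 (hV.tau1 h) (hW.tau1 h)).dlk h k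
    have n2 := (hU.tri1 (hV.dl1 h) (hW.tau1 h)).dlk h k
    refine (L2w_add n (n1.add n2).aesm).trans ?_
    calc _ ≤ 2 * (2 * (10 ^ k * B + 10 ^ k * B) + 10 ^ k * B) := by
          gcongr
          refine (L2w_add n n1.aesm).trans ?_
          gcongr
      _ = _ := by ring

lemma four_pow_sq (j : ℕ) : ((2 : ℝ≥0∞) ^ j) ^ 2 = 4 ^ j := by
  rw [← pow_mul, mul_comm, pow_mul]; norm_num

lemma four_mono {i j : ℕ} (h : i ≤ j) : (4 : ℝ≥0∞) ^ i ≤ 4 ^ j := pow_le_pow_right₀ (by norm_num) h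

lemma b_aw (h a : ℝ) (U : FunRT) {j M : ℕ} (hj : j ≤ 3 * M) :
    Aw (tau a ((dl h)^[j] U)) ^ 2 ≤ 4 ^ (3 * M) * Aw U ^ 2 := by
  rw [Aw_tau]
  calc _ ≤ (2 ^ j * Aw U) ^ 2 := by gcongr; exact Aw_dlk h U j
    _ = 4 ^ j * Aw U ^ 2 := by rw [mul_pow, four_pow_sq]
    _ ≤ _ := by gcongr; norm_num

lemma b_aw' (h a : ℝ) (U : FunRT) {j M : ℕ} (hj : j ≤ 3 * M) (hM : M ≤ j) :
    Aw (tau a ((dl h)^[j] U)) ^ 2 ≤ 4 ^ (3 * M) * Aw ((dl h)^[M] U) ^ 2 := by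
  have := b_aw h a ((dl h)^[M] U) (j := j - M) (M := M) (by omega)
  rwa [← Function.iterate_add_apply, Nat.sub_add_cancel hM] at this

lemma b_l2 (n : ℕ) (h a : ℝ) {U : FunRT} (hU : Nice U) {j M : ℕ} (hj : j ≤ 3 * M) :
    L2w n (tau a ((dl h)^[j] U)) ≤ 4 ^ (3 * M) * L2w n U := by
  rw [L2w_tau]
  refine (L2w_dlk n h hU j).trans ?_
  gcongr; norm_num

lemma b_l2' (n : ℕ) (h a : ℝ) {U : FunRT} (hU : Nice U) {j M : ℕ} (hj : j ≤ 3 * M) (hM : M ≤ j) :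
    L2w n (tau a ((dl h)^[j] U)) ≤ 4 ^ (3 * M) * L2w n ((dl h)^[M] U) := by
  have := b_l2 n h a (hU.dlk h M) (j := j - M) (M := M) (by omega)
  rwa [← Function.iterate_add_apply, Nat.sub_add_cancel hM] at this

lemma b_prod1 (n : ℕ) (h a b c : ℝ) {X : FunRT} (Y Z : FunRT) (hX : Nice X)
    {i j l M : ℕ} (hs : i ≤ 3 * M) (hj : j ≤ 3 * M) (hl : l ≤ 3 * M) (hM : M ≤ i) :
    L2w n (tau a ((dl h)^[i] X)) * Aw (tau b ((dl h)^[j] Y)) ^ 2 * Aw (tau c ((dl h)^[l] Z)) ^ 2 ≤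
      (4 ^ (3 * M)) ^ 3 * (L2w n ((dl h)^[M] X) * Aw Y ^ 2 * Aw Z ^ 2) := by
  calc _ ≤ (4 ^ (3 * M) * L2w n ((dl h)^[M] X)) * (4 ^ (3 * M) * Aw Y ^ 2) * (4 ^ (3 * M) * Aw Z ^ 2) :=
        mul_le_mul' (mul_le_mul' (b_l2' n h a hX hs hM) (b_aw h b Y hj)) (b_aw h c Z hl)
    _ = _ := by ring

lemma b_Bd (n : ℕ) (h a b c : ℝ) {X Y Z : FunRT} (hX : Nice X) (hY : Nice Y) (hZ : Nice Z)
    {i j l M : ℕ} (hs : i ≤ 3 * M) (hj : j ≤ 3 * M) (hl : l ≤ 3 * M) (hM : M ≤ i) :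
    Bd n (tau a ((dl h)^[i] X)) (tau b ((dl h)^[j] Y)) (tau c ((dl h)^[l] Z)) ≤
      (4 ^ (3 * M)) ^ 3 * Bd n ((dl h)^[M] X) Y Z := by
  unfold Bd
  rw [mul_add ((4 ^ (3 * M)) ^ 3)]
  refine add_le_add (b_prod1 n h a b c Y Z hX hs hj hl hM) ?_
  calc _ ≤ (4 ^ (3 * M) * Aw ((dl h)^[M] X) ^ 2) * ((4 ^ (3 * M) * L2w n Y) * (4 ^ (3 * M) * Aw Z ^ 2) +
          (4 ^ (3 * M) * Aw Y ^ 2) * (4 ^ (3 * M) * L2w n Z)) :=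
        mul_le_mul' (b_aw' h a X hs hM) (add_le_add (mul_le_mul' (b_l2 n h b hY hj) (b_aw h c Z hl))
          (mul_le_mul' (b_aw h b Y hj) (b_l2 n h c hZ hl)))
    _ = _ := by ring

def CL (M : ℕ) : ℝ≥0∞ := 10 ^ (3 * M) * (4 ^ (3 * M)) ^ 3

lemma CL_ne (M : ℕ) : CL M ≠ ∞ := by unfold CL; finiteness

lemma diff_L2 (h : ℝ) (M : ℕ) {U V W : FunRT} (hU : Nice U) (hV : Nice V) (hW : Nice W) :
    L2sq ((dl h)^[3 * M] (tri U V W)) ≤ CL M * (L2sq ((dl h)^[M] U) * Aw V ^ 2 * Aw W ^ 2 +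
      L2sq ((dl h)^[M] V) * Aw U ^ 2 * Aw W ^ 2 + L2sq ((dl h)^[M] W) * Aw U ^ 2 * Aw V ^ 2) := by
  rw [CL, mul_assoc]
  simp only [← L2w_zero]
  apply leib 0 h (3 * M) _ hU hV hW
  intro i j l hs a b c
  have nU := (hU.dlk h i).tau1 a
  have nV := (hV.dlk h j).tau1 b
  have nW := (hW.dlk h l).tau1 c
  rw [mul_add, mul_add]
  have : M ≤ i ∨ M ≤ j ∨ M ≤ l := by omega
  rcases this with hM | hM | hM
  · refine le_trans ?_ (le_self_add.trans le_self_add)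
    rw [L2w_zero]
    refine (tri_L2_1 nU nV).trans ?_
    rw [← L2w_zero]
    exact b_prod1 0 h a b c V W hU (by omega) (by omega) (by omega) hM
  · refine le_trans ?_ (le_add_self.trans le_self_add)
    rw [L2w_zero]
    refine (tri_L2_2 nU nV).trans ?_
    rw [← L2w_zero]
    exact b_prod1 0 h b a c U W hV (by omega) (by omega) (by omega) hM
  · refine le_trans ?_ le_add_self
    rw [L2w_zero]
    refine (tri_L2_3 nW).trans ?_
    rw [← L2w_zero]
    exact b_prod1 0 h c a b U V hW (by omega) (by omega) (by omega) hM

lemma diff_L2w (n : ℕ) (h : ℝ) (M : ℕ) {U V W : FunRT} (hU : Nice U) (hV : Nice V) (hW : Nice W) :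
    L2w n ((dl h)^[3 * M] (tri U V W)) ≤ CL M * (2 * 4 ^ n) ^ 2 * (Bd n ((dl h)^[M] U) V W +
      Bd n ((dl h)^[M] V) U W + Bd n ((dl h)^[M] W) U V) := by
  rw [CL, mul_assoc, mul_assoc]
  apply leib n h (3 * M) _ hU hV hW
  intro i j l hs a b c
  have nU := (hU.dlk h i).tau1 a
  have nV := (hV.dlk h j).tau1 b
  have nW := (hW.dlk h l).tau1 c
  refine (tri_L2w n nU nV nW).trans ?_
  rw [mul_left_comm]
  refine mul_le_mul_right ?_ _
  rw [mul_add, mul_add]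
  have : M ≤ i ∨ M ≤ j ∨ M ≤ l := by omega
  rcases this with hM | hM | hM
  · refine le_trans ?_ (le_self_add.trans le_self_add)
    exact b_Bd n h a b c hU hV hW (by omega) (by omega) (by omega) hM
  · refine le_trans ?_ (le_add_self.trans le_self_add)
    rw [Bd_perm1]
    exact b_Bd n h b a c hV hU hW (by omega) (by omega) (by omega) hM
  · refine le_trans ?_ le_add_self
    rw [Bd_perm2]
    exact b_Bd n h c a b hW hU hV (by omega) (by omega) (by omega) hM

end NtProof

namespace NtProof
open scoped FourierTransform Topology

/-! ### Square functions of finite differences -/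

def Eh (h ξ : ℝ) : ℂ := Complex.exp (Complex.I * h * ξ) - 1

def kap (m : ℕ) (h : ℝ) : ℝ≥0∞ := ENNReal.ofReal ((|h| ^ (2 * m + 1))⁻¹)

def cm (m M : ℕ) : ℝ≥0∞ := ∫⁻ h : ℝ, kap m h * ‖Eh h 1‖ₑ ^ (2 * M)

lemma Eh_eq (h ξ : ℝ) : Eh h ξ = Eh (ξ * h) 1 := by
  unfold Eh; push_cast; congr 2; ring

lemma Eh_meas2 : Measurable (fun z : ℝ × ℝ => ‖Eh z.1 z.2‖ₑ) := by
  unfold Eh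
  have : Continuous fun z : ℝ × ℝ => Complex.exp (Complex.I * z.1 * z.2) - 1 := by fun_prop
  exact this.measurable.enorm

lemma Eh_meas (h : ℝ) : Measurable (fun ξ : ℝ => ‖Eh h ξ‖ₑ) := by
  unfold Eh
  have : Continuous fun ξ : ℝ => Complex.exp (Complex.I * h * ξ) - 1 := by fun_prop
  exact this.measurable.enorm

lemma Eh_meas' (ξ : ℝ) : Measurable (fun h : ℝ => ‖Eh h ξ‖ₑ) := by
  unfold Eh
  have : Continuous fun h : ℝ => Complex.exp (Complex.I * h * ξ) - 1 := by fun_prop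
  exact this.measurable.enorm

lemma kap_meas (m : ℕ) : Measurable (kap m) := by
  unfold kap
  exact ((continuous_abs.measurable.pow_const _).inv).ennreal_ofReal

lemma kap_scale (m : ℕ) {ξ : ℝ} (hξ : ξ ≠ 0) (h : ℝ) :
    kap m h = ENNReal.ofReal (|ξ| ^ (2 * m + 1)) * kap m (ξ * h) := by
  unfold kap
  rw [← ENNReal.ofReal_mul (by positivity)]
  congr 1
  have : |ξ| ≠ 0 := abs_ne_zero.2 hξ
  rw [abs_mul, mul_pow, mul_inv, mul_inv_cancel_left₀ (pow_ne_zero _ this)]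

lemma kap_int (m M : ℕ) (hM : 1 ≤ M) (hm : 1 ≤ m) (ξ : ℝ) :
    ∫⁻ h : ℝ, kap m h * ‖Eh h ξ‖ₑ ^ (2 * M) = cm m M * ENNReal.ofReal (ξ ^ (2 * m)) := by
  rcases eq_or_ne ξ 0 with rfl | hξ
  · simp [Eh, show M ≠ 0 by omega, show m ≠ 0 by omega]
  · have e : ∀ h : ℝ, kap m h * ‖Eh h ξ‖ₑ ^ (2 * M) = ENNReal.ofReal (|ξ| ^ (2 * m + 1)) *
        (fun y => kap m y * ‖Eh y 1‖ₑ ^ (2 * M)) (ξ * h) := by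
      intro h
      rw [kap_scale m hξ h, Eh_eq h ξ]; ring
    simp_rw [e]
    rw [lintegral_const_mul' _ _ ENNReal.ofReal_ne_top,
      lintegral_comp_mul (fun y => kap m y * ‖Eh y 1‖ₑ ^ (2 * M)) hξ, ← mul_assoc, mul_comm, ← cm]
    congr 1
    rw [← ENNReal.ofReal_mul (by positivity)]
    congr 1
    have : |ξ| ≠ 0 := abs_ne_zero.2 hξ
    rw [abs_inv, pow_succ, mul_assoc, mul_inv_cancel₀ this, mul_one, pow_mul, sq_abs, pow_mul]

lemma Eh_le_two (h ξ : ℝ) : ‖Eh h ξ‖ ≤ 2 := by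
  unfold Eh
  refine (norm_sub_le _ _).trans ?_
  rw [norm_one, show Complex.I * h * ξ = ((h * ξ : ℝ) : ℂ) * Complex.I by push_cast; ring,
    Complex.norm_exp_ofReal_mul_I]; norm_num

lemma Eh_le_abs (h ξ : ℝ) : ‖Eh h ξ‖ ≤ |h * ξ| := by
  unfold Eh
  have := Real.norm_exp_I_mul_ofReal_sub_one_le (x := h * ξ)
  rw [Real.norm_eq_abs] at this
  rw [show Complex.I * h * ξ = Complex.I * ((h * ξ : ℝ) : ℂ) by push_cast; ring]
  exact this

lemma cm_ne_top (m M : ℕ) (hm : 1 ≤ m) (hM : m + 1 ≤ M) : cm m M ≠ ∞ := by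
  have hI : Integrable fun h : ℝ => 4 ^ M * 2 * (1 + h ^ 2)⁻¹ := integrable_inv_one_add_sq.const_mul _
  refine ne_top_of_le_ne_top hI.lintegral_lt_top.ne ?_
  refine lintegral_mono fun h => ?_
  simp only [kap]
  rw [← ofReal_norm, ← ENNReal.ofReal_pow (norm_nonneg _), ← ENNReal.ofReal_mul (by positivity)]
  refine ENNReal.ofReal_le_ofReal ?_
  have e1 : 0 ≤ ‖Eh h 1‖ := norm_nonneg _
  rcases le_total |h| 1 with h1 | h1
  · have a1 : ‖Eh h 1‖ ≤ |h| := by simpa using Eh_le_abs h 1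
    have a2 : ‖Eh h 1‖ ^ (2 * M) ≤ |h| ^ (2 * m + 1) :=
      (pow_le_pow_left₀ e1 a1 _).trans (pow_le_pow_of_le_one (abs_nonneg _) h1 (by omega))
    have a3 : (|h| ^ (2 * m + 1))⁻¹ * ‖Eh h 1‖ ^ (2 * M) ≤ 1 := by
      rw [inv_mul_eq_div]; exact div_le_one_of_le₀ a2 (by positivity)
    have a4 : (1 : ℝ) ≤ 4 ^ M := one_le_pow₀ (by norm_num)
    have a5 : h ^ 2 ≤ 1 := by rw [← sq_abs]; nlinarith [abs_nonneg h]
    refine a3.trans ?_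
    rw [← div_eq_mul_inv, le_div_iff₀ (by positivity)]; nlinarith
  · have a2 : ‖Eh h 1‖ ^ (2 * M) ≤ 4 ^ M := by
      rw [pow_mul]; exact pow_le_pow_left₀ (by positivity) (by nlinarith [Eh_le_two h 1]) _
    have a3 : (|h| ^ (2 * m + 1))⁻¹ ≤ 2 * (1 + h ^ 2)⁻¹ := by
      have b1 : |h| ^ 2 ≤ |h| ^ (2 * m + 1) := pow_le_pow_right₀ h1 (by omega)
      rw [sq_abs] at b1
      rw [← div_eq_mul_inv, le_div_iff₀ (by positivity), inv_mul_le_iff₀ (by positivity)]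
      have : 1 ≤ h ^ 2 := by rw [← sq_abs]; nlinarith
      nlinarith
    calc _ ≤ (2 * (1 + h ^ 2)⁻¹) * 4 ^ M := mul_le_mul a3 a2 (by positivity) (by positivity)
      _ = _ := by ring

lemma cm_ne_zero (m M : ℕ) : cm m M ≠ 0 := by
  have hmeas : Measurable fun h : ℝ => kap m h * ‖Eh h 1‖ₑ ^ (2 * M) :=
    (kap_meas m).mul ((Eh_meas' 1).pow_const _)
  rw [cm, ← pos_iff_ne_zero, lintegral_pos_iff_support hmeas]
  refine lt_of_lt_of_le (b := volume (Set.Ioo (0 : ℝ) 1)) (by simp) (measure_mono ?_)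
  rintro h ⟨h0, h1⟩
  rw [Function.mem_support]
  have : Eh h 1 ≠ 0 := by
    intro hz
    have h2 := congrArg Complex.im hz
    rw [Eh, show Complex.I * h * (1 : ℝ) = (h : ℂ) * Complex.I by push_cast; ring] at h2
    simp only [Complex.sub_im, Complex.exp_ofReal_mul_I_im, Complex.one_im, sub_zero,
      Complex.zero_im] at h2
    exact absurd h2 (Real.sin_pos_of_pos_of_lt_pi h0 (h1.trans (by linarith [Real.pi_gt_three]))).ne'
  refine mul_ne_zero ?_ (pow_ne_zero _ (by simpa using this))
  rw [kap, Ne, ENNReal.ofReal_eq_zero, not_le]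
  have : |h| ≠ 0 := abs_ne_zero.2 h0.ne'
  positivity

/-- Weighted `L²` norms on the Fourier side. -/
def Wt (w : ℤ → ℝ → ℝ≥0∞) (F : FunRT) : ℝ≥0∞ :=
  ∑' p : ℤ, ∫⁻ ξ : ℝ, w p ξ * ‖ftx (F p) ξ‖ₑ ^ 2

lemma Wt_mono {w w' : ℤ → ℝ → ℝ≥0∞} (h : ∀ p ξ, w p ξ ≤ w' p ξ) (F : FunRT) : Wt w F ≤ Wt w' F :=
  ENNReal.tsum_le_tsum fun p => lintegral_mono fun ξ => mul_le_mul' (h p ξ) le_rfl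

lemma Wt_int (m M : ℕ) (hM : 1 ≤ M) (hm : 1 ≤ m) {w : ℤ → ℝ → ℝ≥0∞} (hw : ∀ p, Measurable (w p))
    (F : FunRT) :
    ∫⁻ h : ℝ, kap m h * Wt (fun p ξ => w p ξ * ‖Eh h ξ‖ₑ ^ (2 * M)) F =
      cm m M * Wt (fun p ξ => w p ξ * ENNReal.ofReal (ξ ^ (2 * m))) F := by
  have hj : ∀ p, Measurable fun z : ℝ × ℝ =>
      kap m z.1 * (w p z.2 * ‖Eh z.1 z.2‖ₑ ^ (2 * M) * ‖ftx (F p) z.2‖ₑ ^ 2) := fun p =>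
    ((kap_meas m).comp measurable_fst).mul ((((hw p).comp measurable_snd).mul
      (Eh_meas2.pow_const _)).mul ((meas_ftx (F p)).comp measurable_snd))
  have hk : ∀ h p, Measurable fun ξ : ℝ => w p ξ * ‖Eh h ξ‖ₑ ^ (2 * M) * ‖ftx (F p) ξ‖ₑ ^ 2 := fun h p =>
    ((hw p).mul ((Eh_meas h).pow_const _)).mul (meas_ftx (F p))
  unfold Wt
  simp_rw [← ENNReal.tsum_mul_left]
  have e1 : ∀ h p, kap m h * ∫⁻ ξ, w p ξ * ‖Eh h ξ‖ₑ ^ (2 * M) * ‖ftx (F p) ξ‖ₑ ^ 2 =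
      ∫⁻ ξ, kap m h * (w p ξ * ‖Eh h ξ‖ₑ ^ (2 * M) * ‖ftx (F p) ξ‖ₑ ^ 2) := fun h p =>
    (lintegral_const_mul _ (hk h p)).symm
  simp_rw [e1]
  rw [lintegral_tsum fun p => (Measurable.lintegral_prod_right' (hj p)).aemeasurable]
  congr 1; ext p
  rw [lintegral_lintegral_swap (hj p).aemeasurable, ← lintegral_const_mul]
  · apply lintegral_congr; intro ξ
    have e2 : ∀ h, kap m h * (w p ξ * ‖Eh h ξ‖ₑ ^ (2 * M) * ‖ftx (F p) ξ‖ₑ ^ 2) =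
        kap m h * ‖Eh h ξ‖ₑ ^ (2 * M) * (w p ξ * ‖ftx (F p) ξ‖ₑ ^ 2) := fun h => by ring
    simp_rw [e2]
    have hmm : Measurable fun h => kap m h * ‖Eh h ξ‖ₑ ^ (2 * M) :=
      (kap_meas m).mul ((Eh_meas' ξ).pow_const _)
    rw [lintegral_mul_const _ hmm, kap_int m M hM hm]
    ring
  · exact ((hw p).mul (by fun_prop)).mul (meas_ftx (F p))

lemma ftx_shift (f : ℝ → ℂ) (h ξ : ℝ) :
    ftx (fun x => f (x + h)) ξ = Complex.exp (Complex.I * h * ξ) * ftx f ξ := by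
  unfold ftx
  rw [← integral_const_mul, ← integral_add_right_eq_self
    (fun x : ℝ => Complex.exp (Complex.I * h * ξ) * (Complex.exp (-(Complex.I * x * ξ)) * f x)) h]
  congr 1; ext x
  rw [← mul_assoc, ← Complex.exp_add]; congr 2; push_cast; ring

lemma ftx_sub {f g : ℝ → ℂ} (hf : Integrable f) (hg : Integrable g) (ξ : ℝ) :
    ftx (fun x => f x - g x) ξ = ftx f ξ - ftx g ξ := by
  unfold ftx
  rw [← integral_sub]
  · congr 1; ext x; ring
  · exact hf.bdd_mul (c := 1) (by fun_prop) (Eventually.of_forall fun x => (norm_ph3' x ξ).le)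
  · exact hg.bdd_mul (c := 1) (by fun_prop) (Eventually.of_forall fun x => (norm_ph3' x ξ).le)

lemma dl_apply (h : ℝ) (F : FunRT) (p : ℤ) : dl h F p = fun x => F p (x + h) - F p x := rfl

lemma dl_int (h : ℝ) {F : FunRT} (hF : ∀ p, Integrable (F p)) (p : ℤ) : Integrable (dl h F p) :=
  ((hF p).comp_add_right h).sub (hF p)

lemma dlk_int (h : ℝ) (k : ℕ) {F : FunRT} (hF : ∀ p, Integrable (F p)) (p : ℤ) :
    Integrable ((dl h)^[k] F p) := by
  induction k generalizing F with
  | zero => exact hF p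
  | succ k ih => exact ih (dl_int h hF)

lemma ftx_dl (h : ℝ) {F : FunRT} (hF : ∀ p, Integrable (F p)) (p : ℤ) (ξ : ℝ) :
    ftx (dl h F p) ξ = Eh h ξ * ftx (F p) ξ := by
  rw [dl_apply, ftx_sub ((hF p).comp_add_right h) (hF p), ftx_shift, Eh]; ring

lemma ftx_dlk (h : ℝ) (k : ℕ) {F : FunRT} (hF : ∀ p, Integrable (F p)) (p : ℤ) (ξ : ℝ) :
    ftx ((dl h)^[k] F p) ξ = Eh h ξ ^ k * ftx (F p) ξ := by
  induction k generalizing F with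
  | zero => simp
  | succ k ih => rw [Function.iterate_succ_apply, ih (dl_int h hF), ftx_dl h hF]; ring

lemma Wt_dlk (h : ℝ) (k : ℕ) {F : FunRT} (hF : ∀ p, Integrable (F p)) (w : ℤ → ℝ → ℝ≥0∞) :
    Wt w ((dl h)^[k] F) = Wt (fun p ξ => w p ξ * ‖Eh h ξ‖ₑ ^ (2 * k)) F := by
  unfold Wt
  congr 1; ext p; apply lintegral_congr; intro ξ
  rw [ftx_dlk h k hF, enorm_mul, enorm_pow, mul_pow, ← pow_mul, mul_comm k 2]; ring

def wp (n : ℕ) (p : ℤ) : ℝ≥0∞ := ENNReal.ofReal ((1 + (p : ℝ) ^ 2) ^ n)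

lemma Wt_wp_le (n : ℕ) (F : FunRT) :
    Wt (fun p _ => wp n p) F ≤ ENNReal.ofReal (2 * Real.pi) * L2w n F := by
  unfold Wt L2w
  rw [← ENNReal.tsum_mul_left]
  refine ENNReal.tsum_le_tsum fun p => ?_
  rw [lintegral_const_mul _ (meas_ftx _), mul_left_comm]
  exact mul_le_mul_right (ftx_L2_le _) _

lemma L2w_expA_Wt (n : ℕ) (t : ℝ) (F : FunRT) :
    L2w n (expA t F) ≤ Wt (fun p _ => wp n p) F := by
  unfold Wt L2w
  refine ENNReal.tsum_le_tsum fun p => ?_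
  rw [lintegral_const_mul _ (meas_ftx _)]
  simp only [enorm_expA]
  refine mul_le_mul_right ((schro_L2_le' t _).trans ?_) _
  refine mul_le_of_le_one_left zero_le ?_
  rw [ENNReal.ofReal_le_one]
  exact inv_le_one_of_one_le₀ (by linarith [Real.pi_gt_three])

/-- Both the function and its Fourier transform are integrable. -/
structure GI (F : FunRT) : Prop where
  int : ∀ p, Integrable (F p)
  fint : ∀ p, Integrable (ftx (F p))

lemma Gd.gi {F : FunRT} (h : Gd F) : GI F := ⟨h.int, h.ftx_int⟩

lemma GI.tau1 {F : FunRT} (hF : GI F) (h : ℝ) : GI (tau h F) := by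
  refine ⟨fun p => (hF.int p).comp_add_right h, fun p => ?_⟩
  have : ftx (tau h F p) = fun ξ : ℝ => Complex.exp (Complex.I * h * ξ) * ftx (F p) ξ := by
    ext ξ; exact ftx_shift _ _ _
  rw [this]
  refine (hF.fint p).bdd_mul (c := 1) (by fun_prop) (Eventually.of_forall fun ξ => ?_)
  exact (norm_ph3 h ξ).le

lemma GI.sub {F G : FunRT} (hF : GI F) (hG : GI G) : GI (F - G) := by
  refine ⟨fun p => (hF.int p).sub (hG.int p), fun p => ?_⟩
  have : ftx ((F - G) p) = fun ξ => ftx (F p) ξ - ftx (G p) ξ := by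
    ext ξ; exact ftx_sub (hF.int p) (hG.int p) ξ
  rw [this]
  exact (hF.fint p).sub (hG.fint p)

lemma GI.dl1 {F : FunRT} (hF : GI F) (h : ℝ) : GI (dl h F) := by
  rw [dl_eq]; exact (hF.tau1 h).sub hF

lemma phsq_int (t : ℝ) {g : ℝ → ℂ} (hg : Integrable g) :
    Integrable fun ξ : ℝ => Complex.exp (-(Complex.I * t * ξ ^ 2)) * g ξ :=
  hg.bdd_mul (c := 1) (by fun_prop) (Eventually.of_forall fun ξ => (norm_phsq t ξ).le)

lemma ph_int' (x : ℝ) {g : ℝ → ℂ} (hg : Integrable g) :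
    Integrable fun ξ : ℝ => Complex.exp (Complex.I * x * ξ) * g ξ :=
  hg.bdd_mul (c := 1) (by fun_prop) (Eventually.of_forall fun ξ => (norm_ph3 x ξ).le)

lemma iftx_sub {f g : ℝ → ℂ} (hf : Integrable f) (hg : Integrable g) (x : ℝ) :
    iftx (fun x => f x - g x) x = iftx f x - iftx g x := by
  unfold iftx
  rw [← mul_sub, ← integral_sub (ph_int' x hf) (ph_int' x hg)]
  congr 2; ext ξ; ring

lemma schro_sub (t : ℝ) {f g : ℝ → ℂ} (hf : Integrable f) (hg : Integrable g)
    (hf' : Integrable (ftx f)) (hg' : Integrable (ftx g)) (x : ℝ) :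
    schro t (fun x => f x - g x) x = schro t f x - schro t g x := by
  unfold schro
  rw [← iftx_sub (phsq_int t hf') (phsq_int t hg')]
  congr 1; ext ξ; rw [ftx_sub hf hg]; ring

lemma expA_sub (t : ℝ) {F G : FunRT} (hF : GI F) (hG : GI G) :
    expA t (F - G) = expA t F - expA t G := by
  ext p x
  simp only [expA, Pi.sub_apply]
  have := schro_sub t (hF.int p) (hG.int p) (hF.fint p) (hG.fint p) x
  rw [← mul_sub, ← this]; rfl

lemma schro_shift (t h : ℝ) (f : ℝ → ℂ) (x : ℝ) :
    schro t (fun x => f (x + h)) x = schro t f (x + h) := by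
  unfold schro iftx
  congr 2; ext ξ
  simp only []
  rw [ftx_shift, ← mul_assoc, ← mul_assoc, ← mul_assoc, ← Complex.exp_add, ← Complex.exp_add,
    ← Complex.exp_add]
  congr 2; push_cast; ring

lemma expA_tau (t h : ℝ) (F : FunRT) : expA t (tau h F) = tau h (expA t F) := by
  ext p x
  simp only [expA, tau]
  rw [← schro_shift]; rfl

lemma expA_dl (t h : ℝ) {F : FunRT} (hF : GI F) : expA t (dl h F) = dl h (expA t F) := by
  rw [dl_eq, expA_sub t (hF.tau1 h) hF, expA_tau, dl_eq]

lemma expA_dlk (t h : ℝ) (k : ℕ) {F : FunRT} (hF : GI F) :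
    expA t ((dl h)^[k] F) = (dl h)^[k] (expA t F) := by
  induction k generalizing F with
  | zero => rfl
  | succ k ih => rw [Function.iterate_succ_apply, ih (hF.dl1 h), expA_dl t h hF]; rfl

/-- Upper bound for differences of a linear evolution. -/
lemma L2w_dlk_expA (n : ℕ) (t h : ℝ) (k : ℕ) {F : FunRT} (hF : GI F) :
    L2w n ((dl h)^[k] (expA t F)) ≤ Wt (fun p ξ => wp n p * ‖Eh h ξ‖ₑ ^ (2 * k)) F := by
  rw [← expA_dlk t h k hF, ← Wt_dlk h k hF.int]
  exact L2w_expA_Wt n t _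

/-- Lower bound for square functions. -/
lemma Wt_le_sq (n m k : ℕ) (hk : 1 ≤ k) (hm : 1 ≤ m) {Q : FunRT} (hQ : ∀ p, Integrable (Q p)) :
    cm m k * Wt (fun p ξ => wp n p * ENNReal.ofReal (ξ ^ (2 * m))) Q ≤
      ENNReal.ofReal (2 * Real.pi) * ∫⁻ h, kap m h * L2w n ((dl h)^[k] Q) := by
  rw [← Wt_int m k hk hm (w := fun p _ => wp n p) (fun p => measurable_const),
    ← lintegral_const_mul' _ _ ENNReal.ofReal_ne_top]
  refine lintegral_mono fun h => ?_
  rw [mul_left_comm, ← Wt_dlk h k hQ]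
  exact mul_le_mul_right (Wt_wp_le n _) _

end NtProof

namespace NtProof
open scoped FourierTransform Topology

/-! ### Sobolev bounds for the trilinear product -/

def Lo (F : FunRT) : ℝ≥0∞ := Hq 2 F + L2sq (xMul F)

def A2 (t : ℝ) (F : FunRT) : ℝ≥0∞ := Aw (expA t F) ^ 2

def del (t : ℝ) : ℝ≥0∞ := ENNReal.ofReal (CA * (1 + |t|)⁻¹)

def Qn (t : ℝ) (F G H : FunRT) : FunRT := tri (expA t F) (conjF (expA t G)) (expA t H)

def Wm (n m : ℕ) (F : FunRT) : ℝ≥0∞ := Wt (fun p ξ => wp n p * ENNReal.ofReal (ξ ^ (2 * m))) F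

lemma del_ne (t : ℝ) : del t ≠ ∞ := ENNReal.ofReal_ne_top

lemma A2_le (t : ℝ) {F : FunRT} (h : Gd F) : A2 t F ≤ del t * Lo F := Abound t h

lemma Gd.l2 {F : FunRT} (h : Gd F) : L2sq F ≠ ∞ := by
  rw [← L2w_zero]
  exact ne_top_of_le_ne_top h.hq ((h.L2w_le 0).trans (Hq_mono F (by norm_num)))

lemma Gd.lo {F : FunRT} (h : Gd F) : Lo F ≠ ∞ := ENNReal.add_ne_top.2 ⟨h.hq, h.hx⟩

lemma Gd.nice (t : ℝ) {F : FunRT} (h : Gd F) : Nice (expA t F) := by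
  refine ⟨expA_cont t F, ?_, ne_top_of_le_ne_top h.l2 (L2sq_expA_le t F)⟩
  intro h1
  have h2 := A2_le t h
  rw [A2, h1] at h2
  have h3 : del t * Lo F ≠ ∞ := ENNReal.mul_ne_top (del_ne t) h.lo
  exact h3 (top_le_iff.1 (by simpa using h2))

lemma Qn_int (t : ℝ) {F G H : FunRT} (hF : Gd F) (hG : Gd G) (hH : Gd H) (p : ℤ) :
    Integrable (Qn t F G H p) := tri_int (hF.nice t) (hG.nice t).conj (hH.nice t) p

lemma Wt_meas (M : ℕ) {w : ℤ → ℝ → ℝ≥0∞} (hw : ∀ p, Measurable (w p)) (F : FunRT) :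
    Measurable fun h : ℝ => Wt (fun p ξ => w p ξ * ‖Eh h ξ‖ₑ ^ (2 * M)) F := by
  unfold Wt
  refine Measurable.tsum fun p => ?_
  have hj : Measurable fun z : ℝ × ℝ => w p z.2 * ‖Eh z.1 z.2‖ₑ ^ (2 * M) * ‖ftx (F p) z.2‖ₑ ^ 2 :=
    (((hw p).comp measurable_snd).mul (Eh_meas2.pow_const _)).mul ((meas_ftx (F p)).comp measurable_snd)
  exact Measurable.lintegral_prod_right' hj

lemma sq_close (n m k : ℕ) (hk : 1 ≤ k) (hm : m + 1 ≤ k) (hm1 : 1 ≤ m) {Q : FunRT}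
    (hQ : ∀ p, Integrable (Q p)) {K : ℝ≥0∞} (hK : K ≠ ∞) {R : ℝ → ℝ≥0∞} {B : ℝ≥0∞}
    (h1 : ∀ h, L2w n ((dl h)^[k] Q) ≤ K * R h) (h2 : ∫⁻ h, kap m h * R h ≤ B) :
    Wm n m Q ≤ (cm m k)⁻¹ * (ENNReal.ofReal (2 * Real.pi) * K) * B := by
  have h := Wt_le_sq n m k hk hm1 hQ
  have h3 : ∫⁻ h, kap m h * L2w n ((dl h)^[k] Q) ≤ K * B := by
    calc _ ≤ ∫⁻ h, K * (kap m h * R h) := lintegral_mono fun h => by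
            rw [mul_left_comm]; exact mul_le_mul_right (h1 h) _
      _ = K * ∫⁻ h, kap m h * R h := lintegral_const_mul' _ _ hK
      _ ≤ _ := mul_le_mul_right h2 _
  have h4 : cm m k * Wm n m Q ≤ ENNReal.ofReal (2 * Real.pi) * (K * B) :=
    h.trans (mul_le_mul_right h3 _)
  have h0 := cm_ne_zero m k
  have ht := cm_ne_top m k hm1 hm
  calc Wm n m Q = (cm m k)⁻¹ * (cm m k * Wm n m Q) := by
        rw [← mul_assoc, ENNReal.inv_mul_cancel h0 ht, one_mul]
    _ ≤ (cm m k)⁻¹ * (ENNReal.ofReal (2 * Real.pi) * (K * B)) := mul_le_mul_right h4 _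
    _ = _ := by ring

lemma kK_int (n m M : ℕ) (hM : 1 ≤ M) (hm : 1 ≤ m) (F : FunRT) :
    ∫⁻ h, kap m h * Wt (fun p ξ => wp n p * ‖Eh h ξ‖ₑ ^ (2 * M)) F = cm m M * Wm n m F :=
  Wt_int m M hM hm (fun _ => measurable_const) F

lemma kmul3 (m : ℕ) {f g k : ℝ → ℝ≥0∞} (hf : Measurable f) (hg : Measurable g) (hk : Measurable k)
    (a b c : ℝ≥0∞) :
    ∫⁻ h, kap m h * (f h * a + g h * b + k h * c) =
      (∫⁻ h, kap m h * f h) * a + (∫⁻ h, kap m h * g h) * b + (∫⁻ h, kap m h * k h) * c := by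
  have e : ∀ h, kap m h * (f h * a + g h * b + k h * c) =
    (kap m h * f h * a + kap m h * g h * b) + kap m h * k h * c := fun h => by ring
  have m1 : Measurable fun h => kap m h * f h := (kap_meas m).mul hf
  have m2 : Measurable fun h => kap m h * g h := (kap_meas m).mul hg
  have m3 : Measurable fun h => kap m h * k h := (kap_meas m).mul hk
  simp_rw [e]
  rw [lintegral_add_right _ (m3.mul_const c), lintegral_add_right _ (m2.mul_const b),
    lintegral_mul_const _ m1, lintegral_mul_const _ m2, lintegral_mul_const _ m3]

lemma kmul2 (m : ℕ) {f g : ℝ → ℝ≥0∞} (hf : Measurable f) (hg : Measurable g)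
    (a b : ℝ≥0∞) :
    ∫⁻ h, kap m h * (f h * a + g h * b) =
      (∫⁻ h, kap m h * f h) * a + (∫⁻ h, kap m h * g h) * b := by
  have := kmul3 m hf hg measurable_zero a b 0
  simpa using this

lemma L2w_dlk_conj (n : ℕ) (t h : ℝ) (k : ℕ) {F : FunRT} (hF : GI F) :
    L2w n ((dl h)^[k] (conjF (expA t F))) ≤ Wt (fun p ξ => wp n p * ‖Eh h ξ‖ₑ ^ (2 * k)) F := by
  rw [dlk_conj, L2w_conj]; exact L2w_dlk_expA n t h k hF

lemma WA (m : ℕ) (hm : 1 ≤ m) : ∃ C : ℝ≥0∞, C ≠ ∞ ∧ ∀ (t : ℝ) (F G H : FunRT), Gd F → Gd G → Gd H →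
    Wm 0 m (Qn t F G H) ≤ C * (Wm 0 m F * (A2 t G * A2 t H) + Wm 0 m G * (A2 t F * A2 t H) +
      Wm 0 m H * (A2 t F * A2 t G)) := by
  refine ⟨(cm m (3 * (m + 1)))⁻¹ * (ENNReal.ofReal (2 * Real.pi) * CL (m + 1)) * cm m (m + 1), ?_, ?_⟩
  · have := ENNReal.inv_ne_top.2 (cm_ne_zero m (3 * (m + 1)))
    have := CL_ne (m + 1)
    have := cm_ne_top m (m + 1) hm le_rfl
    finiteness
  intro t F G H hF hG hH
  rw [mul_assoc _ (cm m (m + 1))]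
  set R : ℝ → ℝ≥0∞ := fun h => Wt (fun p ξ => wp 0 p * ‖Eh h ξ‖ₑ ^ (2 * (m + 1))) F * (A2 t G * A2 t H) +
    Wt (fun p ξ => wp 0 p * ‖Eh h ξ‖ₑ ^ (2 * (m + 1))) G * (A2 t F * A2 t H) +
    Wt (fun p ξ => wp 0 p * ‖Eh h ξ‖ₑ ^ (2 * (m + 1))) H * (A2 t F * A2 t G) with hR
  refine sq_close 0 m (3 * (m + 1)) (by omega) (by omega) hm (Qn_int t hF hG hH) (CL_ne (m + 1)) (R := R) ?_ ?_
  · intro h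
    rw [L2w_zero]
    refine (diff_L2 h (m + 1) (hF.nice t) (hG.nice t).conj (hH.nice t)).trans ?_
    refine mul_le_mul_right ?_ _
    simp only [Aw_conj, ← L2w_zero, mul_assoc, A2, hR]
    refine add_le_add (add_le_add (mul_le_mul' ?_ le_rfl) (mul_le_mul' ?_ le_rfl)) (mul_le_mul' ?_ le_rfl)
    · exact L2w_dlk_expA 0 t h _ hF.gi
    · exact L2w_dlk_conj 0 t h _ hG.gi
    · exact L2w_dlk_expA 0 t h _ hH.gi
  · rw [hR, kmul3 m (Wt_meas _ (fun _ => measurable_const) _) (Wt_meas _ (fun _ => measurable_const) _)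
      (Wt_meas _ (fun _ => measurable_const) _), kK_int 0 m _ (by omega) hm, kK_int 0 m _ (by omega) hm,
      kK_int 0 m _ (by omega) hm]
    apply le_of_eq; ring

/-! #### Weights `x` and differences -/

lemma xMul_dl (h : ℝ) (F : FunRT) : xMul (dl h F) = dl h (xMul F) - (h : ℂ) • tau h F := by
  ext p x
  simp only [xMul, dl, tau, Pi.sub_apply, Pi.smul_apply, smul_eq_mul]
  push_cast; ring

lemma dl_sub_smul (h : ℝ) (U V : FunRT) (c : ℂ) : dl h (U - c • V) = dl h U - c • dl h V := by
  ext p x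
  simp only [dl, Pi.sub_apply, Pi.smul_apply, smul_eq_mul]; ring

lemma xMul_dlk (h : ℝ) (k : ℕ) (F : FunRT) :
    xMul ((dl h)^[k + 1] F) = (dl h)^[k + 1] (xMul F) - (((k + 1 : ℝ) * h : ℝ) : ℂ) • tau h ((dl h)^[k] F) := by
  induction k with
  | zero =>
    simp only [zero_add, Function.iterate_one, Function.iterate_zero, id, Nat.cast_zero, one_mul]
    exact xMul_dl h F
  | succ k ih =>
    rw [Function.iterate_succ_apply' (dl h) (k + 1) F, xMul_dl, ih, dl_sub_smul, dl_tau,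
      ← Function.iterate_succ_apply' (dl h), ← Function.iterate_succ_apply' (dl h) k F]
    rw [sub_sub, ← add_smul]
    congr 2
    push_cast; ring

lemma xMul_aesm {F : FunRT} (h : ∀ p, AEStronglyMeasurable (F p)) (p : ℤ) :
    AEStronglyMeasurable (xMul F p) := by
  unfold xMul
  exact AEStronglyMeasurable.mul (by fun_prop) (h p)

lemma L2w_dl' (n : ℕ) (h : ℝ) {U : FunRT} (hU : ∀ p, AEStronglyMeasurable (U p)) :
    L2w n (dl h U) ≤ 4 * L2w n U := by
  rw [dl_eq]
  refine (L2w_sub n ?_).trans ?_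
  · intro p
    exact (hU p).comp_measurePreserving (measurePreserving_add_right volume h)
  · rw [L2w_tau]; apply le_of_eq; ring

lemma Eh_enorm_le (h ξ : ℝ) : ‖Eh h ξ‖ₑ ^ 2 ≤ 4 := by
  rw [← ofReal_norm, ← ENNReal.ofReal_pow (norm_nonneg _), show (4 : ℝ≥0∞) = ENNReal.ofReal 4 by simp]
  exact ENNReal.ofReal_le_ofReal (by nlinarith [Eh_le_two h ξ, norm_nonneg (Eh h ξ)])

lemma Wt_const_mul (c : ℝ≥0∞) (hc : c ≠ ∞) (w : ℤ → ℝ → ℝ≥0∞) (F : FunRT) :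
    Wt (fun p ξ => c * w p ξ) F = c * Wt w F := by
  unfold Wt
  simp_rw [mul_assoc, lintegral_const_mul' _ _ hc, ENNReal.tsum_mul_left]

lemma Wt_add {w w' : ℤ → ℝ → ℝ≥0∞} (hw : ∀ p, Measurable (w p)) (F : FunRT) :
    Wt (fun p ξ => w p ξ + w' p ξ) F = Wt w F + Wt w' F := by
  unfold Wt
  rw [← ENNReal.tsum_add]
  congr 1; ext p
  simp_rw [add_mul]
  exact lintegral_add_left ((hw p).mul (meas_ftx _)) _

def wq (m : ℕ) (p : ℤ) (ξ : ℝ) : ℝ≥0∞ := ENNReal.ofReal ((1 + ξ ^ 2 + (p : ℝ) ^ 2) ^ m)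

lemma wq_meas (m : ℕ) (p : ℤ) : Measurable (wq m p) := by unfold wq; fun_prop

lemma Hq_eq (m : ℕ) (F : FunRT) : Hq m F = Wt (wq m) F := rfl

lemma Gd.dl1 {F : FunRT} (hF : Gd F) (h : ℝ) : Gd (dl h F) := by
  refine ⟨dl_int h hF.int, ?_, ?_⟩
  · have h1 := Wt_dlk h 1 hF.int (wq 2)
    rw [Function.iterate_one] at h1
    rw [Hq_eq, h1]
    refine ne_top_of_le_ne_top (b := 4 * Hq 2 F) (ENNReal.mul_ne_top (by simp) hF.hq) ?_
    rw [Hq_eq, ← Wt_const_mul 4 (by simp)]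
    refine Wt_mono (fun p ξ => ?_) F
    rw [mul_comm]
    exact mul_le_mul' (by simpa using Eh_enorm_le h ξ) le_rfl
  · rw [xMul_dl]
    have ha := xMul_aesm fun p => (hF.int p).aestronglyMeasurable
    refine ne_top_of_le_ne_top ?_ (L2sq_sub ?_)
    · have h1 : L2sq (dl h (xMul F)) ≠ ∞ := by
        have := L2w_dl' 0 h ha
        rw [L2w_zero, L2w_zero] at this
        exact ne_top_of_le_ne_top (ENNReal.mul_ne_top (by simp) hF.hx) this
      have h2 : L2sq ((h : ℂ) • tau h F) ≠ ∞ := by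
        rw [L2sq_smul, L2sq_tau]
        exact ENNReal.mul_ne_top (by finiteness) hF.l2
      finiteness
    · intro p
      exact ((ha p).comp_measurePreserving (measurePreserving_add_right volume h)).sub (ha p)

lemma Gd.dlk {F : FunRT} (hF : Gd F) (h : ℝ) (k : ℕ) : Gd ((dl h)^[k] F) := by
  induction k generalizing F with
  | zero => exact hF
  | succ k ih => exact ih (hF.dl1 h)

lemma GI.dlk {F : FunRT} (hF : GI F) (h : ℝ) (k : ℕ) : GI ((dl h)^[k] F) := by
  induction k generalizing F with
  | zero => exact hF
  | succ k ih => exact ih (hF.dl1 h)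

lemma GI.L2w_le {F : FunRT} (h : GI F) (n : ℕ) : L2w n F ≤ Wt (fun p _ => wp n p) F := by
  unfold L2w Wt
  refine ENNReal.tsum_le_tsum fun p => ?_
  rw [lintegral_const_mul _ (meas_ftx _)]
  exact mul_le_mul_right (L2_le_ftx (h.int p) (memLp_of_ftx (h.int p) (h.fint p))) _

end NtProof

namespace NtProof
open scoped FourierTransform Topology

lemma meas_kmul (m : ℕ) {f : ℝ → ℝ≥0∞} (hf : Measurable f) : Measurable fun h => kap m h * f h :=
  (kap_meas m).mul hf

def XF (m : ℕ) (F : FunRT) (h : ℝ) : ℝ≥0∞ :=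
  Wt (fun p ξ => wq 2 p ξ * ‖Eh h ξ‖ₑ ^ (2 * (m + 1))) F +
    2 * (Wt (fun p ξ => wp 0 p * ‖Eh h ξ‖ₑ ^ (2 * (m + 1))) (xMul F) +
      ENNReal.ofReal (((m + 1 : ℝ) * h) ^ 2) * Wt (fun p ξ => wp 0 p * ‖Eh h ξ‖ₑ ^ (2 * m)) F)

lemma XF_meas (m : ℕ) (F : FunRT) : Measurable (XF m F) := by
  unfold XF
  refine (Wt_meas _ (wq_meas 2) _).add (((Wt_meas _ (fun _ => measurable_const) _).add
    (Measurable.mul (by fun_prop) (Wt_meas _ (fun _ => measurable_const) _))).const_mul 2)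

lemma Lo_dlk (m : ℕ) {F : FunRT} (hF : Gd F) (hx : Gd (xMul F)) (h : ℝ) :
    Lo ((dl h)^[m + 1] F) ≤ XF m F h := by
  unfold Lo XF
  rw [Hq_eq, Wt_dlk h (m + 1) hF.int]
  refine add_le_add le_rfl ?_
  rw [xMul_dlk]
  refine (L2sq_sub fun p => (dlk_int h _ hx.int p).aestronglyMeasurable).trans ?_
  refine mul_le_mul_right (add_le_add ?_ ?_) _
  · rw [← L2w_zero]
    refine ((hx.gi.dlk h (m + 1)).L2w_le 0).trans ?_
    rw [Wt_dlk h (m + 1) hx.int]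
  · rw [L2sq_smul, L2sq_tau]
    refine mul_le_mul' (le_of_eq ?_) ?_
    · rw [← ofReal_norm, Complex.norm_real, ← ENNReal.ofReal_pow (norm_nonneg _), Real.norm_eq_abs, sq_abs]
    · rw [← L2w_zero]
      refine ((hF.gi.dlk h m).L2w_le 0).trans ?_
      rw [Wt_dlk h m hF.int]

lemma kap_h (m : ℕ) (h : ℝ) : kap (m + 1) h * ENNReal.ofReal (h ^ 2) = kap m h := by
  unfold kap
  rw [← ENNReal.ofReal_mul (by positivity)]
  congr 1
  rcases eq_or_ne h 0 with rfl | h0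
  · simp
  · have : |h| ≠ 0 := abs_ne_zero.2 h0
    rw [← sq_abs]
    field_simp
    ring

lemma wp_xi_le (m : ℕ) (p : ℤ) (ξ : ℝ) : wp 0 p * ENNReal.ofReal (ξ ^ (2 * m)) ≤ wq m p ξ := by
  unfold wp wq
  rw [pow_zero, ENNReal.ofReal_one, one_mul, pow_mul]
  exact ENNReal.ofReal_le_ofReal (pow_le_pow_left₀ (sq_nonneg _) (by nlinarith [sq_nonneg (p : ℝ)]) _)

lemma wq_mono {m n : ℕ} (h : m ≤ n) (p : ℤ) (ξ : ℝ) : wq m p ξ ≤ wq n p ξ :=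
  ENNReal.ofReal_le_ofReal (pow_le_pow_right₀ (by nlinarith [sq_nonneg (p : ℝ), sq_nonneg ξ]) h)

lemma wq_xi_le (m : ℕ) (p : ℤ) (ξ : ℝ) : wq 2 p ξ * ENNReal.ofReal (ξ ^ (2 * m)) ≤ wq (m + 2) p ξ := by
  unfold wq
  rw [← ENNReal.ofReal_mul (by positivity), add_comm m 2, pow_add, pow_mul]
  refine ENNReal.ofReal_le_ofReal (mul_le_mul_of_nonneg_left ?_ (by positivity))
  exact pow_le_pow_left₀ (sq_nonneg _) (by nlinarith [sq_nonneg (p : ℝ)]) _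

lemma XF_int (m : ℕ) (hm : 2 ≤ m) : ∃ C : ℝ≥0∞, C ≠ ∞ ∧ ∀ F : FunRT,
    ∫⁻ h, kap m h * XF m F h ≤ C * (Hq (m + 2) F + Hq m (xMul F)) := by
  obtain ⟨k, rfl⟩ : ∃ k, m = k + 1 := ⟨m - 1, by omega⟩
  set c1 := cm (k + 1) (k + 1 + 1)
  set c2 := cm k (k + 1)
  set d := ENNReal.ofReal (((k + 1 : ℕ) + 1 : ℝ) ^ 2)
  have hc1 : c1 ≠ ∞ := cm_ne_top _ _ (by omega) le_rfl
  have hc2 : c2 ≠ ∞ := cm_ne_top _ _ (by omega) le_rfl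
  have hd : d ≠ ∞ := ENNReal.ofReal_ne_top
  refine ⟨c1 + 2 * c1 + 2 * d * c2, by finiteness, fun F => ?_⟩
  have e : ∀ h, kap (k + 1) h * XF (k + 1) F h =
      (kap (k + 1) h * Wt (fun p ξ => wq 2 p ξ * ‖Eh h ξ‖ₑ ^ (2 * (k + 1 + 1))) F +
      2 * (kap (k + 1) h * Wt (fun p ξ => wp 0 p * ‖Eh h ξ‖ₑ ^ (2 * (k + 1 + 1))) (xMul F))) +
      2 * d * (kap k h * Wt (fun p ξ => wp 0 p * ‖Eh h ξ‖ₑ ^ (2 * (k + 1))) F) := by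
    intro h
    rw [XF, mul_pow, ENNReal.ofReal_mul (by positivity), ← kap_h k h]
    ring
  simp_rw [e]
  have m2 := meas_kmul (k + 1) (Wt_meas (k + 1 + 1) (w := fun p _ => wp 0 p)
    (fun _ => measurable_const) (xMul F))
  have m3 := meas_kmul k (Wt_meas (k + 1) (w := fun p _ => wp 0 p) (fun _ => measurable_const) F)
  rw [lintegral_add_right _ (m3.const_mul _), lintegral_add_right _ (m2.const_mul _),
    lintegral_const_mul' _ _ (by finiteness), lintegral_const_mul' _ _ (by finiteness),
    kK_int 0 (k + 1) (k + 1 + 1) (by omega) (by omega), kK_int 0 k (k + 1) (by omega) (by omega),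
    Wt_int (k + 1) (k + 1 + 1) (by omega) (by omega) (wq_meas 2)]
  have b1 : Wt (fun p ξ => wq 2 p ξ * ENNReal.ofReal (ξ ^ (2 * (k + 1)))) F ≤ Hq (k + 1 + 2) F :=
    Wt_mono (fun p ξ => wq_xi_le (k + 1) p ξ) F
  have b2 : Wm 0 (k + 1) (xMul F) ≤ Hq (k + 1) (xMul F) := Wt_mono (fun p ξ => wp_xi_le _ p ξ) _
  have b3 : Wm 0 k F ≤ Hq (k + 1 + 2) F :=
    Wt_mono (fun p ξ => (wp_xi_le _ p ξ).trans (wq_mono (by omega) p ξ)) _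
  set a := Hq (k + 1 + 2) F
  set b := Hq (k + 1) (xMul F)
  calc _ ≤ c1 * (a + b) + 2 * (c1 * (a + b)) + 2 * d * (c2 * (a + b)) := by
        refine add_le_add (add_le_add ?_ ?_) ?_
        · exact mul_le_mul_right (b1.trans le_self_add) _
        · exact mul_le_mul_right (mul_le_mul_right (b2.trans le_add_self) _) _
        · exact mul_le_mul_right (mul_le_mul_right (b3.trans le_self_add) _) _
    _ = _ := by ring

def DD (n : ℕ) (t : ℝ) (G H : FunRT) : ℝ≥0∞ := Hq n G * A2 t H + A2 t G * Hq n H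

def Tm (n m : ℕ) (t : ℝ) (F G H : FunRT) (h : ℝ) : ℝ≥0∞ :=
  Wt (fun p ξ => wp n p * ‖Eh h ξ‖ₑ ^ (2 * (m + 1))) F * (A2 t G * A2 t H) +
    XF m F h * (del t * DD n t G H)

lemma Tm_meas (n m : ℕ) (t : ℝ) (F G H : FunRT) : Measurable (Tm n m t F G H) := by
  unfold Tm
  exact ((Wt_meas _ (fun _ => measurable_const) _).mul_const _).add ((XF_meas m F).mul_const _)

lemma wp_le_wq (n : ℕ) (p : ℤ) (ξ : ℝ) : wp n p ≤ wq n p ξ :=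
  ENNReal.ofReal_le_ofReal (pow_le_pow_left₀ (by positivity) (by nlinarith [sq_nonneg ξ]) _)

lemma L2w_expA_Hq (n : ℕ) (t : ℝ) (F : FunRT) : L2w n (expA t F) ≤ Hq n F :=
  (L2w_expA_Wt n t F).trans (Wt_mono (fun p ξ => wp_le_wq n p ξ) F)

lemma Aw_dlk_le (m : ℕ) (t : ℝ) {F : FunRT} (hF : Gd F) (hx : Gd (xMul F)) (h : ℝ) :
    Aw ((dl h)^[m + 1] (expA t F)) ^ 2 ≤ del t * XF m F h := by
  rw [← expA_dlk t h _ hF.gi]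
  exact (A2_le t (hF.dlk h _)).trans (mul_le_mul_right (Lo_dlk m hF hx h) _)

/-- abstract form of one of the three contributions -/
lemma Bd_le (n m : ℕ) (t : ℝ) {F G H : FunRT} (h : ℝ) {X Y Z : FunRT}
    (h1 : L2w n X ≤ Wt (fun p ξ => wp n p * ‖Eh h ξ‖ₑ ^ (2 * (m + 1))) F)
    (h2 : Aw X ^ 2 ≤ del t * XF m F h) (hY : Aw Y ^ 2 = A2 t G) (hZ : Aw Z ^ 2 = A2 t H)
    (hY' : L2w n Y ≤ Hq n G) (hZ' : L2w n Z ≤ Hq n H) :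
    Bd n X Y Z ≤ Tm n m t F G H h := by
  unfold Bd Tm DD
  rw [hY, hZ, mul_assoc]
  refine add_le_add (mul_le_mul' h1 le_rfl) ?_
  rw [mul_left_comm, ← mul_assoc]
  exact mul_le_mul' h2 (add_le_add (mul_le_mul' hY' le_rfl) (mul_le_mul_right hZ' _))

def TB (n m : ℕ) (t : ℝ) (F G H : FunRT) : ℝ≥0∞ :=
  Wm n m F * (A2 t G * A2 t H) + (Hq (m + 2) F + Hq m (xMul F)) * (del t * DD n t G H)

lemma WB (n m : ℕ) (hm : 2 ≤ m) : ∃ C : ℝ≥0∞, C ≠ ∞ ∧ ∀ (t : ℝ) (F G H : FunRT), Gd F → Gd G → Gd H →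
    Gd (xMul F) → Gd (xMul G) → Gd (xMul H) →
    Wm n m (Qn t F G H) ≤ C * (TB n m t F G H + TB n m t G F H + TB n m t H F G) := by
  obtain ⟨Cx, hCx, hX⟩ := XF_int m hm
  have hK : CL (m + 1) * (2 * 4 ^ n) ^ 2 ≠ ∞ := by have := CL_ne (m + 1); finiteness
  have hcm := cm_ne_top m (m + 1) (by omega) le_rfl
  refine ⟨(cm m (3 * (m + 1)))⁻¹ * (ENNReal.ofReal (2 * Real.pi) * (CL (m + 1) * (2 * 4 ^ n) ^ 2)) *
    (cm m (m + 1) + Cx), ?_, ?_⟩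
  · have := ENNReal.inv_ne_top.2 (cm_ne_zero m (3 * (m + 1)))
    finiteness
  intro t F G H hF hG hH xF xG xH
  rw [mul_assoc _ (cm m (m + 1) + Cx)]
  set R : ℝ → ℝ≥0∞ := fun h => Tm n m t F G H h + Tm n m t G F H h + Tm n m t H F G h with hR
  have key : ∀ F G H : FunRT, ∫⁻ h, kap m h * Tm n m t F G H h ≤ (cm m (m + 1) + Cx) * TB n m t F G H := by
    intro F G H
    unfold Tm TB
    rw [kmul2 m (Wt_meas _ (fun _ => measurable_const) _) (XF_meas m F), kK_int n m _ (by omega) (by omega),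
      mul_add (cm m (m + 1) + Cx)]
    refine add_le_add ?_ ?_
    · rw [mul_assoc]; exact mul_le_mul' le_self_add le_rfl
    · refine (mul_le_mul' (hX F) le_rfl).trans ?_
      rw [mul_assoc]; exact mul_le_mul' le_add_self le_rfl
  refine sq_close n m (3 * (m + 1)) (by omega) (by omega) (by omega) (Qn_int t hF hG hH) hK (R := R) ?_ ?_
  · intro h
    refine (diff_L2w n h (m + 1) (hF.nice t) (hG.nice t).conj (hH.nice t)).trans ?_
    refine mul_le_mul_right ?_ _
    have cG : L2w n (conjF (expA t G)) ≤ Hq n G := by rw [L2w_conj]; exact L2w_expA_Hq n t G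
    refine add_le_add (add_le_add ?_ ?_) ?_
    · exact Bd_le n m t h (L2w_dlk_expA n t h _ hF.gi) (Aw_dlk_le m t hF xF h) (by rw [Aw_conj]; rfl) rfl
        cG (L2w_expA_Hq n t H)
    · exact Bd_le n m t h (L2w_dlk_conj n t h _ hG.gi) (by rw [dlk_conj, Aw_conj]; exact Aw_dlk_le m t hG xG h)
        rfl rfl (L2w_expA_Hq n t F) (L2w_expA_Hq n t H)
    · exact Bd_le n m t h (L2w_dlk_expA n t h _ hH.gi) (Aw_dlk_le m t hH xH h) rfl (by rw [Aw_conj]; rfl)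
        (L2w_expA_Hq n t F) cG
  · have e : ∀ h, kap m h * R h = (kap m h * Tm n m t F G H h + kap m h * Tm n m t G F H h) +
        kap m h * Tm n m t H F G h := fun h => by rw [hR]; ring
    simp_rw [e]
    have mm := fun F G H => meas_kmul m (Tm_meas n m t F G H)
    rw [lintegral_add_right _ (mm H F G), lintegral_add_right _ (mm G F H), mul_add, mul_add]
    exact add_le_add (add_le_add (key _ _ _) (key _ _ _)) (key _ _ _)

lemma WC (n : ℕ) : ∃ C : ℝ≥0∞, C ≠ ∞ ∧ ∀ (t : ℝ) (F G H : FunRT), Gd F → Gd G → Gd H →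
    Wt (fun p _ => wp n p) (Qn t F G H) ≤ C * (Hq n F * (A2 t G * A2 t H) + Hq n G * (A2 t F * A2 t H) +
      Hq n H * (A2 t F * A2 t G)) := by
  refine ⟨ENNReal.ofReal (2 * Real.pi) * (2 * 4 ^ n) ^ 2, by finiteness, ?_⟩
  intro t F G H hF hG hH
  refine (Wt_wp_le n _).trans ?_
  rw [mul_assoc]
  refine mul_le_mul_right ((tri_L2w n (hF.nice t) (hG.nice t).conj (hH.nice t)).trans ?_) _
  refine mul_le_mul_right ?_ _
  unfold Bd
  rw [Aw_conj, L2w_conj]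
  change L2w n (expA t F) * A2 t G * A2 t H + A2 t F * (L2w n (expA t G) * A2 t H + A2 t G * L2w n (expA t H)) ≤ _
  calc _ = L2w n (expA t F) * (A2 t G * A2 t H) + L2w n (expA t G) * (A2 t F * A2 t H) +
      L2w n (expA t H) * (A2 t F * A2 t G) := by ring
    _ ≤ _ := add_le_add (add_le_add (mul_le_mul' (L2w_expA_Hq n t F) le_rfl)
        (mul_le_mul' (L2w_expA_Hq n t G) le_rfl)) (mul_le_mul' (L2w_expA_Hq n t H) le_rfl)

end NtProof

namespace NtProof
open scoped FourierTransform Topology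

def S2 (N : ℕ) (F : FunRT) : ℝ≥0∞ := Hq N F + L2sq (xMul F)

def w8 (N : ℕ) (p : ℤ) (ξ : ℝ) : ℝ≥0∞ := ENNReal.ofReal ((1 + ξ ^ 2) ^ 8) * wq N p ξ

def P2 (N : ℕ) (F : FunRT) : ℝ≥0∞ := Wt (w8 N) F + Hq N (xMul F) + S2 N F

lemma Lo_le (N : ℕ) (hN : 2 ≤ N) (F : FunRT) : Lo F ≤ S2 N F := add_le_add (Hq_mono F hN) le_rfl

lemma A2_le' (N : ℕ) (hN : 2 ≤ N) (t : ℝ) {F : FunRT} (h : Gd F) : A2 t F ≤ del t * S2 N F :=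
  (A2_le t h).trans (mul_le_mul_right (Lo_le N hN F) _)

lemma A2A2 (N : ℕ) (hN : 2 ≤ N) (t : ℝ) {F G : FunRT} (hF : Gd F) (hG : Gd G) :
    A2 t F * A2 t G ≤ del t ^ 2 * (S2 N F * S2 N G) :=
  (mul_le_mul' (A2_le' N hN t hF) (A2_le' N hN t hG)).trans (le_of_eq (by ring))

lemma wq_split (N : ℕ) (p : ℤ) (ξ : ℝ) :
    wq N p ξ ≤ 2 ^ N * (wp 0 p * ENNReal.ofReal (ξ ^ (2 * N)) + wp N p) := by
  unfold wq wp
  rw [pow_zero, ENNReal.ofReal_one, one_mul, ← ENNReal.ofReal_add (by rw [pow_mul]; positivity) (by positivity),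
    show (2 : ℝ≥0∞) ^ N = ENNReal.ofReal (2 ^ N) by rw [ENNReal.ofReal_pow (by norm_num)]; simp,
    ← ENNReal.ofReal_mul (by positivity)]
  refine ENNReal.ofReal_le_ofReal ?_
  have h := add_pow_le (sq_nonneg ξ) (show (0 : ℝ) ≤ 1 + (p : ℝ) ^ 2 by positivity) N
  have h2 : (2 : ℝ) ^ (N - 1) ≤ 2 ^ N := pow_le_pow_right₀ (by norm_num) (by omega)
  rw [show 1 + ξ ^ 2 + (p : ℝ) ^ 2 = ξ ^ 2 + (1 + (p : ℝ) ^ 2) by ring, pow_mul]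
  exact h.trans (mul_le_mul_of_nonneg_right h2 (by positivity))

lemma w8_split_real (N : ℕ) (a b : ℝ) (ha : 0 ≤ a) (hb : 1 ≤ b) :
    (1 + a) ^ 8 * (a + b) ^ N ≤ 2 ^ (N + 9) * (a ^ (N + 8) + b ^ N * a ^ 8 + b ^ N) := by
  have h1 := add_pow_le (zero_le_one) ha 8
  have h2 := add_pow_le ha (zero_le_one.trans hb) N
  have h3 : (2 : ℝ) ^ (N - 1) ≤ 2 ^ N := pow_le_pow_right₀ (by norm_num) (by omega)
  have hbN : 1 ≤ b ^ N := one_le_pow₀ hb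
  have haN : 0 ≤ a ^ N := by positivity
  have h4 : a ^ N ≤ 1 + a ^ (N + 8) := by
    rcases le_total a 1 with h | h
    · have := pow_le_one₀ (n := N) ha h
      have : 0 ≤ a ^ (N + 8) := by positivity
      linarith
    · have := pow_le_pow_right₀ h (show N ≤ N + 8 by omega)
      linarith
  have h5 : (a + b) ^ N ≤ 2 ^ N * (a ^ N + b ^ N) := h2.trans (mul_le_mul_of_nonneg_right h3 (by positivity))
  have h6 : (1 + a) ^ 8 ≤ 2 ^ 8 * (1 + a ^ 8) := by
    refine h1.trans ?_
    norm_num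
    have : 0 ≤ a ^ 8 := by positivity
    linarith
  have ha8 : 0 ≤ a ^ 8 := by positivity
  calc _ ≤ (2 ^ 8 * (1 + a ^ 8)) * (2 ^ N * (a ^ N + b ^ N)) := mul_le_mul h6 h5 (by positivity) (by positivity)
    _ = 2 ^ (N + 8) * (a ^ N + a ^ (N + 8) + b ^ N + b ^ N * a ^ 8) := by ring
    _ ≤ 2 ^ (N + 8) * (2 * (a ^ (N + 8) + b ^ N * a ^ 8 + b ^ N)) := by
        refine mul_le_mul_of_nonneg_left ?_ (by positivity)
        have : 0 ≤ b ^ N * a ^ 8 := by positivity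
        linarith
    _ = _ := by ring

lemma w8_split (N : ℕ) (p : ℤ) (ξ : ℝ) :
    w8 N p ξ ≤ 2 ^ (N + 9) * (wp 0 p * ENNReal.ofReal (ξ ^ (2 * (N + 8))) +
      wp N p * ENNReal.ofReal (ξ ^ (2 * 8)) + wp N p) := by
  unfold w8 wq wp
  rw [pow_zero, ENNReal.ofReal_one, one_mul, ← ENNReal.ofReal_mul (by positivity),
    ← ENNReal.ofReal_mul (by positivity),
    ← ENNReal.ofReal_add (by rw [pow_mul]; positivity) (by rw [pow_mul]; positivity),
    ← ENNReal.ofReal_add (by rw [pow_mul, pow_mul]; positivity) (by positivity),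
    show (2 : ℝ≥0∞) ^ (N + 9) = ENNReal.ofReal (2 ^ (N + 9)) by rw [ENNReal.ofReal_pow (by norm_num)]; simp,
    ← ENNReal.ofReal_mul (by positivity)]
  refine ENNReal.ofReal_le_ofReal ?_
  rw [show 1 + ξ ^ 2 + (p : ℝ) ^ 2 = ξ ^ 2 + (1 + (p : ℝ) ^ 2) by ring, pow_mul, pow_mul]
  exact w8_split_real N (ξ ^ 2) (1 + (p : ℝ) ^ 2) (sq_nonneg _) (by nlinarith [sq_nonneg (p : ℝ)])

lemma one_le_w (ξ : ℝ) : (1 : ℝ≥0∞) ≤ ENNReal.ofReal ((1 + ξ ^ 2) ^ 8) := by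
  rw [ENNReal.one_le_ofReal]; exact one_le_pow₀ (by nlinarith [sq_nonneg ξ])

lemma xi_meas (n m : ℕ) (p : ℤ) : Measurable fun ξ : ℝ => wp n p * ENNReal.ofReal (ξ ^ (2 * m)) := by
  fun_prop

lemma add3_le {a b c a' b' c' : ℝ≥0∞} (h1 : a ≤ a') (h2 : b ≤ b') (h3 : c ≤ c') : a + b + c ≤ a' + b' + c' :=
  add_le_add (add_le_add h1 h2) h3

/-- `H^N` bound for the product. -/
lemma R1 (N : ℕ) (hN : 2 ≤ N) : ∃ C : ℝ≥0∞, C ≠ ∞ ∧ ∀ (t : ℝ) (F G H : FunRT), Gd F → Gd G → Gd H →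
    Hq N (Qn t F G H) ≤ C * del t ^ 2 * (S2 N F * S2 N G * S2 N H) := by
  obtain ⟨C1, h1, H1⟩ := WA N (by omega)
  obtain ⟨C2, h2, H2⟩ := WC N
  refine ⟨2 ^ N * (C1 * 3 + C2 * 3), by finiteness, ?_⟩
  intro t F G H hF hG hH
  have key : ∀ {a b c : ℝ≥0∞}, a ≤ Hq N F → b ≤ Hq N G → c ≤ Hq N H →
      a * (A2 t G * A2 t H) + b * (A2 t F * A2 t H) + c * (A2 t F * A2 t G) ≤
        3 * (del t ^ 2 * (S2 N F * S2 N G * S2 N H)) := by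
    intro a b c ha hb hc
    calc _ ≤ S2 N F * (del t ^ 2 * (S2 N G * S2 N H)) + S2 N G * (del t ^ 2 * (S2 N F * S2 N H)) +
          S2 N H * (del t ^ 2 * (S2 N F * S2 N G)) :=
          add3_le (mul_le_mul' (ha.trans le_self_add) (A2A2 N hN t hG hH))
            (mul_le_mul' (hb.trans le_self_add) (A2A2 N hN t hF hH))
            (mul_le_mul' (hc.trans le_self_add) (A2A2 N hN t hF hG))
      _ = _ := by ring
  have w0 : ∀ F, Wm 0 N F ≤ Hq N F := fun F => Wt_mono (fun p ξ => wp_xi_le N p ξ) F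
  rw [Hq_eq]
  calc _ ≤ Wt (fun p ξ => 2 ^ N * (wp 0 p * ENNReal.ofReal (ξ ^ (2 * N)) + wp N p)) (Qn t F G H) :=
        Wt_mono (fun p ξ => wq_split N p ξ) _
    _ = 2 ^ N * (Wm 0 N (Qn t F G H) + Wt (fun p _ => wp N p) (Qn t F G H)) := by
        rw [Wt_const_mul _ (by finiteness), Wt_add (xi_meas 0 N)]; rfl
    _ ≤ 2 ^ N * (C1 * (3 * (del t ^ 2 * (S2 N F * S2 N G * S2 N H))) +
          C2 * (3 * (del t ^ 2 * (S2 N F * S2 N G * S2 N H)))) :=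
        mul_le_mul_right (add_le_add
          ((H1 t F G H hF hG hH).trans (mul_le_mul_right (key (w0 F) (w0 G) (w0 H)) _))
          ((H2 t F G H hF hG hH).trans (mul_le_mul_right (key le_rfl le_rfl le_rfl) _))) _
    _ = _ := by ring

def P3 (N : ℕ) (F G H : FunRT) : ℝ≥0∞ :=
  P2 N F * (S2 N G * S2 N H) + P2 N G * (S2 N F * S2 N H) + P2 N H * (S2 N F * S2 N G)

lemma Wm08_le (N : ℕ) (F : FunRT) : Wm 0 (N + 8) F ≤ P2 N F := by
  refine le_trans (Wt_mono (fun p ξ => ?_) F) (le_self_add.trans le_self_add)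
  unfold wp w8 wq
  rw [pow_zero, ENNReal.ofReal_one, one_mul, ← ENNReal.ofReal_mul (by positivity), add_comm N 8, pow_mul, pow_add]
  refine ENNReal.ofReal_le_ofReal (mul_le_mul ?_ ?_ (by positivity) (by positivity))
  · exact pow_le_pow_left₀ (sq_nonneg _) (by linarith) _
  · exact pow_le_pow_left₀ (sq_nonneg _) (by nlinarith [sq_nonneg (p : ℝ)]) _

lemma WmN8_le (N : ℕ) (F : FunRT) : Wm N 8 F ≤ P2 N F := by
  refine le_trans (Wt_mono (fun p ξ => ?_) F) (le_self_add.trans le_self_add)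
  unfold w8
  rw [mul_comm]
  refine mul_le_mul' (ENNReal.ofReal_le_ofReal ?_) (wp_le_wq N p ξ)
  rw [pow_mul]
  exact pow_le_pow_left₀ (sq_nonneg _) (by linarith) _

lemma S2_le_P2 (N : ℕ) (F : FunRT) : S2 N F ≤ P2 N F := le_add_self

lemma TB_le (N : ℕ) (hN : 10 ≤ N) (t : ℝ) {F G H : FunRT} (hG : Gd G) (hH : Gd H) :
    TB N 8 t F G H ≤ 3 * (del t ^ 2 * (P2 N F * (S2 N G * S2 N H))) := by
  unfold TB DD
  have hx : Hq (8 + 2) F + Hq 8 (xMul F) ≤ P2 N F := by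
    calc _ ≤ S2 N F + (Wt (w8 N) F + Hq N (xMul F)) :=
          add_le_add ((Hq_mono F (by omega)).trans le_self_add) ((Hq_mono _ (by omega)).trans le_add_self)
      _ = _ := add_comm _ _
  have hg : Hq N G ≤ S2 N G := le_self_add
  have hh : Hq N H ≤ S2 N H := le_self_add
  calc _ ≤ P2 N F * (del t ^ 2 * (S2 N G * S2 N H)) + P2 N F * (del t *
        (S2 N G * (del t * S2 N H) + (del t * S2 N G) * S2 N H)) := by
        refine add_le_add (mul_le_mul' (WmN8_le N F) (A2A2 N (by omega) t hG hH))
          (mul_le_mul' hx (mul_le_mul_right (add_le_add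
            (mul_le_mul' hg (A2_le' N (by omega) t hH)) (mul_le_mul' (A2_le' N (by omega) t hG) hh)) _))
    _ = _ := by ring

/-- Tame bound for the product. -/
lemma R2 (N : ℕ) (hN : 10 ≤ N) : ∃ C : ℝ≥0∞, C ≠ ∞ ∧ ∀ (t : ℝ) (F G H : FunRT), Gd F → Gd G → Gd H →
    Gd (xMul F) → Gd (xMul G) → Gd (xMul H) →
    Wt (w8 N) (Qn t F G H) ≤ C * del t ^ 2 * P3 N F G H := by
  obtain ⟨C1, h1, H1⟩ := WA (N + 8) (by omega)
  obtain ⟨C2, h2, H2⟩ := WC N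
  obtain ⟨C3, h3, H3⟩ := WB N 8 (by omega)
  refine ⟨2 ^ (N + 9) * (C1 + C3 * 3 + C2), by finiteness, ?_⟩
  intro t F G H hF hG hH xF xG xH
  have key : ∀ {a b c : ℝ≥0∞}, a ≤ P2 N F → b ≤ P2 N G → c ≤ P2 N H →
      a * (A2 t G * A2 t H) + b * (A2 t F * A2 t H) + c * (A2 t F * A2 t G) ≤
        del t ^ 2 * P3 N F G H := by
    intro a b c ha hb hc
    have hN' : 2 ≤ N := by omega
    calc _ ≤ P2 N F * (del t ^ 2 * (S2 N G * S2 N H)) + P2 N G * (del t ^ 2 * (S2 N F * S2 N H)) +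
          P2 N H * (del t ^ 2 * (S2 N F * S2 N G)) :=
          add3_le (mul_le_mul' ha (A2A2 N hN' t hG hH))
            (mul_le_mul' hb (A2A2 N hN' t hF hH))
            (mul_le_mul' hc (A2A2 N hN' t hF hG))
      _ = _ := by unfold P3; ring
  have hq : ∀ F, Hq N F ≤ P2 N F := fun F => le_self_add.trans (S2_le_P2 N F)
  have key3 : TB N 8 t F G H + TB N 8 t G F H + TB N 8 t H F G ≤ 3 * (del t ^ 2 * P3 N F G H) := by
    refine (add3_le (TB_le N hN t hG hH) (TB_le N hN t hF hH) (TB_le N hN t hF hG)).trans (le_of_eq ?_)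
    unfold P3; ring
  calc _ ≤ Wt (fun p ξ => 2 ^ (N + 9) * (wp 0 p * ENNReal.ofReal (ξ ^ (2 * (N + 8))) +
      wp N p * ENNReal.ofReal (ξ ^ (2 * 8)) + wp N p)) (Qn t F G H) :=
        Wt_mono (fun p ξ => w8_split N p ξ) _
    _ = 2 ^ (N + 9) * (Wm 0 (N + 8) (Qn t F G H) + Wm N 8 (Qn t F G H) + Wt (fun p _ => wp N p) (Qn t F G H)) := by
        have hmm : ∀ p : ℤ, Measurable fun ξ : ℝ => wp 0 p * ENNReal.ofReal (ξ ^ (2 * (N + 8))) +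
            wp N p * ENNReal.ofReal (ξ ^ (2 * 8)) :=
          fun p => (xi_meas 0 (N + 8) p).add (xi_meas N 8 p)
        rw [Wt_const_mul _ (by finiteness), Wt_add hmm, Wt_add (xi_meas 0 (N + 8))]; rfl
    _ ≤ 2 ^ (N + 9) * (C1 * (del t ^ 2 * P3 N F G H) + C3 * (3 * (del t ^ 2 * P3 N F G H)) +
          C2 * (del t ^ 2 * P3 N F G H)) :=
        mul_le_mul_right (add3_le
          ((H1 t F G H hF hG hH).trans (mul_le_mul_right (key (Wm08_le N F) (Wm08_le N G) (Wm08_le N H)) _))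
          ((H3 t F G H hF hG hH xF xG xH).trans (mul_le_mul_right key3 _))
          ((H2 t F G H hF hG hH).trans (mul_le_mul_right (key (hq F) (hq G) (hq H)) _))) _
    _ = _ := by ring

/-! #### Consequences for `Nt` -/

lemma Nt_eq (t : ℝ) (F G H : FunRT) : Nt t F G H = expA (-t) (Qn t F G H) := rfl

lemma Wt_expA_le (t : ℝ) (w : ℤ → ℝ → ℝ≥0∞) (F : FunRT) : Wt w (expA t F) ≤ Wt w F := by
  unfold Wt
  refine ENNReal.tsum_le_tsum fun p => lintegral_mono_ae ?_
  filter_upwards [ftx_iftx_le (fun ξ => Complex.exp (-(Complex.I * t * ξ ^ 2)) * ftx (F p) ξ)] with ξ hξ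
  refine mul_le_mul_right (pow_le_pow_left₀ zero_le ?_ 2) _
  have e : expA t F p = fun x => Complex.exp (-(Complex.I * t * |(p : ℝ)|)) * schro t (F p) x := rfl
  rw [e, ftx_const_mul, enorm_mul, enorm_of_norm_one (norm_phabs t p), one_mul]
  refine hξ.trans (le_of_eq ?_)
  rw [enorm_mul, enorm_of_norm_one (norm_phsq t ξ), one_mul]

lemma Qn_gi (t : ℝ) {F G H : FunRT} (hF : Gd F) (hG : Gd G) (hH : Gd H) : GI (Qn t F G H) := by
  refine ⟨Qn_int t hF hG hH, fun p => ?_⟩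
  obtain ⟨C, hC, h⟩ := R1 2 le_rfl
  have h1 : Hq 2 (Qn t F G H) ≠ ∞ := by
    refine ne_top_of_le_ne_top ?_ (h t F G H hF hG hH)
    have a1 : S2 2 F ≠ ∞ := hF.lo
    have a2 : S2 2 G ≠ ∞ := hG.lo
    have a3 : S2 2 H ≠ ∞ := hH.lo
    have := del_ne t
    finiteness
  apply int_of_weight (ftx_cont _).aestronglyMeasurable
  refine ne_top_of_le_ne_top (ENNReal.ne_top_of_tsum_ne_top h1 p) ?_
  refine lintegral_mono fun ξ => mul_le_mul' (ENNReal.ofReal_le_ofReal ?_) le_rfl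
  nlinarith [sq_nonneg ξ, sq_nonneg (p : ℝ)]

end NtProof

namespace NtProof
open scoped FourierTransform Topology

/-! #### Galilean invariance -/

def modF (η : ℝ) (F : FunRT) : FunRT := fun p x => Complex.exp (Complex.I * η * x) * F p x

def galF (t η : ℝ) (U : FunRT) : FunRT := fun p x =>
  Complex.exp (Complex.I * x * η - Complex.I * t * η ^ 2) * U p (x - 2 * t * η)

lemma norm_gph (t η x : ℝ) : ‖Complex.exp (Complex.I * x * η - Complex.I * t * η ^ 2)‖ = 1 := by
  rw [show Complex.I * x * η - Complex.I * t * η ^ 2 = ((x * η - t * η ^ 2 : ℝ) : ℂ) * Complex.I by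
    push_cast; ring, Complex.norm_exp_ofReal_mul_I]

lemma ftx_mod (η : ℝ) (f : ℝ → ℂ) (ξ : ℝ) :
    ftx (fun x : ℝ => Complex.exp (Complex.I * η * x) * f x) ξ = ftx f (ξ - η) := by
  unfold ftx
  congr 1; ext x
  rw [← mul_assoc, ← Complex.exp_add]
  congr 2; push_cast; ring

lemma schro_mod (t η : ℝ) (f : ℝ → ℂ) (x : ℝ) :
    schro t (fun x : ℝ => Complex.exp (Complex.I * η * x) * f x) x =
      Complex.exp (Complex.I * x * η - Complex.I * t * η ^ 2) * schro t f (x - 2 * t * η) := by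
  unfold schro iftx
  rw [mul_left_comm]
  congr 1
  rw [← integral_const_mul, ← integral_add_right_eq_self _ η]
  refine integral_congr_ae (Eventually.of_forall fun ξ => ?_)
  simp only []
  rw [ftx_mod, add_sub_cancel_right, ← mul_assoc, ← mul_assoc, ← mul_assoc, ← Complex.exp_add, ← Complex.exp_add,
    ← Complex.exp_add]
  congr 2; push_cast; ring

lemma expA_mod (t η : ℝ) (F : FunRT) : expA t (modF η F) = galF t η (expA t F) := by
  ext p x
  simp only [expA, galF]
  rw [show modF η F p = fun x : ℝ => Complex.exp (Complex.I * η * x) * F p x from rfl, schro_mod]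
  ring

lemma expA_smul (t : ℝ) (c : ℂ) (F : FunRT) : expA t (c • F) = c • expA t F := by
  ext p x
  simp only [expA, Pi.smul_apply, smul_eq_mul]
  have : schro t ((c • F) p) x = c * schro t (F p) x := by
    unfold schro iftx
    rw [mul_left_comm]
    congr 1
    rw [← integral_const_mul]
    refine integral_congr_ae (Eventually.of_forall fun ξ => ?_)
    simp only []
    rw [show (c • F) p = fun x => c * F p x from rfl, ftx_const_mul]; ring
  rw [show c • F p = (c • F) p from rfl, this]; ring

lemma galF_eq (t η : ℝ) (V : FunRT) :
    galF t η V = Complex.exp (-(Complex.I * t * η ^ 2)) • modF η (tau (-(2 * t * η)) V) := by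
  ext p x
  simp only [galF, modF, tau, Pi.smul_apply, smul_eq_mul]
  rw [← mul_assoc, ← Complex.exp_add, ← sub_eq_add_neg]
  congr 2; ring

lemma expA_neg_gal (t η : ℝ) (V : FunRT) : expA (-t) (galF t η V) = modF η (expA (-t) V) := by
  rw [galF_eq, expA_smul, expA_mod, expA_tau]
  ext p x
  simp only [galF, modF, tau, Pi.smul_apply, smul_eq_mul]
  rw [← mul_assoc, ← Complex.exp_add]
  congr 2
  · push_cast; ring
  · push_cast; ring

lemma conjF_gal_mul (t η : ℝ) (U V W : FunRT) :
    tri (galF t η U) (conjF (galF t η V)) (galF t η W) = galF t η (tri U (conjF V) W) := by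
  ext p x
  simp only [tri, mulF, galF, conjF, map_mul]
  set e := Complex.exp (Complex.I * x * η - Complex.I * t * η ^ 2) with he
  have h1 : e * (starRingEnd ℂ) e = 1 := by
    rw [Complex.mul_conj, Complex.normSq_eq_norm_sq, he, norm_gph]; simp
  rw [← tsum_mul_left]
  congr 1; ext q
  have : ∀ r : ℤ, e * U r (x - 2 * t * η) * ((starRingEnd ℂ) e * (starRingEnd ℂ) (V (-(q - r)) (x - 2 * t * η))) =
      U r (x - 2 * t * η) * (starRingEnd ℂ) (V (-(q - r)) (x - 2 * t * η)) := by
    intro r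
    calc _ = (e * (starRingEnd ℂ) e) * (U r (x - 2 * t * η) * (starRingEnd ℂ) (V (-(q - r)) (x - 2 * t * η))) := by ring
      _ = _ := by rw [h1, one_mul]
  simp only [this]
  ring

lemma Qn_mod (t η : ℝ) (F G H : FunRT) :
    Qn t (modF η F) (modF η G) (modF η H) = galF t η (Qn t F G H) := by
  unfold Qn
  rw [expA_mod, expA_mod, expA_mod, conjF_gal_mul]

lemma Nt_mod (t η : ℝ) (F G H : FunRT) :
    modF η (Nt t F G H) = expA (-t) (Qn t (modF η F) (modF η G) (modF η H)) := by
  rw [Qn_mod, expA_neg_gal, Nt_eq]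

lemma Aw_gal (t η : ℝ) (U : FunRT) : Aw (galF t η U) = Aw U := by
  rw [← Aw_tau (-(2 * t * η)) U]
  unfold Aw galF tau
  simp only [enorm_mul, enorm_of_norm_one (norm_gph _ _ _), one_mul]
  simp only [sub_eq_add_neg]

lemma norm_mph (η x : ℝ) : ‖Complex.exp (Complex.I * η * x)‖ = 1 := norm_ph3 η x

lemma Gd.mod {F : FunRT} (hF : Gd F) (η : ℝ) : Gd (modF η F) := by
  refine ⟨fun p => ?_, ?_, ?_⟩
  · exact ph_int' η (hF.int p)
  · have : Hq 2 (modF η F) ≤ ENNReal.ofReal ((2 + 2 * η ^ 2) ^ 2) * Hq 2 F := by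
      unfold Hq
      rw [← ENNReal.tsum_mul_left]
      refine ENNReal.tsum_le_tsum fun p => ?_
      rw [← lintegral_add_right_eq_self _ η, ← lintegral_const_mul' _ _ (by finiteness)]
      refine lintegral_mono fun ξ => ?_
      simp only []
      rw [show modF η F p = fun x : ℝ => Complex.exp (Complex.I * η * x) * F p x from rfl, ftx_mod,
        add_sub_cancel_right, ← mul_assoc, ← ENNReal.ofReal_mul (by positivity), ← mul_pow]
      refine mul_le_mul' (ENNReal.ofReal_le_ofReal (pow_le_pow_left₀ (by positivity) ?_ 2)) le_rfl
      nlinarith [sq_nonneg (ξ - η), sq_nonneg (ξ * η), sq_nonneg (p : ℝ), sq_nonneg ((p : ℝ) * η), sq_nonneg ξ, sq_nonneg η]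
    have := hF.hq
    refine ne_top_of_le_ne_top ?_ ‹Hq 2 (modF η F) ≤ _›
    finiteness
  · have : L2sq (xMul (modF η F)) = L2sq (xMul F) := by
      rw [L2sq_eq, L2sq_eq]
      unfold xMul modF
      simp only [enorm_mul, enorm_of_norm_one (norm_mph _ _), one_mul]
    rw [this]; exact hF.hx

lemma mod_sub_L2 (η : ℝ) (F : FunRT) : L2sq (modF η F - F) ≤ ENNReal.ofReal (η ^ 2) * L2sq (xMul F) := by
  rw [L2sq_eq, L2sq_eq, ← ENNReal.tsum_mul_left]
  refine ENNReal.tsum_le_tsum fun p => ?_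
  rw [← lintegral_const_mul' _ _ (by finiteness)]
  refine lintegral_mono fun x => ?_
  have e : (modF η F - F) p x = Eh η x * F p x := by
    simp only [modF, Pi.sub_apply, Eh]; ring
  rw [e, show xMul F p x = (x : ℂ) * F p x from rfl, enorm_mul, enorm_mul, mul_pow, mul_pow, ← mul_assoc]
  refine mul_le_mul' ?_ le_rfl
  rw [← ofReal_norm, ← ofReal_norm, ← ENNReal.ofReal_pow (norm_nonneg _), ← ENNReal.ofReal_pow (norm_nonneg _),
    ← ENNReal.ofReal_mul (by positivity)]
  refine ENNReal.ofReal_le_ofReal ?_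
  have := Eh_le_abs η x
  rw [Complex.norm_real, Real.norm_eq_abs, sq_abs, ← mul_pow, ← sq_abs (η * x)]
  exact pow_le_pow_left₀ (norm_nonneg _) this 2

lemma exp_two (y : ℝ) : ‖Complex.exp (Complex.I * y) - 1 - Complex.I * y‖ ≤ 2 * y ^ 2 := by
  have hn : ‖Complex.I * y‖ = |y| := by simp
  rcases le_total |y| 1 with h | h
  · have := Complex.norm_exp_sub_one_sub_id_le (x := Complex.I * y) (by rw [hn]; exact h)
    rw [hn, sq_abs] at this
    nlinarith [sq_nonneg y]
  · have h1 := Real.norm_exp_I_mul_ofReal_sub_one_le (x := y)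
    rw [Real.norm_eq_abs] at h1
    refine (norm_sub_le _ _).trans ?_
    rw [hn, ← sq_abs]; nlinarith

lemma mod_sub_L2' (η : ℝ) (F : FunRT) :
    L2sq (modF η F - F - (Complex.I * η) • xMul F) ≤ ENNReal.ofReal (4 * η ^ 4) * L2sq (xMul (xMul F)) := by
  rw [L2sq_eq, L2sq_eq, ← ENNReal.tsum_mul_left]
  refine ENNReal.tsum_le_tsum fun p => ?_
  rw [← lintegral_const_mul' _ _ (by finiteness)]
  refine lintegral_mono fun x => ?_
  have e : (modF η F - F - (Complex.I * η) • xMul F) p x =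
      (Complex.exp (Complex.I * (η * x : ℝ)) - 1 - Complex.I * (η * x : ℝ)) * F p x := by
    simp only [modF, Pi.sub_apply, Pi.smul_apply, smul_eq_mul, xMul]; push_cast; ring_nf
  rw [e, show xMul (xMul F) p x = (((x * x : ℝ)) : ℂ) * F p x by simp only [xMul]; push_cast; ring,
    enorm_mul, enorm_mul, mul_pow, mul_pow, ← mul_assoc]
  refine mul_le_mul' ?_ le_rfl
  rw [← ofReal_norm, ← ofReal_norm, ← ENNReal.ofReal_pow (norm_nonneg _), ← ENNReal.ofReal_pow (norm_nonneg _),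
    ← ENNReal.ofReal_mul (by positivity)]
  refine ENNReal.ofReal_le_ofReal ?_
  rw [Complex.norm_real, Real.norm_eq_abs, sq_abs]
  refine (pow_le_pow_left₀ (norm_nonneg _) (exp_two (η * x)) 2).trans (le_of_eq ?_)
  ring

/-! #### Trilinear algebra -/

lemma GI.smul {F : FunRT} (hF : GI F) (c : ℂ) : GI (c • F) := by
  refine ⟨fun p => (hF.int p).smul c, fun p => ?_⟩
  have : ftx ((c • F) p) = fun ξ => c * ftx (F p) ξ := by
    ext ξ; exact ftx_const_mul _ _ _
  rw [this]; exact (hF.fint p).const_mul c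

lemma GI.add {F G : FunRT} (hF : GI F) (hG : GI G) : GI (F + G) := by
  rw [show F + G = F - (-1 : ℂ) • G by rw [neg_one_smul, sub_neg_eq_add]]
  exact hF.sub (hG.smul _)

lemma expA_add (t : ℝ) {F G : FunRT} (hF : GI F) (hG : GI G) : expA t (F + G) = expA t F + expA t G := by
  rw [show F + G = F - (-1 : ℂ) • G by rw [neg_one_smul, sub_neg_eq_add], expA_sub t hF (hG.smul _), expA_smul,
    neg_one_smul, sub_neg_eq_add]

lemma tri_sub1 {U U' V W : FunRT} (hU : Nice U) (hU' : Nice U') (hV : Nice V) (hW : Nice W) :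
    tri (U - U') V W = tri U V W - tri U' V W := by
  unfold tri; rw [mulF_sub_left hU hU' hV, mulF_sub_left (hU.mul hV) (hU'.mul hV) hW]

lemma tri_sub2 {U V V' W : FunRT} (hU : Nice U) (hV : Nice V) (hV' : Nice V') (hW : Nice W) :
    tri U (V - V') W = tri U V W - tri U V' W := by
  unfold tri; rw [mulF_sub_right hU hV hV', mulF_sub_left (hU.mul hV) (hU.mul hV') hW]

lemma tri_sub3 {U V W W' : FunRT} (hU : Nice U) (hV : Nice V) (hW : Nice W) (hW' : Nice W') :
    tri U V (W - W') = tri U V W - tri U V W' := by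
  unfold tri; rw [mulF_sub_right (hU.mul hV) hW hW']

lemma tri_tel {U V W U' V' W' : FunRT} (hU : Nice U) (hV : Nice V) (hW : Nice W)
    (hU' : Nice U') (hV' : Nice V') (hW' : Nice W') :
    tri U' V' W' - tri U V W = tri (U' - U) V' W' + tri U (V' - V) W' + tri U V (W' - W) := by
  rw [tri_sub1 hU' hU hV' hW', tri_sub2 hU hV' hV hW', tri_sub3 hU hV hW' hW]
  abel

lemma L2sq_add3 {U V W : FunRT} (hU : Nice U) (hV : Nice V) :
    L2sq (U + V + W) ≤ 4 * (L2sq U + L2sq V + L2sq W) := by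
  refine (L2sq_add (hU.add hV).aesm).trans ?_
  calc _ ≤ 2 * (2 * (L2sq U + L2sq V) + 2 * L2sq W) :=
        mul_le_mul_right (add_le_add (L2sq_add hU.aesm) (le_mul_of_one_le_left zero_le (by norm_num))) _
    _ = _ := by ring

lemma tri_tel_L2 {U V W U' V' W' : FunRT} (hU : Nice U) (hV : Nice V) (hW : Nice W)
    (hU' : Nice U') (hV' : Nice V') (hW' : Nice W') :
    L2sq (tri U' V' W' - tri U V W) ≤ 4 * (L2sq (U' - U) * Aw V' ^ 2 * Aw W' ^ 2 +
      L2sq (V' - V) * Aw U ^ 2 * Aw W' ^ 2 + L2sq (W' - W) * Aw U ^ 2 * Aw V ^ 2) := by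
  rw [tri_tel hU hV hW hU' hV' hW']
  refine (L2sq_add3 ((hU'.sub hU).tri1 hV' hW') (hU.tri1 (hV'.sub hV) hW')).trans ?_
  exact mul_le_mul_right (add_le_add (add_le_add (tri_L2_1 (hU'.sub hU) hV') (tri_L2_2 hU (hV'.sub hV)))
    (tri_L2_3 (hW'.sub hW))) _

/-! #### Fatou -/

lemma L2sq_fatou {U : FunRT} {V : ℕ → FunRT} (hm : ∀ n p, Continuous (V n p))
    (hl : ∀ p x, Tendsto (fun n => V n p x) atTop (𝓝 (U p x))) :
    L2sq U ≤ liminf (fun n => L2sq (V n)) atTop := by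
  have h1 : ∀ p, ∫⁻ x, ‖U p x‖ₑ ^ 2 ≤ liminf (fun n => ∫⁻ x, ‖V n p x‖ₑ ^ 2) atTop := by
    intro p
    refine le_trans (lintegral_mono fun x => ?_)
      (lintegral_liminf_le fun n => ((hm n p).measurable.enorm.pow_const 2))
    have : Tendsto (fun n => ‖V n p x‖ₑ ^ 2) atTop (𝓝 (‖U p x‖ₑ ^ 2)) :=
      ((ENNReal.continuous_pow 2).tendsto _).comp ((hl p x).enorm)
    exact this.liminf_eq.ge
  simp only [L2sq_eq]
  simp only [← lintegral_count]
  refine (lintegral_mono h1).trans ?_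
  exact lintegral_liminf_le fun n => measurable_from_top

end NtProof

namespace NtProof
open scoped FourierTransform Topology

/-! #### The weight `x` on `Nt` -/

def et (n : ℕ) : ℝ := 1 / ((n : ℝ) + 1)

lemma et_pos (n : ℕ) : 0 < et n := by unfold et; positivity

lemma et_tendsto : Tendsto et atTop (𝓝 0) := tendsto_one_div_add_atTop_nhds_zero_nat

lemma quot_tendsto (U : FunRT) (p : ℤ) (x : ℝ) :
    Tendsto (fun n : ℕ => ((Complex.I * (et n : ℝ))⁻¹ • (modF (et n) U - U)) p x) atTop (𝓝 (xMul U p x)) := by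
  rw [tendsto_iff_norm_sub_tendsto_zero]
  have hlim : Tendsto (fun n : ℕ => et n * (2 * x ^ 2 * ‖U p x‖)) atTop (𝓝 0) := by
    simpa using et_tendsto.mul_const (2 * x ^ 2 * ‖U p x‖)
  refine squeeze_zero (fun n => norm_nonneg _) (fun n => ?_) hlim
  have h0 : (et n : ℂ) ≠ 0 := by exact_mod_cast (et_pos n).ne'
  have e : ((Complex.I * (et n : ℝ))⁻¹ • (modF (et n) U - U)) p x - xMul U p x =
      (Complex.I * (et n : ℝ))⁻¹ * ((Complex.exp (Complex.I * (et n * x : ℝ)) - 1 - Complex.I * (et n * x : ℝ)) * U p x) := by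
    simp only [Pi.smul_apply, Pi.sub_apply, smul_eq_mul, modF, xMul]
    have hI := Complex.I_ne_zero
    field_simp
    push_cast
    ring_nf
  have hn : ‖(Complex.I * (et n : ℝ))⁻¹‖ = (et n)⁻¹ := by
    rw [norm_inv, norm_mul, Complex.norm_I, one_mul, Complex.norm_real, Real.norm_of_nonneg (et_pos n).le]
  rw [e, norm_mul, hn, norm_mul]
  have := exp_two (et n * x)
  calc _ ≤ (et n)⁻¹ * (2 * (et n * x) ^ 2 * ‖U p x‖) :=
        mul_le_mul_of_nonneg_left (mul_le_mul_of_nonneg_right this (norm_nonneg _)) (inv_pos.2 (et_pos n)).le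
    _ = _ := by have := (et_pos n).ne'; field_simp

lemma modF_cont {U : FunRT} (h : ∀ p, Continuous (U p)) (η : ℝ) (p : ℤ) : Continuous (modF η U p) := by
  unfold modF
  have := h p
  fun_prop

lemma Nt_cont (t : ℝ) (F G H : FunRT) (p : ℤ) : Continuous (Nt t F G H p) := expA_cont _ _ p

lemma quot_cont {U : FunRT} (h : ∀ p, Continuous (U p)) (η : ℝ) (c : ℂ) (p : ℤ) :
    Continuous ((c • (modF η U - U)) p) :=
  ((modF_cont h η p).sub (h p)).const_smul c

lemma A2_mod (t η : ℝ) (F : FunRT) : A2 t (modF η F) = A2 t F := by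
  unfold A2; rw [expA_mod, Aw_gal]

lemma L2sq_conj (U : FunRT) : L2sq (conjF U) = L2sq U := by
  rw [← L2w_zero, ← L2w_zero, L2w_conj]

def Kx (t : ℝ) (F G H : FunRT) : ℝ≥0∞ :=
  4 * (L2sq (xMul F) * A2 t G * A2 t H + L2sq (xMul G) * A2 t F * A2 t H + L2sq (xMul H) * A2 t F * A2 t G)

lemma expA_mod_sub_L2 (t η : ℝ) {F : FunRT} (hF : Gd F) :
    L2sq (expA t (modF η F) - expA t F) ≤ ENNReal.ofReal (η ^ 2) * L2sq (xMul F) := by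
  rw [← expA_sub t (hF.mod η).gi hF.gi]
  exact (L2sq_expA_le t _).trans (mod_sub_L2 η F)

lemma Nt_mod_sub (t η : ℝ) {F G H : FunRT} (hF : Gd F) (hG : Gd G) (hH : Gd H) :
    L2sq (modF η (Nt t F G H) - Nt t F G H) ≤ ENNReal.ofReal (η ^ 2) * Kx t F G H := by
  rw [Nt_mod, Nt_eq, ← expA_sub (-t) (Qn_gi t (hF.mod η) (hG.mod η) (hH.mod η)) (Qn_gi t hF hG hH)]
  refine (L2sq_expA_le _ _).trans ?_
  unfold Qn
  refine (tri_tel_L2 (hF.nice t) (hG.nice t).conj (hH.nice t) ((hF.mod η).nice t) ((hG.mod η).nice t).conj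
    ((hH.mod η).nice t)).trans ?_
  rw [← conjF_sub, L2sq_conj, Aw_conj, Aw_conj]
  have e : ∀ F, Aw (expA t (modF η F)) ^ 2 = A2 t F := fun F => A2_mod t η F
  have e' : ∀ F, Aw (expA t F) ^ 2 = A2 t F := fun F => rfl
  simp only [e, e']
  calc _ ≤ 4 * (ENNReal.ofReal (η ^ 2) * L2sq (xMul F) * A2 t G * A2 t H +
        ENNReal.ofReal (η ^ 2) * L2sq (xMul G) * A2 t F * A2 t H +
        ENNReal.ofReal (η ^ 2) * L2sq (xMul H) * A2 t F * A2 t G) :=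
        mul_le_mul_right (add_le_add (add_le_add
          (mul_le_mul' (mul_le_mul' (expA_mod_sub_L2 t η hF) le_rfl) le_rfl)
          (mul_le_mul' (mul_le_mul' (expA_mod_sub_L2 t η hG) le_rfl) le_rfl))
          (mul_le_mul' (mul_le_mul' (expA_mod_sub_L2 t η hH) le_rfl) le_rfl)) _
    _ = _ := by unfold Kx; ring

lemma enorm_et_inv (n : ℕ) : ‖(Complex.I * (et n : ℝ))⁻¹‖ₑ ^ 2 * ENNReal.ofReal (et n ^ 2) = 1 := by
  rw [← ofReal_norm, ← ENNReal.ofReal_pow (norm_nonneg _), ← ENNReal.ofReal_mul (by positivity), norm_inv,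
    norm_mul, Complex.norm_I, one_mul, Complex.norm_real, Real.norm_of_nonneg (et_pos n).le, ← mul_pow,
    inv_mul_cancel₀ (et_pos n).ne']
  simp

lemma xNt_L2 (t : ℝ) {F G H : FunRT} (hF : Gd F) (hG : Gd G) (hH : Gd H) :
    L2sq (xMul (Nt t F G H)) ≤ Kx t F G H := by
  refine (L2sq_fatou (fun n p => quot_cont (Nt_cont t F G H) (et n) _ p)
    (fun p x => quot_tendsto (Nt t F G H) p x)).trans ?_
  refine (liminf_le_liminf (v := fun _ => Kx t F G H) (Eventually.of_forall fun n => ?_)).trans (liminf_const _).le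
  rw [L2sq_smul]
  refine (mul_le_mul_right (Nt_mod_sub t (et n) hF hG hH) _).trans (le_of_eq ?_)
  rw [← mul_assoc, enorm_et_inv, one_mul]

/-! #### The product rule for `x` -/

lemma tri_rem {U V W U' V' W' X Y Z : FunRT} (hU : Nice U) (hV : Nice V) (hW : Nice W)
    (hU' : Nice U') (hV' : Nice V') (hW' : Nice W') (hX : Nice X) (hY : Nice Y) (hZ : Nice Z) :
    tri U' V' W' - tri U V W - (tri X V W + tri U Y W + tri U V Z) =
      (tri (U' - U - X) V' W' + tri X (V' - V) W' + tri X V (W' - W)) +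
      (tri U (V' - V - Y) W' + tri U Y (W' - W) + tri U V (W' - W - Z)) := by
  rw [tri_sub1 (hU'.sub hU) hX hV' hW', tri_sub1 hU' hU hV' hW', tri_sub2 hX hV' hV hW', tri_sub3 hX hV hW' hW,
    tri_sub2 hU (hV'.sub hV) hY hW', tri_sub2 hU hV' hV hW', tri_sub3 hU hY hW' hW,
    tri_sub3 hU hV (hW'.sub hW) hZ, tri_sub3 hU hV hW' hW]
  abel

lemma tri_rem_L2 {U V W U' V' W' X Y Z : FunRT} (hU : Nice U) (hV : Nice V) (hW : Nice W)
    (hU' : Nice U') (hV' : Nice V') (hW' : Nice W') (hX : Nice X) (hY : Nice Y) (hZ : Nice Z) :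
    L2sq (tri U' V' W' - tri U V W - (tri X V W + tri U Y W + tri U V Z)) ≤
      8 * ((L2sq (U' - U - X) * Aw V' ^ 2 * Aw W' ^ 2 + L2sq (V' - V) * Aw X ^ 2 * Aw W' ^ 2 +
        L2sq (W' - W) * Aw X ^ 2 * Aw V ^ 2) +
      (L2sq (V' - V - Y) * Aw U ^ 2 * Aw W' ^ 2 + L2sq (W' - W) * Aw U ^ 2 * Aw Y ^ 2 +
        L2sq (W' - W - Z) * Aw U ^ 2 * Aw V ^ 2)) := by
  rw [tri_rem hU hV hW hU' hV' hW' hX hY hZ]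
  have n1 := ((hU'.sub hU).sub hX).tri1 hV' hW'
  have n2 := hX.tri1 (hV'.sub hV) hW'
  have n3 := hX.tri1 hV (hW'.sub hW)
  have n4 := hU.tri1 ((hV'.sub hV).sub hY) hW'
  have n5 := hU.tri1 hY (hW'.sub hW)
  refine (L2sq_add ((n1.add n2).add n3).aesm).trans ?_
  calc _ ≤ 2 * (4 * _ + 4 * _) := mul_le_mul_right (add_le_add (L2sq_add3 n1 n2) (L2sq_add3 n4 n5)) _
    _ ≤ 2 * (4 * _ + 4 * _) := mul_le_mul_right (add_le_add
        (mul_le_mul_right (add3_le (tri_L2_1 ((hU'.sub hU).sub hX) hV') (tri_L2_2 hX (hV'.sub hV))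
          (tri_L2_3 (hW'.sub hW))) _)
        (mul_le_mul_right (add3_le (tri_L2_2 hU ((hV'.sub hV).sub hY)) (tri_L2_3 (hW'.sub hW))
          (tri_L2_3 ((hW'.sub hW).sub hZ))) _)) _
    _ = _ := by ring

def XX (t : ℝ) (F G H : FunRT) : FunRT :=
  Nt t (xMul F) G H - Nt t F (xMul G) H + Nt t F G (xMul H)

def Ky (t : ℝ) (F G H : FunRT) : ℝ≥0∞ :=
  8 * ((4 * L2sq (xMul (xMul F)) * A2 t G * A2 t H + L2sq (xMul G) * A2 t (xMul F) * A2 t H +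
        L2sq (xMul H) * A2 t (xMul F) * A2 t G) +
      (4 * L2sq (xMul (xMul G)) * A2 t F * A2 t H + L2sq (xMul H) * A2 t F * A2 t (xMul G) +
        4 * L2sq (xMul (xMul H)) * A2 t F * A2 t G))

lemma conjF_smul (c : ℂ) (U : FunRT) : conjF (c • U) = (starRingEnd ℂ c) • conjF U := by
  ext p x; simp [conjF]

lemma expA_mod_sub2_L2 (t η : ℝ) {F : FunRT} (hF : Gd F) (xF : Gd (xMul F)) :
    L2sq (expA t (modF η F) - expA t F - expA t ((Complex.I * η) • xMul F)) ≤
      ENNReal.ofReal (4 * η ^ 4) * L2sq (xMul (xMul F)) := by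
  rw [← expA_sub t (hF.mod η).gi hF.gi, ← expA_sub t ((hF.mod η).gi.sub hF.gi) (xF.gi.smul _)]
  exact (L2sq_expA_le t _).trans (mod_sub_L2' η F)

lemma A2_ne (t : ℝ) {F : FunRT} (hF : Gd F) : A2 t F ≠ ∞ := by
  have := (hF.nice t).aw
  unfold A2
  finiteness

lemma Ky_ne (t : ℝ) {F G H : FunRT} (hF : Gd F) (hG : Gd G) (hH : Gd H)
    (xF : Gd (xMul F)) (xG : Gd (xMul G)) (xH : Gd (xMul H)) : Ky t F G H ≠ ∞ := by
  have a1 := A2_ne t hF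
  have a2 := A2_ne t hG
  have a3 := A2_ne t hH
  have a4 := A2_ne t xF
  have a5 := A2_ne t xG
  have b1 := hF.hx
  have b2 := hG.hx
  have b3 := hH.hx
  have c1 := xF.hx
  have c2 := xG.hx
  have c3 := xH.hx
  unfold Ky
  finiteness

lemma enorm_Ieta (η : ℝ) : ‖Complex.I * (η : ℂ)‖ₑ ^ 2 = ENNReal.ofReal (η ^ 2) := by
  rw [← ofReal_norm, ← ENNReal.ofReal_pow (norm_nonneg _), norm_mul, Complex.norm_I, one_mul, Complex.norm_real,
    Real.norm_eq_abs, sq_abs]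

lemma Nt_rem (t η : ℝ) {F G H : FunRT} (hF : Gd F) (hG : Gd G) (hH : Gd H)
    (xF : Gd (xMul F)) (xG : Gd (xMul G)) (xH : Gd (xMul H)) :
    L2sq (modF η (Nt t F G H) - Nt t F G H - (Complex.I * η) • XX t F G H) ≤
      ENNReal.ofReal (η ^ 4) * Ky t F G H := by
  set c : ℂ := Complex.I * η with hc
  have g0 := Qn_gi t (hF.mod η) (hG.mod η) (hH.mod η)
  have g1 := Qn_gi t hF hG hH
  have g2 := Qn_gi t xF hG hH
  have g3 := Qn_gi t hF xG hH
  have g4 := Qn_gi t hF hG xH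
  have e1 : modF η (Nt t F G H) - Nt t F G H - c • XX t F G H =
      expA (-t) (Qn t (modF η F) (modF η G) (modF η H) - Qn t F G H -
        c • (Qn t (xMul F) G H - Qn t F (xMul G) H + Qn t F G (xMul H))) := by
    rw [expA_sub _ (g0.sub g1) (((g2.sub g3).add g4).smul c), expA_sub _ g0 g1, expA_smul,
      expA_add _ (g2.sub g3) g4, expA_sub _ g2 g3, Nt_mod]
    rfl
  have e2 : c • (Qn t (xMul F) G H - Qn t F (xMul G) H + Qn t F G (xMul H)) =
      tri (expA t (c • xMul F)) (conjF (expA t G)) (expA t H) +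
      tri (expA t F) (conjF (expA t (c • xMul G))) (expA t H) +
      tri (expA t F) (conjF (expA t G)) (expA t (c • xMul H)) := by
    have hcc : (starRingEnd ℂ) c = -c := by simp [hc]
    simp only [expA_smul, conjF_smul, hcc]
    unfold Qn tri
    simp only [mulF_smul_left, mulF_smul_right]
    rw [smul_add, smul_sub, neg_smul, sub_eq_add_neg]
  rw [e1, e2]
  refine (L2sq_expA_le _ _).trans ?_
  have nx : ∀ {F : FunRT}, Gd F → Nice (expA t (c • F)) := fun h => by
    rw [expA_smul]; exact (h.nice t).smul c
  refine (tri_rem_L2 (hF.nice t) (hG.nice t).conj (hH.nice t) ((hF.mod η).nice t) ((hG.mod η).nice t).conj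
    ((hH.mod η).nice t) (nx xF) (nx xG).conj (nx xH)).trans ?_
  rw [← conjF_sub, ← conjF_sub, L2sq_conj, L2sq_conj, Aw_conj, Aw_conj, Aw_conj]
  have e : ∀ F, Aw (expA t (modF η F)) ^ 2 = A2 t F := fun F => A2_mod t η F
  have e' : ∀ F, Aw (expA t F) ^ 2 = A2 t F := fun F => rfl
  have e'' : ∀ F, A2 t (c • F) = ENNReal.ofReal (η ^ 2) * A2 t F := fun F => by
    unfold A2
    rw [expA_smul, Aw_smul, mul_pow, hc, enorm_Ieta]
  simp only [e, e', e'']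
  have m2 : ∀ {F : FunRT}, Gd F → _ := fun {F} (h : Gd F) => expA_mod_sub_L2 t η h
  have m4 : ∀ {F : FunRT}, Gd F → Gd (xMul F) → _ := fun {F} (h : Gd F) h' => expA_mod_sub2_L2 t η h h'
  calc _ ≤ 8 * ((ENNReal.ofReal (4 * η ^ 4) * L2sq (xMul (xMul F)) * A2 t G * A2 t H +
        ENNReal.ofReal (η ^ 2) * L2sq (xMul G) * (ENNReal.ofReal (η ^ 2) * A2 t (xMul F)) * A2 t H +
        ENNReal.ofReal (η ^ 2) * L2sq (xMul H) * (ENNReal.ofReal (η ^ 2) * A2 t (xMul F)) * A2 t G) +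
      (ENNReal.ofReal (4 * η ^ 4) * L2sq (xMul (xMul G)) * A2 t F * A2 t H +
        ENNReal.ofReal (η ^ 2) * L2sq (xMul H) * A2 t F * (ENNReal.ofReal (η ^ 2) * A2 t (xMul G)) +
        ENNReal.ofReal (4 * η ^ 4) * L2sq (xMul (xMul H)) * A2 t F * A2 t G)) :=
        mul_le_mul_right (add_le_add
          (add3_le (mul_le_mul' (mul_le_mul' (m4 hF xF) le_rfl) le_rfl)
            (mul_le_mul' (mul_le_mul' (m2 hG) le_rfl) le_rfl)
            (mul_le_mul' (mul_le_mul' (m2 hH) le_rfl) le_rfl))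
          (add3_le (mul_le_mul' (mul_le_mul' (m4 hG xG) le_rfl) le_rfl)
            (mul_le_mul' (mul_le_mul' (m2 hH) le_rfl) le_rfl)
            (mul_le_mul' (mul_le_mul' (m4 hH xH) le_rfl) le_rfl))) _
    _ = _ := by
        have h4 : ENNReal.ofReal (4 * η ^ 4) = 4 * ENNReal.ofReal (η ^ 2) ^ 2 := by
          rw [ENNReal.ofReal_mul (by norm_num), ← ENNReal.ofReal_pow (by positivity)]; simp [← pow_mul]
        have h5 : ENNReal.ofReal (η ^ 4) = ENNReal.ofReal (η ^ 2) ^ 2 := by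
          rw [← ENNReal.ofReal_pow (by positivity)]; simp [← pow_mul]
        rw [h4, h5]; unfold Ky; ring

lemma xNt_eq (t : ℝ) {F G H : FunRT} (hF : Gd F) (hG : Gd G) (hH : Gd H)
    (xF : Gd (xMul F)) (xG : Gd (xMul G)) (xH : Gd (xMul H)) (p : ℤ) :
    xMul (Nt t F G H) p =ᵐ[volume] XX t F G H p := by
  have hXc : ∀ p, Continuous (XX t F G H p) := fun p =>
    ((Nt_cont t _ _ _ p).sub (Nt_cont t _ _ _ p)).add (Nt_cont t _ _ _ p)
  have h0 : L2sq (xMul (Nt t F G H) - XX t F G H) = 0 := by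
    rw [← nonpos_iff_eq_zero]
    have hV := L2sq_fatou (U := xMul (Nt t F G H) - XX t F G H)
      (V := fun n => (Complex.I * (et n : ℝ))⁻¹ • (modF (et n) (Nt t F G H) - Nt t F G H) - XX t F G H)
      (fun n p => (quot_cont (Nt_cont t F G H) (et n) _ p).sub (hXc p))
      (fun p x => (quot_tendsto (Nt t F G H) p x).sub_const (XX t F G H p x))
    refine hV.trans ?_
    have hb : Tendsto (fun n => ENNReal.ofReal (et n ^ 2) * Ky t F G H) atTop (𝓝 0) := by
      have h1 : Tendsto (fun n => ENNReal.ofReal (et n ^ 2)) atTop (𝓝 0) := by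
        have := ENNReal.tendsto_ofReal (et_tendsto.pow 2)
        simpa using this
      have := ENNReal.Tendsto.mul_const (b := Ky t F G H) h1 (Or.inr (Ky_ne t hF hG hH xF xG xH))
      simpa using this
    rw [← hb.liminf_eq]
    refine liminf_le_liminf (Eventually.of_forall fun n => ?_)
    have hc : (Complex.I * (et n : ℝ)) ≠ 0 :=
      mul_ne_zero Complex.I_ne_zero (by exact_mod_cast (et_pos n).ne')
    rw [show (Complex.I * (et n : ℝ))⁻¹ • (modF (et n) (Nt t F G H) - Nt t F G H) - XX t F G H =
      (Complex.I * (et n : ℝ))⁻¹ • (modF (et n) (Nt t F G H) - Nt t F G H - (Complex.I * (et n : ℝ)) • XX t F G H) by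
        rw [smul_sub _ _ ((Complex.I * (et n : ℝ)) • XX t F G H), inv_smul_smul₀ hc], L2sq_smul]
    refine (mul_le_mul_right (Nt_rem t (et n) hF hG hH xF xG xH) _).trans (le_of_eq ?_)
    rw [show et n ^ 4 = et n ^ 2 * et n ^ 2 by ring, ENNReal.ofReal_mul (by positivity), ← mul_assoc, ← mul_assoc,
      enorm_et_inv, one_mul]
  rw [L2sq_eq, ENNReal.tsum_eq_zero] at h0
  have h1 := h0 p
  have hm : Measurable fun x => ‖(xMul (Nt t F G H) - XX t F G H) p x‖ₑ ^ 2 := by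
    have : Continuous ((xMul (Nt t F G H) - XX t F G H) p) := by
      have a := Nt_cont t F G H p
      have b : Continuous (xMul (Nt t F G H) p) := by unfold xMul; fun_prop
      exact b.sub (hXc p)
    exact this.measurable.enorm.pow_const 2
  rw [lintegral_eq_zero_iff hm] at h1
  filter_upwards [h1] with x hx
  simp only [Pi.zero_apply, ne_eq, OfNat.ofNat_ne_zero, not_false_eq_true, pow_eq_zero_iff, enorm_eq_zero,
    Pi.sub_apply, sub_eq_zero] at hx
  exact hx

end NtProof

namespace NtProof
open scoped FourierTransform Topology

/-! #### The `S` estimate -/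

lemma RS (N : ℕ) (hN : 2 ≤ N) : ∃ C : ℝ≥0∞, C ≠ ∞ ∧ ∀ (t : ℝ) (F G H : FunRT), Gd F → Gd G → Gd H →
    S2 N (Nt t F G H) ≤ C * del t ^ 2 * (S2 N F * S2 N G * S2 N H) := by
  obtain ⟨C, hC, h⟩ := R1 N hN
  refine ⟨C + 12, by finiteness, ?_⟩
  intro t F G H hF hG hH
  have hx : ∀ F, L2sq (xMul F) ≤ S2 N F := fun F => le_add_self
  have h1 : L2sq (xMul (Nt t F G H)) ≤ 12 * (del t ^ 2 * (S2 N F * S2 N G * S2 N H)) := by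
    refine (xNt_L2 t hF hG hH).trans ?_
    unfold Kx
    simp only [mul_assoc]
    calc _ ≤ 4 * (S2 N F * (del t ^ 2 * (S2 N G * S2 N H)) + S2 N G * (del t ^ 2 * (S2 N F * S2 N H)) +
          S2 N H * (del t ^ 2 * (S2 N F * S2 N G))) :=
          mul_le_mul_right (add3_le (mul_le_mul' (hx F) (A2A2 N hN t hG hH)) (mul_le_mul' (hx G) (A2A2 N hN t hF hH))
            (mul_le_mul' (hx H) (A2A2 N hN t hF hG))) _
      _ = _ := by ring
  have h2 : Hq N (Nt t F G H) ≤ C * del t ^ 2 * (S2 N F * S2 N G * S2 N H) := by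
    refine le_trans ?_ (h t F G H hF hG hH)
    rw [Nt_eq]; exact Wt_expA_le _ _ _
  calc S2 N (Nt t F G H) ≤ _ := add_le_add h2 h1
    _ = _ := by ring

lemma int_of_L2 {f : ℝ → ℂ} (hf : AEStronglyMeasurable f) (h1 : ∫⁻ x, ‖f x‖ₑ ^ 2 ≠ ∞)
    (h2 : ∫⁻ x : ℝ, ‖(x : ℂ) * f x‖ₑ ^ 2 ≠ ∞) : Integrable f := by
  apply int_of_weight hf
  have : ∀ x : ℝ, ENNReal.ofReal (1 + x ^ 2) * ‖f x‖ₑ ^ 2 = ‖f x‖ₑ ^ 2 + ‖(x : ℂ) * f x‖ₑ ^ 2 := by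
    intro x
    rw [ENNReal.ofReal_add (by norm_num) (by positivity), add_mul, ENNReal.ofReal_one, one_mul, enorm_mul, mul_pow]
    congr 2
    rw [← ofReal_norm, ← ENNReal.ofReal_pow (norm_nonneg _), Complex.norm_real, Real.norm_eq_abs, sq_abs]
  simp only [this]
  rw [lintegral_add_left' (hf.enorm.pow_const 2)]
  exact ENNReal.add_ne_top.2 ⟨h1, h2⟩

lemma Nt_gd (t : ℝ) {F G H : FunRT} (hF : Gd F) (hG : Gd G) (hH : Gd H) : Gd (Nt t F G H) := by
  obtain ⟨C, hC, h⟩ := RS 2 le_rfl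
  have h1 : S2 2 (Nt t F G H) ≠ ∞ := by
    refine ne_top_of_le_ne_top ?_ (h t F G H hF hG hH)
    have a1 : S2 2 F ≠ ∞ := hF.lo
    have a2 : S2 2 G ≠ ∞ := hG.lo
    have a3 : S2 2 H ≠ ∞ := hH.lo
    have := del_ne t
    finiteness
  have hx : L2sq (xMul (Nt t F G H)) ≠ ∞ := ne_top_of_le_ne_top h1 le_add_self
  refine ⟨fun p => ?_, ne_top_of_le_ne_top h1 le_self_add, hx⟩
  refine int_of_L2 (Nt_cont t F G H p).aestronglyMeasurable ?_ (ENNReal.ne_top_of_tsum_ne_top hx p)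
  have : L2sq (Nt t F G H) ≠ ∞ := by
    rw [Nt_eq]
    exact ne_top_of_le_ne_top ((hF.nice t).tri1 (hG.nice t).conj (hH.nice t)).l2 (L2sq_expA_le _ _)
  exact ENNReal.ne_top_of_tsum_ne_top this p

lemma Hq_congr (N : ℕ) {F G : FunRT} (h : ∀ p, F p =ᵐ[volume] G p) : Hq N F = Hq N G := by
  unfold Hq
  congr 1; ext p
  rw [ftx_congr (h p)]

lemma L2sq_congr {F G : FunRT} (h : ∀ p, F p =ᵐ[volume] G p) : L2sq F = L2sq G := by
  rw [L2sq_eq, L2sq_eq]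
  congr 1; ext p
  refine lintegral_congr_ae ?_
  filter_upwards [h p] with x hx
  rw [hx]

lemma S2_congr (N : ℕ) {F G : FunRT} (h : ∀ p, F p =ᵐ[volume] G p) : S2 N F = S2 N G := by
  unfold S2
  rw [Hq_congr N h, L2sq_congr (F := xMul F) (G := xMul G)]
  intro p
  filter_upwards [h p] with x hx
  simp only [xMul, hx]

lemma enorm_sub_sq (a b : ℂ) : ‖a - b‖ₑ ^ 2 ≤ 2 * (‖a‖ₑ ^ 2 + ‖b‖ₑ ^ 2) :=
  (pow_le_pow_left₀ zero_le enorm_sub_le 2).trans (add_sq_le _ _)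

lemma Hq_sub (N : ℕ) {F G : FunRT} (hF : ∀ p, Integrable (F p)) (hG : ∀ p, Integrable (G p)) :
    Hq N (F - G) ≤ 2 * (Hq N F + Hq N G) := by
  rw [Hq_eq, Hq_eq, Hq_eq]
  unfold Wt
  rw [← ENNReal.tsum_add, ← ENNReal.tsum_mul_left]
  refine ENNReal.tsum_le_tsum fun p => ?_
  have hmm : Measurable fun ξ => wq N p ξ * ‖ftx (F p) ξ‖ₑ ^ 2 := (wq_meas N p).mul (meas_ftx (F p))
  rw [← lintegral_add_left hmm, ← lintegral_const_mul' _ _ (by finiteness)]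
  refine lintegral_mono fun ξ => ?_
  rw [show (F - G) p = fun x => F p x - G p x from rfl, ftx_sub (hF p) (hG p)]
  refine (mul_le_mul_right (enorm_sub_sq _ _) _).trans (le_of_eq ?_)
  ring

lemma S2_sub (N : ℕ) {F G : FunRT} (hF : ∀ p, Integrable (F p)) (hG : ∀ p, Integrable (G p)) :
    S2 N (F - G) ≤ 2 * (S2 N F + S2 N G) := by
  have e : xMul (F - G) = xMul F - xMul G := by
    ext p x; simp only [xMul, Pi.sub_apply]; ring
  unfold S2
  rw [e]
  refine (add_le_add (Hq_sub N hF hG) (L2sq_sub (xMul_aesm fun p => (hF p).1))).trans (le_of_eq ?_)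
  ring

lemma S2_neg (N : ℕ) (F : FunRT) : S2 N (-F) = S2 N F := by
  unfold S2
  congr 1
  · unfold Hq
    congr 1; ext p
    refine lintegral_congr fun ξ => ?_
    rw [show (-F) p = fun x => (-1 : ℂ) * F p x by ext x; simp, ftx_const_mul, enorm_mul]
    simp
  · rw [L2sq_eq, L2sq_eq]
    simp [xMul]

lemma S2_sub_add (N : ℕ) {F G H : FunRT} (hF : ∀ p, Integrable (F p)) (hG : ∀ p, Integrable (G p))
    (hH : ∀ p, Integrable (H p)) : S2 N (F - G + H) ≤ 4 * (S2 N F + S2 N G + S2 N H) := by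
  rw [show F - G + H = (F - G) - (-H) by abel]
  refine (S2_sub (F := F - G) (G := -H) N (fun p => (hF p).sub (hG p)) (fun p => (hH p).neg)).trans ?_
  rw [S2_neg]
  calc _ ≤ 2 * (2 * (S2 N F + S2 N G) + 2 * S2 N H) :=
        mul_le_mul_right (add_le_add (S2_sub N hF hG) (le_mul_of_one_le_left zero_le (by norm_num))) _
    _ = _ := by ring

lemma RSx (N : ℕ) (hN : 2 ≤ N) : ∃ C : ℝ≥0∞, C ≠ ∞ ∧ ∀ (t : ℝ) (F G H : FunRT), Gd F → Gd G → Gd H →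
    Gd (xMul F) → Gd (xMul G) → Gd (xMul H) →
    S2 N (xMul (Nt t F G H)) ≤ C * del t ^ 2 * (S2 N (xMul F) * (S2 N G * S2 N H) +
      S2 N (xMul G) * (S2 N F * S2 N H) + S2 N (xMul H) * (S2 N F * S2 N G)) := by
  obtain ⟨C, hC, h⟩ := RS N hN
  refine ⟨4 * C, by finiteness, ?_⟩
  intro t F G H hF hG hH xF xG xH
  rw [S2_congr N (xNt_eq t hF hG hH xF xG xH)]
  unfold XX
  refine (S2_sub_add N (Nt_gd t xF hG hH).int (Nt_gd t hF xG hH).int (Nt_gd t hF hG xH).int).trans ?_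
  refine (mul_le_mul_right (add3_le (h t _ _ _ xF hG hH) (h t _ _ _ hF xG hH) (h t _ _ _ hF hG xH)) _).trans
    (le_of_eq ?_)
  ring

/-! #### The operator `opL` -/

lemma opL_Hq_le (N : ℕ) (F : FunRT) : Hq N (opL F) ≤ Wt (w8 N) F := by
  rw [Hq_eq]
  unfold Wt
  refine ENNReal.tsum_le_tsum fun p => lintegral_mono_ae ?_
  filter_upwards [ftx_iftx_le (fun ξ : ℝ => ((1 + ξ ^ 2 : ℝ) : ℂ) ^ 4 * ftx (F p) ξ)] with ξ hξ
  have h2 : ‖ftx (opL F p) ξ‖ₑ ≤ ‖((1 + ξ ^ 2 : ℝ) : ℂ) ^ 4 * ftx (F p) ξ‖ₑ := hξ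
  refine (mul_le_mul_right (pow_le_pow_left₀ zero_le h2 2) _).trans (le_of_eq ?_)
  unfold w8
  rw [enorm_mul, mul_pow, ← ofReal_norm, ← ENNReal.ofReal_pow (norm_nonneg _), norm_pow, Complex.norm_real,
    Real.norm_of_nonneg (by positivity), ← pow_mul]
  ring

lemma ftx_hasDeriv {f : ℝ → ℂ} (hf : Integrable f) (hx : Integrable fun x : ℝ => (x : ℂ) * f x) (ξ : ℝ) :
    HasDerivAt (ftx f) (-Complex.I * ftx (fun x : ℝ => (x : ℂ) * f x) ξ) ξ := by
  have hm : ∀ ξ : ℝ, Integrable fun x : ℝ => Complex.exp (-(Complex.I * x * ξ)) * f x := fun ξ =>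
    hf.bdd_mul (c := 1) (by fun_prop) (Eventually.of_forall fun x => (norm_ph3' x ξ).le)
  have := hasDerivAt_integral_of_dominated_loc_of_deriv_le (μ := volume) (𝕜 := ℝ) (s := Set.univ)
    (F := fun (ξ : ℝ) (x : ℝ) => Complex.exp (-(Complex.I * x * ξ)) * f x)
    (F' := fun (ξ : ℝ) (x : ℝ) => -Complex.I * (Complex.exp (-(Complex.I * x * ξ)) * ((x : ℂ) * f x)))
    (x₀ := ξ) (bound := fun x : ℝ => ‖(x : ℂ) * f x‖) univ_mem
    (Eventually.of_forall fun ξ => (hm ξ).1) (hm ξ) ?_ ?_ hx.norm ?_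
  · have e : -Complex.I * ftx (fun x : ℝ => (x : ℂ) * f x) ξ =
        ∫ x : ℝ, -Complex.I * (Complex.exp (-(Complex.I * x * ξ)) * ((x : ℂ) * f x)) := by
      rw [integral_const_mul]; rfl
    rw [e]; exact this.2
  · exact (((hx.bdd_mul (c := 1) (by fun_prop)
      (Eventually.of_forall fun x => (norm_ph3' x ξ).le))).const_mul _).1
  · refine Eventually.of_forall fun x η _ => ?_
    rw [norm_mul, norm_neg, Complex.norm_I, one_mul, norm_mul, norm_ph3', one_mul]
  · refine Eventually.of_forall fun x η _ => ?_
    have h1 : HasDerivAt (fun η : ℝ => -(Complex.I * x * (η : ℂ))) (-(Complex.I * x * 1)) η :=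
      ((Complex.ofRealCLM.hasDerivAt (x := η)).const_mul (Complex.I * x)).neg
    have e : -Complex.I * (Complex.exp (-(Complex.I * x * η)) * ((x : ℂ) * f x)) =
        Complex.exp (-(Complex.I * x * η)) * (-(Complex.I * x * 1)) * f x := by ring
    rw [e]
    exact (h1.cexp).mul_const (f x)

end NtProof

namespace NtProof
open scoped FourierTransform Topology

/-! #### The operator `(1 - ∂_xx)^4` and the weight `x` -/

lemma kc_bd {k : ℝ → ℂ} {K : ℝ} (hb : ∀ ξ, ‖k ξ‖ ≤ K * (1 + ξ ^ 2) ^ 4) (z : ℂ) (ξ : ℝ) :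
    ‖k ξ * z‖ₑ ^ 2 ≤ ENNReal.ofReal (K ^ 2) * (ENNReal.ofReal ((1 + ξ ^ 2) ^ 8) * ‖z‖ₑ ^ 2) := by
  rw [enorm_mul, mul_pow, ← mul_assoc]
  refine mul_le_mul_left ?_ _
  rw [← ofReal_norm, ← ENNReal.ofReal_pow (norm_nonneg _), ← ENNReal.ofReal_mul (by positivity)]
  apply ENNReal.ofReal_le_ofReal
  calc ‖k ξ‖ ^ 2 ≤ (K * (1 + ξ ^ 2) ^ 4) ^ 2 := pow_le_pow_left₀ (norm_nonneg _) (hb ξ) 2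
    _ = _ := by ring

lemma int_kc {k c : ℝ → ℂ} (hk : Continuous k) (hc : Continuous c) {K : ℝ}
    (hb : ∀ ξ, ‖k ξ‖ ≤ K * (1 + ξ ^ 2) ^ 4)
    (h : ∫⁻ ξ : ℝ, ENNReal.ofReal ((1 + ξ ^ 2) ^ 9) * ‖c ξ‖ₑ ^ 2 ≠ ∞) :
    Integrable fun ξ => k ξ * c ξ := by
  apply int_of_weight (hk.mul hc).aestronglyMeasurable
  refine ne_top_of_le_ne_top (ENNReal.mul_ne_top (ENNReal.ofReal_ne_top (r := K ^ 2)) h) ?_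
  rw [← lintegral_const_mul' _ _ ENNReal.ofReal_ne_top]
  refine lintegral_mono fun ξ => ?_
  refine (mul_le_mul_right (kc_bd hb (c ξ) ξ) _).trans (le_of_eq ?_)
  rw [show (1 + ξ ^ 2 : ℝ) ^ 9 = (1 + ξ ^ 2) * (1 + ξ ^ 2) ^ 8 by ring,
    ENNReal.ofReal_mul (by positivity)]
  ring

/-- The symbol of `(1 - ∂_xx)^4`. -/
def k4 (ξ : ℝ) : ℂ := ((1 + ξ ^ 2 : ℝ) : ℂ) ^ 4
/-- The derivative of the symbol. -/
def k4d (ξ : ℝ) : ℂ := 8 * (ξ : ℂ) * ((1 + ξ ^ 2 : ℝ) : ℂ) ^ 3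

lemma k4_cont : Continuous k4 := by unfold k4; fun_prop
lemma k4d_cont : Continuous k4d := by unfold k4d; fun_prop
lemma k4_bd (ξ : ℝ) : ‖k4 ξ‖ ≤ 1 * (1 + ξ ^ 2) ^ 4 := by
  unfold k4
  rw [norm_pow, Complex.norm_real, Real.norm_eq_abs, abs_of_nonneg (by positivity), one_mul]
lemma k4d_bd (ξ : ℝ) : ‖k4d ξ‖ ≤ 4 * (1 + ξ ^ 2) ^ 4 := by
  unfold k4d
  rw [norm_mul, norm_mul, norm_pow, Complex.norm_real, Complex.norm_real, Real.norm_eq_abs, Real.norm_eq_abs,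
    abs_of_nonneg (show 0 ≤ 1 + ξ ^ 2 by positivity)]
  have h8 : ‖(8 : ℂ)‖ = 8 := by simp
  rw [h8]
  have h1 : 2 * |ξ| ≤ 1 + ξ ^ 2 := by nlinarith [sq_nonneg (|ξ| - 1), sq_abs ξ]
  have h2 : 0 ≤ (1 + ξ ^ 2) ^ 3 := by positivity
  nlinarith [mul_le_mul_of_nonneg_right h1 h2]

lemma k4_deriv (ξ : ℝ) : HasDerivAt k4 (k4d ξ) ξ := by
  have h0 : HasDerivAt (fun ξ : ℝ => (1 + ξ ^ 2 : ℝ)) (2 * ξ) ξ := by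
    have := (hasDerivAt_pow 2 ξ).const_add 1
    have e : (2 * ξ : ℝ) = ((2 : ℕ) : ℝ) * ξ ^ (2 - 1) := by norm_num
    rw [e]; exact this
  have h1 := h0.ofReal_comp
  have h2 := h1.pow 4
  have e : k4d ξ = ((4 : ℕ) : ℂ) * ((1 + ξ ^ 2 : ℝ) : ℂ) ^ (4 - 1) * ((2 * ξ : ℝ) : ℂ) := by
    unfold k4d; push_cast; ring
  rw [e]; exact h2

lemma enorm_negI : ‖-Complex.I‖ₑ = 1 := by rw [← ofReal_norm]; simp

lemma opx {f : ℝ → ℂ} (hf : Integrable f) (hx : Integrable fun x : ℝ => (x : ℂ) * f x)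
    (h1 : ∫⁻ ξ : ℝ, ENNReal.ofReal ((1 + ξ ^ 2) ^ 9) * ‖ftx f ξ‖ₑ ^ 2 ≠ ∞)
    (h2 : ∫⁻ ξ : ℝ, ENNReal.ofReal ((1 + ξ ^ 2) ^ 9) * ‖ftx (fun x : ℝ => (x : ℂ) * f x) ξ‖ₑ ^ 2 ≠ ∞) (x : ℝ) :
    ‖(x : ℂ) * iftx (fun ξ => k4 ξ * ftx f ξ) x‖ₑ =
      ‖iftx (fun ξ => k4d ξ * ftx f ξ + k4 ξ * (-Complex.I * ftx (fun x : ℝ => (x : ℂ) * f x) ξ)) x‖ₑ := by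
  have hu : ∀ ξ : ℝ, HasDerivAt (fun ξ : ℝ => Complex.exp (Complex.I * x * ξ))
      (Complex.exp (Complex.I * x * ξ) * (Complex.I * x)) ξ := by
    intro ξ
    have := ((Complex.ofRealCLM.hasDerivAt (x := ξ)).const_mul (Complex.I * x)).cexp
    simpa using this
  have hv : ∀ ξ : ℝ, HasDerivAt (fun ξ : ℝ => k4 ξ * ftx f ξ)
      (k4d ξ * ftx f ξ + k4 ξ * (-Complex.I * ftx (fun x : ℝ => (x : ℂ) * f x) ξ)) ξ := fun ξ =>
    (k4_deriv ξ).mul (ftx_hasDeriv hf hx ξ)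
  have hE : ∀ {g : ℝ → ℂ}, Integrable g → Integrable fun ξ : ℝ => Complex.exp (Complex.I * x * ξ) * g ξ := fun hg =>
    hg.bdd_mul (c := 1) (by fun_prop) (Eventually.of_forall fun ξ => (norm_ph3 x ξ).le)
  have i1 : Integrable fun ξ => k4 ξ * ftx f ξ := int_kc k4_cont (ftx_cont _) k4_bd h1
  have i2 : Integrable fun ξ => k4d ξ * ftx f ξ := int_kc k4d_cont (ftx_cont _) k4d_bd h1
  have i3 : Integrable fun ξ => k4 ξ * (-Complex.I * ftx (fun x : ℝ => (x : ℂ) * f x) ξ) := by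
    have := (int_kc k4_cont (ftx_cont _) k4_bd h2).const_mul (-Complex.I)
    refine this.congr (Eventually.of_forall fun ξ => ?_)
    ring
  have i4 := i2.add i3
  have key := integral_mul_deriv_eq_deriv_mul_of_integrable (fun ξ _ => hu ξ) (fun ξ _ => hv ξ) (hE i4)
    (((hE i1).const_mul (Complex.I * x)).congr (Eventually.of_forall fun ξ => by
      simp only [Pi.mul_apply]; ring)) (hE i1)
  have key2 : (∫ ξ : ℝ, Complex.exp (Complex.I * x * ξ) * (Complex.I * x) * (k4 ξ * ftx f ξ)) =
      (Complex.I * x) * ∫ ξ : ℝ, Complex.exp (Complex.I * x * ξ) * (k4 ξ * ftx f ξ) := by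
    rw [← integral_const_mul]
    congr 1; ext ξ; ring
  unfold iftx
  rw [key, key2, show ∀ a b c : ℂ, a * -(Complex.I * b * c) = -Complex.I * (b * (a * c)) by intros; ring,
    enorm_mul (-Complex.I), enorm_negI, one_mul]

lemma Hq_p {N : ℕ} (hN : 9 ≤ N) {F : FunRT} (h : Hq N F ≠ ∞) (p : ℤ) :
    ∫⁻ ξ : ℝ, ENNReal.ofReal ((1 + ξ ^ 2) ^ 9) * ‖ftx (F p) ξ‖ₑ ^ 2 ≠ ∞ := by
  refine ne_top_of_le_ne_top (ENNReal.ne_top_of_tsum_ne_top h p) ?_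
  refine lintegral_mono fun ξ => mul_le_mul_left (ENNReal.ofReal_le_ofReal ?_) _
  have a : (1 + ξ ^ 2 : ℝ) ≤ 1 + ξ ^ 2 + (p : ℝ) ^ 2 := by nlinarith [sq_nonneg (p : ℝ)]
  have b : (1 : ℝ) ≤ 1 + ξ ^ 2 + (p : ℝ) ^ 2 := by nlinarith [sq_nonneg (p : ℝ), sq_nonneg ξ]
  exact (pow_le_pow_left₀ (by positivity) a 9).trans (pow_le_pow_right₀ b hN)

lemma w9_le {N : ℕ} (hN : 9 ≤ N) (p : ℤ) (ξ : ℝ) :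
    ENNReal.ofReal ((1 + ξ ^ 2) ^ 8) ≤ ENNReal.ofReal ((1 + ξ ^ 2 + (p : ℝ) ^ 2) ^ N) := by
  apply ENNReal.ofReal_le_ofReal
  have a : (1 + ξ ^ 2 : ℝ) ≤ 1 + ξ ^ 2 + (p : ℝ) ^ 2 := by nlinarith [sq_nonneg (p : ℝ)]
  have b : (1 : ℝ) ≤ 1 + ξ ^ 2 + (p : ℝ) ^ 2 := by nlinarith [sq_nonneg (p : ℝ), sq_nonneg ξ]
  exact (pow_le_pow_left₀ (by positivity) a 8).trans (pow_le_pow_right₀ b (by omega))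

lemma two_pi_inv_le : ENNReal.ofReal (2 * Real.pi)⁻¹ ≤ 1 := by
  rw [← ENNReal.ofReal_one]
  apply ENNReal.ofReal_le_ofReal
  apply inv_le_one_of_one_le₀
  nlinarith [Real.pi_gt_three]

lemma opL_x (N : ℕ) (hN : 9 ≤ N) {F : FunRT} (hF : ∀ p, Integrable (F p)) (hx : ∀ p, Integrable (xMul F p))
    (h1 : Hq N F ≠ ∞) (h2 : Hq N (xMul F) ≠ ∞) :
    L2sq (xMul (opL F)) ≤ 32 * (Hq N F + Hq N (xMul F)) := by
  have e : L2sq (xMul (opL F)) = ∑' p : ℤ, ∫⁻ x : ℝ, ‖iftx (fun ξ => k4d ξ * ftx (F p) ξ +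
      k4 ξ * (-Complex.I * ftx (fun x : ℝ => (x : ℂ) * F p x) ξ)) x‖ₑ ^ 2 := by
    refine tsum_congr fun p => lintegral_congr fun x => ?_
    rw [← opx (hF p) (hx p) (Hq_p hN h1 p) (Hq_p hN h2 p) x]
    rfl
  rw [e, Hq_eq, Hq_eq]
  unfold Wt
  rw [← ENNReal.tsum_add, ← ENNReal.tsum_mul_left]
  refine ENNReal.tsum_le_tsum fun p => (iftx_L2_le _).trans ?_
  refine (mul_le_mul_left two_pi_inv_le _).trans ?_
  have hmm : Measurable fun ξ : ℝ => wq N p ξ * ‖ftx (F p) ξ‖ₑ ^ 2 := (wq_meas N p).mul (meas_ftx _)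
  rw [one_mul, ← lintegral_add_left hmm, ← lintegral_const_mul' _ _ (by finiteness)]
  refine lintegral_mono fun ξ => ?_
  refine (pow_le_pow_left₀ zero_le (enorm_add_le _ _) 2).trans ((add_sq_le _ _).trans ?_)
  have b1 := kc_bd k4d_bd (ftx (F p) ξ) ξ
  have b2 := kc_bd k4_bd (-Complex.I * ftx (fun x : ℝ => (x : ℂ) * F p x) ξ) ξ
  have c1 := w9_le hN p ξ
  have e16 : ENNReal.ofReal (4 ^ 2) = 16 := by norm_num
  have e1 : ENNReal.ofReal (1 ^ 2) ≤ 16 := by norm_num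
  have e3 : ‖-Complex.I * ftx (fun x : ℝ => (x : ℂ) * F p x) ξ‖ₑ = ‖ftx (xMul F p) ξ‖ₑ := by
    rw [enorm_mul, enorm_negI, one_mul]; rfl
  rw [e16] at b1
  rw [e3] at b2
  refine (mul_le_mul_right (add_le_add (b1.trans (mul_le_mul_right (mul_le_mul_left c1 _) _))
    (b2.trans (mul_le_mul' e1 (mul_le_mul_left c1 _)))) _).trans (le_of_eq ?_)
  unfold wq
  ring

lemma Wt_le_opL (N : ℕ) (hN : 9 ≤ N) {F : FunRT} (hF : ∀ p, Integrable (F p)) (hx : ∀ p, Integrable (xMul F p))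
    (h1 : Hq N F ≠ ∞) (h2 : Hq N (xMul F) ≠ ∞) : Wt (w8 N) F ≤ Hq N (opL F) := by
  have hX : L2sq (xMul (opL F)) ≠ ∞ := ne_top_of_le_ne_top (by finiteness) (opL_x N hN hF hx h1 h2)
  rw [Hq_eq]
  unfold Wt
  refine ENNReal.tsum_le_tsum fun p => lintegral_mono_ae ?_
  have i1 : Integrable fun ξ => k4 ξ * ftx (F p) ξ := int_kc k4_cont (ftx_cont _) k4_bd (Hq_p hN h1 p)
  have hL : ∫⁻ x, ‖opL F p x‖ₑ ^ 2 ≠ ∞ := by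
    refine ne_top_of_le_ne_top (ENNReal.mul_ne_top (by finiteness) ?_) (iftx_L2_le _)
    refine ne_top_of_le_ne_top (ENNReal.mul_ne_top (ENNReal.ofReal_ne_top (r := 1 ^ 2)) (Hq_p hN h1 p)) ?_
    rw [← lintegral_const_mul' _ _ ENNReal.ofReal_ne_top]
    refine lintegral_mono fun ξ => ?_
    refine (kc_bd k4_bd (ftx (F p) ξ) ξ).trans ?_
    refine mul_le_mul_right (mul_le_mul_left (ENNReal.ofReal_le_ofReal ?_) _) _
    exact pow_le_pow_right₀ (by nlinarith [sq_nonneg ξ]) (by norm_num)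
  have i2 : Integrable (opL F p) := by
    refine int_of_L2 (iftx_cont _).aestronglyMeasurable hL ?_
    exact ENNReal.ne_top_of_tsum_ne_top hX p
  filter_upwards [ftx_iftx i1 i2] with ξ hξ
  have h2 : ftx (opL F p) ξ = ((1 + ξ ^ 2 : ℝ) : ℂ) ^ 4 * ftx (F p) ξ := hξ
  rw [h2]
  unfold w8
  rw [enorm_mul, mul_pow, ← ofReal_norm (((1 + ξ ^ 2 : ℝ) : ℂ) ^ 4), ← ENNReal.ofReal_pow (norm_nonneg _), norm_pow,
    Complex.norm_real, Real.norm_eq_abs, abs_of_nonneg (show 0 ≤ 1 + ξ ^ 2 by positivity), ← pow_mul]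
  refine le_of_eq ?_
  ring

end NtProof

namespace NtProof
open scoped FourierTransform Topology

/-! #### The `S⁺` estimate -/

def SP (N : ℕ) (F : FunRT) : ℝ≥0∞ := S2 N F + S2 N (opL F) + S2 N (xMul F)

def SPX (N : ℕ) (F G H : FunRT) : ℝ≥0∞ :=
  SP N F * (S2 N G * S2 N H) + SP N G * (S2 N F * S2 N H) + SP N H * (S2 N F * S2 N G)

/-- Inputs with finite `S⁺`-type norms. -/
structure Gp (N : ℕ) (F : FunRT) : Prop where
  g : Gd F
  gx : Gd (xMul F)
  s : S2 N F ≠ ∞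
  sx : S2 N (xMul F) ≠ ∞

lemma P2_le_SP {N : ℕ} (hN : 9 ≤ N) {F : FunRT} (h : Gp N F) : P2 N F ≤ SP N F := by
  have := Wt_le_opL N hN h.g.int h.gx.int (ne_top_of_le_ne_top h.s le_self_add)
    (ne_top_of_le_ne_top h.sx le_self_add)
  unfold P2 SP
  calc _ ≤ S2 N (opL F) + S2 N (xMul F) + S2 N F :=
        add3_le (this.trans le_self_add) le_self_add le_rfl
    _ = _ := by ring

lemma RP (N : ℕ) (hN : 10 ≤ N) : ∃ C : ℝ≥0∞, C ≠ ∞ ∧ ∀ (t : ℝ) (F G H : FunRT), Gp N F → Gp N G → Gp N H →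
    SP N (Nt t F G H) ≤ C * del t ^ 2 * SPX N F G H := by
  obtain ⟨C1, h1, H1⟩ := RS N (by omega)
  obtain ⟨C2, h2, H2⟩ := RSx N (by omega)
  obtain ⟨C3, h3, H3⟩ := R2 N hN
  refine ⟨33 * C1 + 33 * C2 + C3, by finiteness, ?_⟩
  intro t F G H hF hG hH
  have a1 := H1 t F G H hF.g hG.g hH.g
  have a2 := H2 t F G H hF.g hG.g hH.g hF.gx hG.gx hH.gx
  have a3 := H3 t F G H hF.g hG.g hH.g hF.gx hG.gx hH.gx
  have := del_ne t
  have f1 := hF.s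
  have f2 := hG.s
  have f3 := hH.s
  have f4 := hF.sx
  have f5 := hG.sx
  have f6 := hH.sx
  have n1 : S2 N (Nt t F G H) ≠ ∞ := ne_top_of_le_ne_top (by finiteness) a1
  have n2 : S2 N (xMul (Nt t F G H)) ≠ ∞ := ne_top_of_le_ne_top (by finiteness) a2
  have q1 : ∀ F, S2 N F ≤ SP N F := fun F => le_self_add.trans le_self_add
  have q2 : ∀ F, S2 N (xMul F) ≤ SP N F := fun F => le_add_self
  have b1 : S2 N (Nt t F G H) ≤ C1 * del t ^ 2 * SPX N F G H := by
    refine a1.trans (mul_le_mul_right ?_ _)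
    rw [mul_assoc]
    exact (mul_le_mul_left (q1 F) _).trans (le_self_add.trans le_self_add)
  have b2 : S2 N (xMul (Nt t F G H)) ≤ C2 * del t ^ 2 * SPX N F G H :=
    a2.trans (mul_le_mul_right (add3_le (mul_le_mul_left (q2 F) _) (mul_le_mul_left (q2 G) _)
      (mul_le_mul_left (q2 H) _)) _)
  have b3 : Hq N (opL (Nt t F G H)) ≤ C3 * del t ^ 2 * SPX N F G H := by
    refine (opL_Hq_le N _).trans ((Wt_expA_le (-t) _ (Qn t F G H)).trans (a3.trans ?_))
    exact mul_le_mul_right (add3_le (mul_le_mul_left (P2_le_SP (by omega) hF) _)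
      (mul_le_mul_left (P2_le_SP (by omega) hG) _) (mul_le_mul_left (P2_le_SP (by omega) hH) _)) _
  have hxi : ∀ p, Integrable (xMul (Nt t F G H) p) := fun p =>
    ((((Nt_gd t hF.gx hG.g hH.g).int p).sub ((Nt_gd t hF.g hG.gx hH.g).int p)).add
      ((Nt_gd t hF.g hG.g hH.gx).int p)).congr (xNt_eq t hF.g hG.g hH.g hF.gx hG.gx hH.gx p).symm
  have b4 := opL_x N (by omega) (Nt_gd t hF.g hG.g hH.g).int hxi
    (ne_top_of_le_ne_top n1 le_self_add) (ne_top_of_le_ne_top n2 le_self_add)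
  have b5 : L2sq (xMul (opL (Nt t F G H))) ≤ 32 * (C1 * del t ^ 2 * SPX N F G H + C2 * del t ^ 2 * SPX N F G H) :=
    b4.trans (mul_le_mul_right (add_le_add (le_self_add.trans b1) (le_self_add.trans b2)) _)
  have b6 : S2 N (opL (Nt t F G H)) ≤ C3 * del t ^ 2 * SPX N F G H +
      32 * (C1 * del t ^ 2 * SPX N F G H + C2 * del t ^ 2 * SPX N F G H) := add_le_add b3 b5
  refine (add3_le b1 b6 b2).trans (le_of_eq ?_)
  ring

/-! #### Reduction to integrable inputs -/

open Classical in
/-- Replace the non-integrable Fourier coefficients by zero. -/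
def red (F : FunRT) : FunRT := fun p => if Integrable (F p) then F p else 0

lemma ftx_zero : ftx 0 = 0 := by ext ξ; simp [ftx]

lemma red_cases (F : FunRT) (p : ℤ) : (Integrable (F p) ∧ red F p = F p) ∨ (¬ Integrable (F p) ∧ red F p = 0) := by
  unfold red
  by_cases h : Integrable (F p)
  · left; exact ⟨h, if_pos h⟩
  · right; exact ⟨h, if_neg h⟩

lemma red_int (F : FunRT) (p : ℤ) : Integrable (red F p) := by
  rcases red_cases F p with ⟨h, e⟩ | ⟨h, e⟩ <;> rw [e]
  · exact h
  · exact integrable_zero _ _ _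

lemma red_ftx (F : FunRT) (p : ℤ) : ftx (red F p) = ftx (F p) := by
  rcases red_cases F p with ⟨h, e⟩ | ⟨h, e⟩ <;> rw [e]
  ext ξ; rw [ftx_nonint h, ftx_zero]; rfl

lemma red_opL (F : FunRT) : opL (red F) = opL F := by
  unfold opL; simp only [red_ftx]

lemma red_expA (t : ℝ) (F : FunRT) : expA t (red F) = expA t F := by
  unfold expA schro; simp only [red_ftx]

lemma red_Nt (t : ℝ) (F G H : FunRT) : Nt t (red F) (red G) (red H) = Nt t F G H := by
  unfold Nt; simp only [red_expA]

lemma red_Hq (N : ℕ) (F : FunRT) : Hq N (red F) = Hq N F := by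
  unfold Hq; simp only [red_ftx]

lemma xMul_red (F : FunRT) (p : ℤ) : xMul (red F) p = xMul F p ∨ xMul (red F) p = 0 := by
  rcases red_cases F p with ⟨h, e⟩ | ⟨h, e⟩
  · left; unfold xMul; rw [e]
  · right; unfold xMul; rw [e]; ext x; simp

lemma xxMul_red (F : FunRT) (p : ℤ) : xMul (xMul (red F)) p = xMul (xMul F) p ∨ xMul (xMul (red F)) p = 0 := by
  rcases xMul_red F p with e | e
  · left; ext x; exact congrArg (fun z => (x : ℂ) * z) (congrFun e x)
  · right; ext x
    have : xMul (xMul (red F)) p x = (x : ℂ) * 0 := congrArg (fun z => (x : ℂ) * z) (congrFun e x)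
    rw [this, mul_zero]; rfl

lemma L2_red {F G : FunRT} (h : ∀ p, F p = G p ∨ F p = 0) : L2sq F ≤ L2sq G := by
  rw [L2sq_eq, L2sq_eq]
  refine ENNReal.tsum_le_tsum fun p => ?_
  rcases h p with e | e <;> rw [e]
  simp

lemma Hq_red (N : ℕ) {F G : FunRT} (h : ∀ p, F p = G p ∨ F p = 0) : Hq N F ≤ Hq N G := by
  unfold Hq
  refine ENNReal.tsum_le_tsum fun p => ?_
  rcases h p with e | e <;> rw [e]
  rw [ftx_zero]; simp

lemma S2_red (N : ℕ) (F : FunRT) : S2 N (red F) ≤ S2 N F := by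
  unfold S2
  rw [red_Hq]
  exact add_le_add le_rfl (L2_red (xMul_red F))

lemma S2x_red (N : ℕ) (F : FunRT) : S2 N (xMul (red F)) ≤ S2 N (xMul F) :=
  add_le_add (Hq_red N (xMul_red F)) (L2_red (xxMul_red F))

lemma SP_red (N : ℕ) (F : FunRT) : SP N (red F) ≤ SP N F := by
  unfold SP
  rw [red_opL]
  exact add3_le (S2_red N F) le_rfl (S2x_red N F)

lemma gd_red {N : ℕ} (hN : 2 ≤ N) {F : FunRT} (h : S2 N F ≠ ∞) : Gd (red F) := by
  have h' := ne_top_of_le_ne_top h (S2_red N F)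
  exact ⟨red_int F, ne_top_of_le_ne_top h' ((Hq_mono _ hN).trans le_self_add), ne_top_of_le_ne_top h' le_add_self⟩

lemma gp_red {N : ℕ} (hN : 2 ≤ N) {F : FunRT} (h : SP N F ≠ ∞) : Gp N (red F) := by
  have h' := ne_top_of_le_ne_top h (SP_red N F)
  have h1 : S2 N (red F) ≠ ∞ := ne_top_of_le_ne_top h' (le_self_add.trans le_self_add)
  have h2 : S2 N (xMul (red F)) ≠ ∞ := ne_top_of_le_ne_top h' le_add_self
  have h3 : L2sq (xMul (red F)) ≠ ∞ := ne_top_of_le_ne_top h1 le_add_self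
  have h4 : L2sq (xMul (xMul (red F))) ≠ ∞ := ne_top_of_le_ne_top h2 le_add_self
  refine ⟨gd_red hN (ne_top_of_le_ne_top h (le_self_add.trans le_self_add)), ⟨fun p => ?_, ?_, h4⟩, h1, h2⟩
  · refine int_of_L2 ?_ (ENNReal.ne_top_of_tsum_ne_top h3 p) (ENNReal.ne_top_of_tsum_ne_top h4 p)
    exact (Complex.continuous_ofReal.aestronglyMeasurable).mul (red_int F p).1
  · exact ne_top_of_le_ne_top h2 ((Hq_mono _ hN).trans le_self_add)

/-! #### Vanishing norms -/

lemma Hq_zero {N : ℕ} {F : FunRT} (h : Hq N F = 0) (p : ℤ) : ftx (F p) = 0 := by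
  unfold Hq at h
  rw [ENNReal.tsum_eq_zero] at h
  have h1 := h p
  have hm : Measurable fun ξ : ℝ => wq N p ξ * ‖ftx (F p) ξ‖ₑ ^ 2 := (wq_meas N p).mul (meas_ftx _)
  have h2 := (lintegral_eq_zero_iff hm).1 h1
  refine (Continuous.ae_eq_iff_eq volume (ftx_cont _) continuous_zero).1 ?_
  filter_upwards [h2] with ξ hξ
  have h3 : wq N p ξ * ‖ftx (F p) ξ‖ₑ ^ 2 = 0 := hξ
  rcases mul_eq_zero.1 h3 with h4 | h4
  · exfalso
    unfold wq at h4
    rw [ENNReal.ofReal_eq_zero] at h4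
    have : (0 : ℝ) < (1 + ξ ^ 2 + (p : ℝ) ^ 2) ^ N := by positivity
    linarith
  · simpa using h4

lemma expA_zero {t : ℝ} {F : FunRT} (h : ∀ p, ftx (F p) = 0) : expA t F = 0 := by
  ext p x
  unfold expA schro iftx
  simp [h p]

lemma Nt_zero {N : ℕ} {t : ℝ} {F G H : FunRT} (h : S2 N F = 0 ∨ S2 N G = 0 ∨ S2 N H = 0) : Nt t F G H = 0 := by
  have hz : ∀ F : FunRT, S2 N F = 0 → expA t F = 0 := fun F hF =>
    expA_zero (Hq_zero (le_antisymm (le_self_add.trans hF.le) zero_le))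
  have hm : mulF (mulF (expA t F) (conjF (expA t G))) (expA t H) = 0 := by
    ext p x
    rcases h with h | h | h <;> rw [hz _ h] <;> simp [mulF, conjF]
  unfold Nt
  rw [hm]
  exact expA_zero fun p => ftx_zero

lemma S2_0 (N : ℕ) : S2 N 0 = 0 := by
  have hx : xMul 0 = 0 := by ext p x; simp [xMul]
  unfold S2
  rw [hx, L2sq_eq]
  unfold Hq
  simp [ftx_zero]

lemma SP_0 (N : ℕ) : SP N 0 = 0 := by
  have hx : xMul 0 = 0 := by ext p x; simp [xMul]
  have ho : opL 0 = 0 := by ext p x; simp [opL, ftx_zero, iftx]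
  unfold SP
  rw [hx, ho, S2_0]; simp

/-! #### Unconditional squared estimates -/

lemma US (N : ℕ) (hN : 2 ≤ N) : ∃ C : ℝ≥0∞, C ≠ ∞ ∧ ∀ (t : ℝ) (F G H : FunRT),
    S2 N (Nt t F G H) ≤ C * del t ^ 2 * (S2 N F * S2 N G * S2 N H) := by
  obtain ⟨C, hC, h⟩ := RS N hN
  refine ⟨C + 1, by finiteness, fun t F G H => ?_⟩
  by_cases h0 : S2 N F = 0 ∨ S2 N G = 0 ∨ S2 N H = 0
  · rw [Nt_zero h0, S2_0]; exact zero_le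
  push Not at h0
  obtain ⟨z1, z2, z3⟩ := h0
  have zC : (C + 1) * del t ^ 2 ≠ 0 := by
    refine mul_ne_zero (by simp) (pow_ne_zero _ ?_)
    unfold del
    rw [Ne, ENNReal.ofReal_eq_zero, not_le]
    have := CA_pos
    positivity
  by_cases hT : S2 N F = ∞ ∨ S2 N G = ∞ ∨ S2 N H = ∞
  · have : S2 N F * S2 N G * S2 N H = ∞ := by
      rcases hT with e | e | e <;> rw [e] <;> simp [ENNReal.top_mul, ENNReal.mul_top, *]
    rw [this, ENNReal.mul_top zC]; exact le_top
  push Not at hT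
  obtain ⟨y1, y2, y3⟩ := hT
  rw [← red_Nt]
  refine (h t _ _ _ (gd_red hN y1) (gd_red hN y2) (gd_red hN y3)).trans ?_
  exact mul_le_mul' (mul_le_mul_left le_self_add _)
    (mul_le_mul' (mul_le_mul' (S2_red N F) (S2_red N G)) (S2_red N H))

lemma UP (N : ℕ) (hN : 10 ≤ N) : ∃ C : ℝ≥0∞, C ≠ ∞ ∧ ∀ (t : ℝ) (F G H : FunRT),
    SP N (Nt t F G H) ≤ C * del t ^ 2 * SPX N F G H := by
  obtain ⟨C, hC, h⟩ := RP N hN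
  refine ⟨C + 1, by finiteness, fun t F G H => ?_⟩
  by_cases h0 : S2 N F = 0 ∨ S2 N G = 0 ∨ S2 N H = 0
  · rw [Nt_zero h0, SP_0]; exact zero_le
  push Not at h0
  obtain ⟨z1, z2, z3⟩ := h0
  have zC : (C + 1) * del t ^ 2 ≠ 0 := by
    refine mul_ne_zero (by simp) (pow_ne_zero _ ?_)
    unfold del
    rw [Ne, ENNReal.ofReal_eq_zero, not_le]
    have := CA_pos
    positivity
  by_cases hT : SP N F = ∞ ∨ SP N G = ∞ ∨ SP N H = ∞
  · have : SPX N F G H = ∞ := by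
      unfold SPX
      rcases hT with e | e | e <;> rw [e] <;> simp [ENNReal.top_mul, *]
    rw [this, ENNReal.mul_top zC]; exact le_top
  push Not at hT
  obtain ⟨y1, y2, y3⟩ := hT
  rw [← red_Nt]
  refine (h t _ _ _ (gp_red (by omega) y1) (gp_red (by omega) y2) (gp_red (by omega) y3)).trans ?_
  refine mul_le_mul' (mul_le_mul_left le_self_add _) (add3_le ?_ ?_ ?_)
  · exact mul_le_mul' (SP_red N F) (mul_le_mul' (S2_red N G) (S2_red N H))
  · exact mul_le_mul' (SP_red N G) (mul_le_mul' (S2_red N F) (S2_red N H))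
  · exact mul_le_mul' (SP_red N H) (mul_le_mul' (S2_red N F) (S2_red N G))

end NtProof

namespace NtProof
open scoped FourierTransform Topology

/-! #### From squares to norms -/

lemma HsNorm_sq (N : ℕ) (F : FunRT) : HsNorm N F ^ 2 = Hq N F := by
  unfold HsNorm
  rw [sq, half_mul_half]
  unfold Hq
  simp only [Real.rpow_natCast]
  rfl

lemma L2norm_sq (F : FunRT) : L2norm F ^ 2 = L2sq F := by
  unfold L2norm
  rw [sq, half_mul_half]

lemma sq_add_le (a b : ℝ≥0∞) : a ^ 2 + b ^ 2 ≤ (a + b) ^ 2 :=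
  calc a ^ 2 + b ^ 2 ≤ a ^ 2 + b ^ 2 + 2 * a * b := le_self_add
    _ = _ := by ring

lemma S2_le_sq (N : ℕ) (F : FunRT) : S2 N F ≤ Snorm N F ^ 2 := by
  unfold S2 Snorm
  rw [← HsNorm_sq, ← L2norm_sq]
  exact sq_add_le _ _

lemma Snorm_sq_le (N : ℕ) (F : FunRT) : Snorm N F ^ 2 ≤ 2 * S2 N F := by
  unfold S2 Snorm
  rw [← HsNorm_sq, ← L2norm_sq]
  exact add_sq_le _ _

lemma SP_le_sq (N : ℕ) (F : FunRT) : SP N F ≤ SplusNorm N F ^ 2 := by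
  unfold SP SplusNorm
  refine (add3_le (S2_le_sq N _) (S2_le_sq N _) (S2_le_sq N _)).trans ?_
  exact (add_le_add (sq_add_le _ _) le_rfl).trans (sq_add_le _ _)

lemma Splus_sq_le (N : ℕ) (F : FunRT) : SplusNorm N F ^ 2 ≤ 8 * SP N F := by
  unfold SplusNorm
  calc _ ≤ 2 * ((Snorm N F + Snorm N (opL F)) ^ 2 + Snorm N (xMul F) ^ 2) := add_sq_le _ _
    _ ≤ 2 * (2 * (Snorm N F ^ 2 + Snorm N (opL F) ^ 2) + 2 * Snorm N (xMul F) ^ 2) :=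
      mul_le_mul_right (add_le_add (add_sq_le _ _) (le_mul_of_one_le_left zero_le (by norm_num))) _
    _ = 4 * (Snorm N F ^ 2 + Snorm N (opL F) ^ 2 + Snorm N (xMul F) ^ 2) := by ring
    _ ≤ 4 * (2 * S2 N F + 2 * S2 N (opL F) + 2 * S2 N (xMul F)) :=
      mul_le_mul_right (add3_le (Snorm_sq_le N _) (Snorm_sq_le N _) (Snorm_sq_le N _)) _
    _ = _ := by unfold SP; ring

lemma le_of_sq {a K d M : ℝ≥0∞} (h : a ^ 2 ≤ K * d ^ 2 * M ^ 2) : a ≤ K ^ (1 / 2 : ℝ) * d * M := by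
  have e : K * d ^ 2 * M ^ 2 = (K ^ (1 / 2 : ℝ) * d * M) ^ 2 := by
    rw [mul_pow, mul_pow, sq (K ^ (1 / 2 : ℝ)), half_mul_half]
  rw [e] at h
  exact (ENNReal.pow_le_pow_left_iff two_ne_zero).1 h

lemma del_le {K : ℝ≥0∞} (hK : K ≠ ∞) {C : ℝ} (hC : K.toReal * CA ≤ C) (t : ℝ) :
    K * del t ≤ ENNReal.ofReal (C * (1 + |t|)⁻¹) := by
  unfold del
  conv_lhs => rw [← ENNReal.ofReal_toReal hK]
  rw [← ENNReal.ofReal_mul ENNReal.toReal_nonneg, ← mul_assoc]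
  exact ENNReal.ofReal_le_ofReal (mul_le_mul_of_nonneg_right hC (by positivity))

theorem main (N : ℕ) (hN : 13 ≤ N) : ∃ C : ℝ, 0 < C ∧ ∀ t : ℝ,
    (∀ F G H : FunRT, Snorm N (Nt t F G H) ≤
      ENNReal.ofReal (C * (1 + |t|)⁻¹) * (Snorm N F * Snorm N G * Snorm N H)) ∧
    (∀ F₁ F₂ F₃ : FunRT, SplusNorm N (Nt t F₁ F₂ F₃) ≤ ENNReal.ofReal (C * (1 + |t|)⁻¹) *
      max (SplusNorm N F₁ * Snorm N F₂ * Snorm N F₃)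
        (max (SplusNorm N F₂ * Snorm N F₁ * Snorm N F₃) (SplusNorm N F₃ * Snorm N F₁ * Snorm N F₂))) := by
  obtain ⟨C1, h1, H1⟩ := US N (by omega)
  obtain ⟨C2, h2, H2⟩ := UP N (by omega)
  have k1 : (2 * C1) ^ (1 / 2 : ℝ) ≠ ∞ := ENNReal.rpow_ne_top_of_nonneg (by norm_num) (by finiteness)
  have k2 : (24 * C2) ^ (1 / 2 : ℝ) ≠ ∞ := ENNReal.rpow_ne_top_of_nonneg (by norm_num) (by finiteness)
  have p0 := CA_pos
  have p1 : 0 ≤ ((2 * C1) ^ (1 / 2 : ℝ)).toReal * CA := by positivity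
  have p2 : 0 ≤ ((24 * C2) ^ (1 / 2 : ℝ)).toReal * CA := by positivity
  refine ⟨((2 * C1) ^ (1 / 2 : ℝ)).toReal * CA + ((24 * C2) ^ (1 / 2 : ℝ)).toReal * CA + 1, by linarith,
    fun t => ⟨fun F G H => ?_, fun F G H => ?_⟩⟩
  · refine le_trans (le_of_sq (K := 2 * C1) (d := del t) ?_) (mul_le_mul_left (del_le k1 (by linarith) t) _)
    refine (Snorm_sq_le N _).trans ((mul_le_mul_right (H1 t F G H) _).trans ?_)
    calc _ = 2 * C1 * del t ^ 2 * (S2 N F * S2 N G * S2 N H) := by ring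
      _ ≤ 2 * C1 * del t ^ 2 * (Snorm N F ^ 2 * Snorm N G ^ 2 * Snorm N H ^ 2) :=
        mul_le_mul_right (mul_le_mul' (mul_le_mul' (S2_le_sq N F) (S2_le_sq N G)) (S2_le_sq N H)) _
      _ = _ := by ring
  · refine le_trans (le_of_sq (K := 24 * C2) (d := del t) ?_) (mul_le_mul_left (del_le k2 (by linarith) t) _)
    refine (Splus_sq_le N _).trans ((mul_le_mul_right (H2 t F G H) _).trans ?_)
    have q : ∀ (A B D : FunRT) (M : ℝ≥0∞), SplusNorm N A * Snorm N B * Snorm N D ≤ M →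
        SP N A * (S2 N B * S2 N D) ≤ M ^ 2 := by
      intro A B D M hM
      refine (mul_le_mul' (SP_le_sq N A) (mul_le_mul' (S2_le_sq N B) (S2_le_sq N D))).trans ?_
      rw [← mul_pow, ← mul_pow, ← mul_assoc]
      exact pow_le_pow_left₀ zero_le hM 2
    set M := max (SplusNorm N F * Snorm N G * Snorm N H)
        (max (SplusNorm N G * Snorm N F * Snorm N H) (SplusNorm N H * Snorm N F * Snorm N G)) with hM
    have q1 := q F G H M (le_max_left _ _)
    have q2 := q G F H M ((le_max_left _ _).trans (le_max_right _ _))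
    have q3 := q H F G M ((le_max_right _ _).trans (le_max_right _ _))
    calc _ ≤ 8 * (C2 * del t ^ 2 * (M ^ 2 + M ^ 2 + M ^ 2)) :=
          mul_le_mul_right (mul_le_mul_right (add3_le q1 q2 q3) _) _
      _ = _ := by ring

end NtProof

/-- **Bounds on the nonlinearity `N^t` in `S` and `S⁺`:**
`‖N^t[F,G,H]‖_S ≲ (1+|t|)⁻¹‖F‖_S‖G‖_S‖H‖_S` and
`‖N^t[F¹,F²,F³]‖_{S⁺} ≲ (1+|t|)⁻¹ max_{{j,k,ℓ}} ‖F^j‖_{S⁺}‖F^k‖_S‖F^ℓ‖_S`. -/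
theorem Nt_estimates (N : ℕ) (hN : 13 ≤ N) :
    ∃ C : ℝ, 0 < C ∧ ∀ t : ℝ,
      (∀ F G H : FunRT,
        Snorm N (Nt t F G H) ≤ ENNReal.ofReal (C * (1 + |t|)⁻¹) *
          (Snorm N F * Snorm N G * Snorm N H)) ∧
      (∀ F₁ F₂ F₃ : FunRT,
        SplusNorm N (Nt t F₁ F₂ F₃) ≤ ENNReal.ofReal (C * (1 + |t|)⁻¹) *
          max (SplusNorm N F₁ * Snorm N F₂ * Snorm N F₃)
            (max (SplusNorm N F₂ * Snorm N F₁ * Snorm N F₃)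
              (SplusNorm N F₃ * Snorm N F₁ * Snorm N F₂))) := NtProof.main N hN

end
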